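/- Let n be an even integer with n ≡ 0 (mod 8), let x ∈ S_n be a picky element of Type II, and let P be the unique Sylow 2-subgroup of S_n containing x. Then there exists a bijection Γ : Irr^x(S_n) → Irr^x(P) satisfying: (I) Γ(χ)(1)_2 = χ(1)_2 for every χ ∈ Irr^x(S_n); (II) Γ(χ)(x) = ±χ(x) for every χ ∈ Irr^x(S_n). Moreover, for H ∈ {S_n, P}: (a) if χ ∈ Irr_{2'}(H) then χ(x) = ±1; (b) if χ ∈ Irr^x(H) \ Irr_{2'}(H) then χ(x) = ±2. -/

import Mathlib

open CategoryTheory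

noncomputable section

/-- The set of irreducible complex characters of a group `G`. -/
def Irr (G : Type) [Group G] : Set (G → ℂ) :=
  {χ | ∃ V : FDRep ℂ G, Simple V ∧ V.character = χ}

/-- The irreducible characters of `G` that do not vanish at `g`. -/
def IrrX (G : Type) [Group G] (g : G) : Set (G → ℂ) :=
  {χ | χ ∈ Irr G ∧ χ g ≠ 0}

/-- The irreducible characters of `G` of degree not divisible by `p`. -/
def IrrP' (p : ℕ) (G : Type) [Group G] : Set (G → ℂ) :=
  {χ | ∃ V : FDRep ℂ G, Simple V ∧ V.character = χ ∧ ¬ (p ∣ Module.finrank ℂ V)}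

/-- The degree of a character, recovered from its value at `1`. -/
def charDeg {G : Type} [Group G] (χ : G → ℂ) : ℕ := ⌊(χ 1).re⌋₊

/-- The `p`-part of a natural number. -/
def pPart (p m : ℕ) : ℕ := p ^ (m.factorization p)

/-- `x` is a picky `p`-element: a `p`-element lying in a unique Sylow `p`-subgroup. -/
def IsPicky (p : ℕ) {G : Type*} [Group G] (x : G) : Prop :=
  (∃ k, orderOf x = p ^ k) ∧ ∃! Q : Sylow p G, x ∈ Q

/-- `H` is a normal subgroup of `K` (both subgroups of an ambient group `G`). -/
def NormalIn {G : Type*} [Group G] (H K : Subgroup G) : Prop :=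
  H ≤ K ∧ ∀ k ∈ K, ∀ h ∈ H, k * h * k⁻¹ ∈ H

/-- `H` is subnormal in `K`: there is a finite chain of subgroups from `H` to `K`,
each normal in the next. -/
def IsSubnormalIn {G : Type*} [Group G] (H K : Subgroup G) : Prop :=
  Relation.ReflTransGen NormalIn H K

/-- The subnormalizer of `x` in `G`: the subgroup generated by all `g` such that
`⟨x⟩` is subnormal in `⟨x, g⟩`. -/
def subnormalizer {G : Type*} [Group G] (x : G) : Subgroup G :=
  Subgroup.closure {g | IsSubnormalIn (Subgroup.zpowers x) (Subgroup.closure {x, g})}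

lemma mem_subnormalizer_self {G : Type*} [Group G] (x : G) : x ∈ subnormalizer x :=
  Subgroup.subset_closure (by
    show IsSubnormalIn (Subgroup.zpowers x) (Subgroup.closure {x, x})
    rw [Set.pair_eq_singleton, ← Subgroup.zpowers_eq_closure]
    exact Relation.ReflTransGen.refl)

/-- The full cycle type of a permutation of `Fin n`: the multiset of the lengths of
all its cycles, with fixed points counted as cycles of length `1`. -/
def fullCycleType {n : ℕ} (x : Equiv.Perm (Fin n)) : Multiset ℕ :=
  x.cycleType + Multiset.replicate (n - x.support.card) 1

/-- The multiset of cycle lengths of a `p`-adic element of `S_n`: `a_i` cycles of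
length `p ^ i`, where `n = Σ a_i p ^ i` is the `p`-adic expansion of `n`. -/
def padicCycleMultiset (p n : ℕ) : Multiset ℕ :=
  ∑ i ∈ Finset.range (Nat.digits p n).length,
    Multiset.replicate ((Nat.digits p n).getD i 0) (p ^ i)

/-- A `p`-adic element of `S_n`. -/
def IsPAdic (p : ℕ) {n : ℕ} (x : Equiv.Perm (Fin n)) : Prop :=
  fullCycleType x = padicCycleMultiset p n

/-- A picky element of Type II: a `2`-adic element on `n - 2` points together with
two fixed points. -/
def IsTypeII {n : ℕ} (x : Equiv.Perm (Fin n)) : Prop :=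
  fullCycleType x = padicCycleMultiset 2 (n - 2) + Multiset.replicate 2 1

/-- A picky element of Type III: a `3`-adic element on `n - 3` points together with
three fixed points. -/
def IsTypeIII {n : ℕ} (x : Equiv.Perm (Fin n)) : Prop :=
  fullCycleType x = padicCycleMultiset 3 (n - 3) + Multiset.replicate 3 1

namespace TypeII

section Characters

open Representation

variable {G : Type} [Group G]

lemma character_mem_Irr [Fintype G] {V : Type} [AddCommGroup V] [Module ℂ V]
    [FiniteDimensional ℂ V] (ρ : Representation ℂ G V)
    (h : ∑ g, ρ.character g * ρ.character g⁻¹ = Fintype.card G) : ρ.character ∈ Irr G := by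
  refine ⟨FDRep.of ρ, ?_, rfl⟩
  rw [FDRep.simple_iff_char_is_norm_one, Nat.card_eq_fintype_card]
  exact h

lemma character_mem_Irr_of_isIrreducible [Fintype G] {V : Type} [AddCommGroup V] [Module ℂ V]
    [FiniteDimensional ℂ V] (ρ : Representation ℂ G V) [IsIrreducible ρ] :
    ρ.character ∈ Irr G := by
  have hc : (Nat.card G : ℂ) ≠ 0 := Nat.cast_ne_zero.2 Nat.card_pos.ne'
  have := invertibleOfNonzero hc
  apply character_mem_Irr
  have := char_orthonormal ρ ρ
  rw [if_pos ⟨Representation.Equiv.refl ρ⟩, inv_mul_eq_iff_eq_mul₀ hc] at this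
  rw [this, Nat.card_eq_fintype_card, mul_one]

open scoped Classical in
lemma sum_mul_inv_of_mem_Irr [Fintype G] {χ ψ : G → ℂ} (hχ : χ ∈ Irr G) (hψ : ψ ∈ Irr G) :
    ∑ g, χ g * ψ g⁻¹ = if χ = ψ then (Fintype.card G : ℂ) else 0 := by
  obtain ⟨V, hV, rfl⟩ := hχ
  obtain ⟨W, hW, rfl⟩ := hψ
  have hc : (Nat.card G : ℂ) ≠ 0 := Nat.cast_ne_zero.2 Nat.card_pos.ne'
  have := invertibleOfNonzero hc
  have key := FDRep.char_orthonormal V W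
  rw [inv_mul_eq_iff_eq_mul₀ hc] at key
  have hV1 := (FDRep.simple_iff_char_is_norm_one V).1 hV
  rw [key, ← Nat.card_eq_fintype_card]
  split_ifs with h1 h2 h2
  · simp
  · exact absurd (FDRep.char_iso h1.some) h2
  · rw [if_neg h1, ← h2, hV1] at key
    simp at key
  · simp

/-- The character of a complex representation is a sum of irreducible characters. -/
lemma exists_multiset_irr [Fintype G] (n : ℕ) :
    ∀ {V : Type} [AddCommGroup V] [Module ℂ V] [FiniteDimensional ℂ V]
      (ρ : Representation ℂ G V), Module.finrank ℂ V = n →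
      ∃ s : Multiset (G → ℂ), (∀ χ ∈ s, χ ∈ Irr G) ∧ ρ.character = s.sum := by
  induction n using Nat.strong_induction_on with
  | _ n ih =>
    intro V _ _ _ ρ hn
    by_cases hirr : IsIrreducible ρ
    · exact ⟨{ρ.character}, by simpa using character_mem_Irr_of_isIrreducible ρ, by simp⟩
    by_cases h0 : Subsingleton V
    · refine ⟨0, by simp, ?_⟩
      ext g
      simp only [character, Multiset.sum_zero, Pi.zero_apply]
      rw [Subsingleton.elim (ρ g) 0, map_zero]
    rw [not_subsingleton_iff_nontrivial] at h0
    have hnt : Nontrivial (Subrepresentation ρ) := by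
      refine ⟨⊥, ⊤, fun h => ?_⟩
      have := congrArg Subrepresentation.toSubmodule h
      exact bot_ne_top this
    obtain ⟨σ, hσ0, hσ1⟩ : ∃ σ : Subrepresentation ρ, σ ≠ ⊥ ∧ σ ≠ ⊤ := by
      by_contra! hc
      exact hirr ⟨fun σ => or_iff_not_imp_left.2 (hc σ)⟩
    obtain ⟨τ, hτ⟩ := exists_isCompl σ
    have hco : IsCompl σ.toSubmodule τ.toSubmodule := by
      constructor
      · rw [disjoint_iff]
        exact congrArg Subrepresentation.toSubmodule (disjoint_iff.1 hτ.1)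
      · rw [codisjoint_iff]
        exact congrArg Subrepresentation.toSubmodule (codisjoint_iff.1 hτ.2)
    have hadd := Submodule.finrank_add_eq_of_isCompl hco
    have hσp : 0 < Module.finrank ℂ σ.toSubmodule := by
      rw [Module.finrank_pos_iff_exists_ne_zero]
      by_contra! hc
      apply hσ0
      apply Subrepresentation.toSubmodule_injective
      change _ = (⊥ : Submodule ℂ V)
      rw [Submodule.eq_bot_iff]
      intro x hx
      simpa using congrArg Subtype.val (hc ⟨x, hx⟩)
    have hσl : Module.finrank ℂ σ.toSubmodule < Module.finrank ℂ V := by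
      refine Submodule.finrank_lt fun h => hσ1 ?_
      apply Subrepresentation.toSubmodule_injective
      exact h
    obtain ⟨s, hs, hs'⟩ := ih _ (by omega) σ.toRepresentation rfl
    obtain ⟨t, ht, ht'⟩ := ih (Module.finrank ℂ τ.toSubmodule) (by omega) τ.toRepresentation rfl
    refine ⟨s + t, fun χ hχ => (Multiset.mem_add.1 hχ).elim (hs χ) (ht χ), ?_⟩
    rw [Multiset.sum_add, ← hs', ← ht']
    ext g
    let A : Bool → Submodule ℂ V := fun b => cond b σ.toSubmodule τ.toSubmodule
    have hA : DirectSum.IsInternal A := by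
      rw [DirectSum.isInternal_submodule_iff_isCompl A (i := true) (j := false) (by decide)
        (by ext b; cases b <;> simp)]
      exact hco
    have hmaps : ∀ b, Set.MapsTo (ρ g) (A b) (A b) := by
      rintro (_ | _) x hx
      · exact τ.apply_mem_toSubmodule g hx
      · exact σ.apply_mem_toSubmodule g hx
    have := LinearMap.trace_eq_sum_trace_restrict hA hmaps
    rw [Fintype.sum_bool] at this
    exact this

/-- A combination of characters that is orthogonal to every irreducible character has
norm zero. -/
lemma sum_mul_inv_eq_zero [Fintype G] {ι : Type} [Fintype ι] (c : ι → ℂ) (V : ι → Type)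
    [∀ i, AddCommGroup (V i)] [∀ i, Module ℂ (V i)] [∀ i, FiniteDimensional ℂ (V i)]
    (ρ : ∀ i, Representation ℂ G (V i)) (f : G → ℂ)
    (hf : ∀ g, f g = ∑ i, c i * (ρ i).character g)
    (h0 : ∀ χ ∈ Irr G, ∑ g, f g * χ g⁻¹ = 0) : ∑ g, f g * f g⁻¹ = 0 := by
  have key : ∀ i, ∑ g, f g * (ρ i).character g⁻¹ = 0 := by
    intro i
    obtain ⟨s, hs, hs'⟩ := exists_multiset_irr _ (ρ i) rfl
    rw [hs']
    clear hs'
    induction s using Multiset.induction_on with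
    | empty => simp
    | cons χ s ih =>
      simp only [Multiset.sum_cons, Pi.add_apply, mul_add, Finset.sum_add_distrib]
      rw [h0 χ (hs χ (by simp)), ih (fun χ hχ => hs χ (by simp [hχ])), add_zero]
  calc ∑ g, f g * f g⁻¹ = ∑ g, ∑ i, c i * (f g * (ρ i).character g⁻¹) := by
        refine Finset.sum_congr rfl fun g _ => ?_
        rw [hf g⁻¹, Finset.mul_sum]
        exact Finset.sum_congr rfl fun i _ => by ring
    _ = 0 := by
        rw [Finset.sum_comm]
        simp [← Finset.mul_sum, key]

lemma exists_int_sum_mul_inv [Fintype G] {V : Type} [AddCommGroup V] [Module ℂ V]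
    [FiniteDimensional ℂ V] (ρ : Representation ℂ G V) {χ : G → ℂ} (hχ : χ ∈ Irr G) :
    ∃ a : ℤ, ∑ g, ρ.character g * χ g⁻¹ = Fintype.card G * a := by
  obtain ⟨s, hs, hs'⟩ := exists_multiset_irr _ ρ rfl
  rw [hs']
  clear hs'
  induction s using Multiset.induction_on with
  | empty => exact ⟨0, by simp⟩
  | cons ψ s ih =>
    obtain ⟨a, ha⟩ := ih (fun χ hχ => hs χ (by simp [hχ]))
    simp only [Multiset.sum_cons, Pi.add_apply, add_mul, Finset.sum_add_distrib]
    rw [ha, sum_mul_inv_of_mem_Irr (hs ψ (by simp)) hχ]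
    split_ifs
    · exact ⟨1 + a, by push_cast; ring⟩
    · exact ⟨a, by simp⟩

lemma apply_conj_of_mem_Irr {χ : G → ℂ} (hχ : χ ∈ Irr G) (g h : G) : χ (h * g * h⁻¹) = χ g := by
  obtain ⟨V, -, rfl⟩ := hχ
  exact FDRep.char_conj V g h

lemma exists_apply_one_of_mem_Irr {χ : G → ℂ} (hχ : χ ∈ Irr G) :
    ∃ n : ℕ, 0 < n ∧ χ 1 = n := by
  obtain ⟨V, hV, rfl⟩ := hχ
  refine ⟨Module.finrank ℂ V, ?_, FDRep.char_one V⟩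
  by_contra! h0
  have : Subsingleton V := Module.finrank_zero_iff.1 (Nat.le_zero.1 h0)
  refine id_nonzero V ?_
  ext x
  exact Subsingleton.elim (α := V) _ _

/-- A character of odd degree does not vanish on elements of `2`-power order. -/
lemma character_ne_zero_of_odd {k : ℕ} {x : G} (hx : x ^ 2 ^ k = 1) (V : FDRep ℂ G)
    (hV : ¬ 2 ∣ Module.finrank ℂ V) : V.character x ≠ 0 := by
  intro h0
  have hsp : (V.ρ x).charpoly.Splits := IsAlgClosed.splits _
  have htr : (V.ρ x).charpoly.roots.sum = 0 := by
    rw [← Module.End.trace_eq_sum_roots_charpoly_of_splits hsp]; exact h0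
  have hcard : (V.ρ x).charpoly.roots.card = Module.finrank ℂ V := by
    rw [← hsp.natDegree_eq_card_roots, LinearMap.charpoly_natDegree]
  have hroot : ∀ μ ∈ (V.ρ x).charpoly.roots, μ ^ 2 ^ k = 1 := by
    intro μ hμ
    have h1 := (Polynomial.mem_roots'.1 hμ).2
    rw [← Module.End.hasEigenvalue_iff_isRoot_charpoly] at h1
    obtain ⟨v, hv⟩ := h1.exists_hasEigenvector
    have h2 := hv.pow_apply (2 ^ k)
    rw [← map_pow, hx, map_one, Module.End.one_apply] at h2
    have h3 : (μ ^ 2 ^ k - 1) • v = 0 := by rw [sub_smul, ← h2, one_smul, sub_self]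
    exact sub_eq_zero.1 ((smul_eq_zero.1 h3).resolve_right hv.2)
  -- Frobenius modulo two in the ring of algebraic integers
  have key : ∀ s : Multiset ℂ, (∀ μ ∈ s, μ ^ 2 ^ k = 1) →
      ∃ z : ℂ, IsIntegral ℤ z ∧ s.sum ^ 2 ^ k = s.card + 2 * z ∧ IsIntegral ℤ s.sum := by
    intro s
    induction s using Multiset.induction_on with
    | empty => exact fun _ => ⟨0, isIntegral_zero, by simp, by simpa using isIntegral_zero⟩
    | cons a s ih =>
      intro hs
      obtain ⟨z, hz, h1, h2⟩ := ih (fun μ hμ => hs μ (by simp [hμ]))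
      have ha : a ^ 2 ^ k = 1 := hs a (by simp)
      have hai : IsIntegral ℤ a :=
        IsIntegral.of_pow (n := 2 ^ k) (by positivity) (by rw [ha]; exact isIntegral_one)
      let R := integralClosure ℤ ℂ
      obtain ⟨w, hw⟩ := exists_add_pow_prime_pow_eq Nat.prime_two (⟨a, hai⟩ : R) ⟨s.sum, h2⟩ k
      have hw' := congrArg (algebraMap R ℂ) hw
      simp only [map_add, map_mul, map_pow] at hw'
      change (a + s.sum) ^ 2 ^ k = a ^ 2 ^ k + s.sum ^ 2 ^ k +
        algebraMap R ℂ _ * a * s.sum * w at hw'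
      refine ⟨z + a * s.sum * w, hz.add ((hai.mul h2).mul w.2), ?_, ?_⟩
      · rw [Multiset.sum_cons, hw', ha, h1, Multiset.card_cons]
        rw [show algebraMap R ℂ ((2 : ℕ) : R) = 2 from map_ofNat _ 2]
        push_cast
        ring
      · rw [Multiset.sum_cons]; exact hai.add h2
  obtain ⟨z, hz, h1, -⟩ := key _ hroot
  rw [htr, zero_pow (by positivity), hcard] at h1
  have hz' : z = algebraMap ℚ ℂ (-(Module.finrank ℂ V : ℚ) / 2) := by
    simp only [eq_ratCast]
    push_cast
    linear_combination -h1 / 2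
  have hz2 : IsIntegral ℤ (-(Module.finrank ℂ V : ℚ) / 2) := by
    rw [hz'] at hz
    exact (isIntegral_algebraMap_iff (algebraMap ℚ ℂ).injective).1 hz
  obtain ⟨m, hm⟩ := IsIntegrallyClosed.isIntegral_iff.1 hz2
  apply hV
  have : (Module.finrank ℂ V : ℤ) = 2 * (-m) := by
    have h3 : (m : ℚ) = -(Module.finrank ℂ V : ℚ) / 2 := by simpa using hm
    have : (Module.finrank ℂ V : ℚ) = 2 * (-m) := by rw [h3]; ring
    exact_mod_cast this
  omega

end Characters

section Profiles

open Representation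

/-- The order of the centralizer of `x`. -/
def cent {G : Type} [Group G] (x : G) : ℕ := Nat.card {h : G // h * x = x * h}

/-- The number of elements conjugating `x` to `y`. -/
def conjCount {G : Type} [Group G] (x y : G) : ℕ := Nat.card {h : G // h * x * h⁻¹ = y}

lemma conjCount_self {G : Type} [Group G] (x : G) : conjCount x x = cent x :=
  Nat.card_congr (Equiv.subtypeEquivRight fun h => by rw [mul_inv_eq_iff_eq_mul])

lemma conjCount_eq_zero {G : Type} [Group G] {x y : G} (h : ¬ IsConj x y) :
    conjCount x y = 0 := by
  have : IsEmpty {h : G // h * x * h⁻¹ = y} := ⟨fun g => h (isConj_iff.2 ⟨g.1, g.2⟩)⟩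
  exact Nat.card_of_isEmpty

lemma conjCount_conj {G : Type} [Group G] (x y g : G) :
    conjCount x (g * y * g⁻¹) = conjCount x y := by
  refine Nat.card_congr ⟨fun h => ⟨g⁻¹ * h.1, ?_⟩, fun h => ⟨g * h.1, ?_⟩, fun h => ?_, fun h => ?_⟩
  · have := h.2
    calc g⁻¹ * h.1 * x * (g⁻¹ * h.1)⁻¹ = g⁻¹ * (h.1 * x * h.1⁻¹) * g := by group
      _ = y := by rw [this]; group
  · have := h.2
    calc g * h.1 * x * (g * h.1)⁻¹ = g * (h.1 * x * h.1⁻¹) * g⁻¹ := by group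
      _ = _ := by rw [this]
  · simp
  · simp

lemma conjCount_of_isConj {G : Type} [Group G] {x y : G} (h : IsConj x y) :
    conjCount x y = cent x := by
  obtain ⟨g, rfl⟩ := isConj_iff.1 h
  rw [conjCount_conj, conjCount_self]

lemma sum_conjCount_mul {G : Type} [Group G] [Fintype G] {R : Type} [CommRing R] (x : G)
    (f : G → R) (hf : ∀ g h, f (h * g * h⁻¹) = f g) :
    ∑ y, (conjCount x y : R) * f y = Fintype.card G * f x := by
  classical
  have : ∀ y, (conjCount x y : R) * f y = ∑ h : G, if h * x * h⁻¹ = y then f y else 0 := by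
    intro y
    rw [conjCount, Nat.card_eq_fintype_card, Fintype.card_subtype, Finset.card_eq_sum_ones,
      Nat.cast_sum, Finset.sum_mul, Finset.sum_filter]
    simp
  simp_rw [this]
  rw [Finset.sum_comm]
  simp [hf]

variable {G : Type} [Group G]

lemma sum_mul_of_irr [Fintype G] {e f : G → ℤ} [Decidable (e = f)]
    (he : (fun g => (e g : ℂ)) ∈ Irr G)
    (hf : (fun g => (f g : ℂ)) ∈ Irr G) (hinv : ∀ g, f g⁻¹ = f g) :
    ∑ g, e g * f g = if e = f then (Fintype.card G : ℤ) else 0 := by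
  classical
  have h := sum_mul_inv_of_mem_Irr he hf
  have h2 : ((fun g => (e g : ℂ)) = fun g => (f g : ℂ)) ↔ e = f := by
    simp [funext_iff]
  simp only [h2, hinv] at h
  have : ((∑ g, e g * f g : ℤ) : ℂ) = ((if e = f then (Fintype.card G : ℤ) else 0 : ℤ) : ℂ) := by
    push_cast
    exact h
  exact_mod_cast this

lemma intClass {e : G → ℤ} (he : (fun g => (e g : ℂ)) ∈ Irr G) (g h : G) :
    e (h * g * h⁻¹) = e g := by
  exact_mod_cast apply_conj_of_mem_Irr he g h

section Bessel

variable [Fintype G] {I : Type} [Fintype I] {e : I → G → ℤ}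

lemma bessel_identity (he : Function.Injective e)
    (hirr : ∀ i, (fun g => (e i g : ℂ)) ∈ Irr G) (hinv : ∀ i g, e i g⁻¹ = e i g) (x : G) :
    ∑ g, ((conjCount x g : ℤ) - ∑ i, e i x * e i g) ^ 2
      = Fintype.card G * (cent x - ∑ i, (e i x) ^ 2) := by
  classical
  have h1 : ∑ g, (conjCount x g : ℤ) * conjCount x g = Fintype.card G * cent x := by
    rw [sum_conjCount_mul x (fun g => (conjCount x g : ℤ))
      (fun g h => by simp only [conjCount_conj]), conjCount_self]
  have h2 : ∑ g, (conjCount x g : ℤ) * ∑ i, e i x * e i g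
      = Fintype.card G * ∑ i, (e i x) ^ 2 := by
    rw [sum_conjCount_mul x (fun g => ∑ i, e i x * e i g)
      (fun g h => Finset.sum_congr rfl fun i _ => by rw [intClass (hirr i)])]
    simp_rw [sq]
  have h3 : ∑ g, (∑ i, e i x * e i g) * (∑ i, e i x * e i g)
      = Fintype.card G * ∑ i, (e i x) ^ 2 := by
    calc ∑ g, (∑ i, e i x * e i g) * (∑ i, e i x * e i g)
        = ∑ i, ∑ j, (e i x * e j x) * ∑ g, e i g * e j g := by
          simp_rw [Finset.sum_mul_sum, Finset.mul_sum]
          rw [Finset.sum_comm]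
          refine Finset.sum_congr rfl fun i _ => ?_
          rw [Finset.sum_comm]
          refine Finset.sum_congr rfl fun j _ => Finset.sum_congr rfl fun g _ => by ring
      _ = _ := by
          simp_rw [sum_mul_of_irr (hirr _) (hirr _) (hinv _), he.eq_iff]
          simp only [mul_ite, mul_zero, Finset.sum_ite_eq, Finset.mem_univ, if_true]
          rw [Finset.mul_sum]
          exact Finset.sum_congr rfl fun i _ => by ring
  calc _ = ∑ g, ((conjCount x g : ℤ) * conjCount x g
        - 2 * ((conjCount x g : ℤ) * ∑ i, e i x * e i g)
        + (∑ i, e i x * e i g) * (∑ i, e i x * e i g)) :=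
        Finset.sum_congr rfl fun g _ => by ring
    _ = _ := by
        rw [Finset.sum_add_distrib, Finset.sum_sub_distrib, ← Finset.mul_sum, h1, h2, h3]
        ring

lemma bessel_le (he : Function.Injective e)
    (hirr : ∀ i, (fun g => (e i g : ℂ)) ∈ Irr G) (hinv : ∀ i g, e i g⁻¹ = e i g) (x : G) :
    ∑ i, (e i x) ^ 2 ≤ cent x := by
  have h := bessel_identity he hirr hinv x
  have h0 : 0 ≤ ∑ g, ((conjCount x g : ℤ) - ∑ i, e i x * e i g) ^ 2 :=
    Finset.sum_nonneg fun g _ => sq_nonneg _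
  rw [h] at h0
  have := nonneg_of_mul_nonneg_right h0 (by exact_mod_cast Fintype.card_pos)
  linarith

lemma bessel_eq (he : Function.Injective e)
    (hirr : ∀ i, (fun g => (e i g : ℂ)) ∈ Irr G) (hinv : ∀ i g, e i g⁻¹ = e i g) (x : G)
    (hx : ∑ i, (e i x) ^ 2 = cent x) (g : G) :
    ∑ i, e i x * e i g = conjCount x g := by
  have h := bessel_identity he hirr hinv x
  rw [hx, sub_self, mul_zero, Finset.sum_eq_zero_iff_of_nonneg fun g _ => sq_nonneg _] at h
  have := h g (Finset.mem_univ _)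
  rw [sq_eq_zero_iff] at this
  linarith

lemma sum_mul_eq_zero_of_not_isConj (he : Function.Injective e)
    (hirr : ∀ i, (fun g => (e i g : ℂ)) ∈ Irr G) (hinv : ∀ i g, e i g⁻¹ = e i g) (x : G)
    (hx : ∑ i, (e i x) ^ 2 = cent x) {y : G} (hy : ¬ IsConj x y) :
    ∑ i, e i x * e i y = 0 := by
  rw [bessel_eq he hirr hinv x hx, conjCount_eq_zero hy, Nat.cast_zero]

lemma isConj_inv_of_bessel (he : Function.Injective e)
    (hirr : ∀ i, (fun g => (e i g : ℂ)) ∈ Irr G) (hinv : ∀ i g, e i g⁻¹ = e i g) (x : G)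
    (hx : ∑ i, (e i x) ^ 2 = cent x) :
    IsConj x x⁻¹ := by
  by_contra hc
  have h := sum_mul_eq_zero_of_not_isConj he hirr hinv x hx hc
  simp_rw [hinv, ← sq] at h
  rw [hx] at h
  have : 0 < cent x := by
    have : Nonempty {h : G // h * x = x * h} := ⟨⟨1, by simp⟩⟩
    exact Nat.card_pos
  omega

lemma exists_eq_of_apply_ne_zero (he : Function.Injective e)
    (hirr : ∀ i, (fun g => (e i g : ℂ)) ∈ Irr G) (hinv : ∀ i g, e i g⁻¹ = e i g) (x : G)
    (hx : ∑ i, (e i x) ^ 2 = cent x)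
    {χ : G → ℂ} (hχ : χ ∈ Irr G) (h0 : χ x ≠ 0) :
    ∃ i, χ = fun g => (e i g : ℂ) := by
  classical
  by_contra! hne
  apply h0
  have hcl : χ x⁻¹ = χ x := by
    obtain ⟨g, hg⟩ := isConj_iff.1 (isConj_inv_of_bessel he hirr hinv x hx)
    rw [← hg, apply_conj_of_mem_Irr hχ]
  have h1 : ∑ g, (conjCount x g : ℂ) * χ g⁻¹ = Fintype.card G * χ x⁻¹ :=
    sum_conjCount_mul x (fun g => χ g⁻¹) fun g h => by
      rw [← apply_conj_of_mem_Irr hχ g⁻¹ h]; congr 1; group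
  have h2 : ∑ g, (conjCount x g : ℂ) * χ g⁻¹ = 0 := by
    have : ∀ g, (conjCount x g : ℂ) = ∑ i, (e i x : ℂ) * e i g := fun g => by
      have := bessel_eq he hirr hinv x hx g
      exact_mod_cast this.symm
    simp_rw [this, Finset.sum_mul, mul_assoc]
    rw [Finset.sum_comm]
    refine Finset.sum_eq_zero fun i _ => ?_
    rw [← Finset.mul_sum, sum_mul_inv_of_mem_Irr (hirr i) hχ, if_neg (hne i).symm, mul_zero]
  rw [h1, hcl] at h2
  exact (mul_eq_zero.1 h2).resolve_left (by exact_mod_cast Fintype.card_ne_zero)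

end Bessel

/-- The irreducible characters of `G` that do not vanish at `x` are integer valued, take the
value `±1` at `x` if their degree is odd and `±2` otherwise, and exactly `f k` of them have a
degree whose `2`-part is `2 ^ k`. -/
def Prof (G : Type) [Group G] (x : G) (f : ℕ → ℕ) : Prop :=
  ∃ (I : Type) (_ : Fintype I) (e : I → G → ℤ) (d : I → ℕ),
    Function.Injective e ∧ (∀ i, (fun g => (e i g : ℂ)) ∈ Irr G) ∧
    (∀ i g, e i g⁻¹ = e i g) ∧ (∀ i, ∃ n : ℕ, e i 1 = n ∧ n.factorization 2 = d i) ∧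
    (∀ i, d i = 0 → |e i x| = 1) ∧ (∀ i, d i ≠ 0 → |e i x| = 2) ∧
    ∑ i, (e i x) ^ 2 = cent x ∧ ∀ k, Nat.card {i // d i = k} = f k

lemma comp_mulEquiv_mem_Irr {H : Type} [Group H] [Finite G] (φ : H ≃* G) {χ : G → ℂ}
    (hχ : χ ∈ Irr G) : (fun h => χ (φ h)) ∈ Irr H := by
  have := Fintype.ofFinite G
  have : Finite H := Finite.of_equiv _ φ.symm.toEquiv
  have := Fintype.ofFinite H
  have hn := sum_mul_inv_of_mem_Irr hχ hχ
  obtain ⟨V, hV, rfl⟩ := hχ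
  refine character_mem_Irr (V.ρ.comp φ.toMonoidHom) ?_
  rw [if_pos rfl] at hn
  rw [Fintype.card_congr φ.toEquiv, ← hn, ← φ.toEquiv.sum_comp]
  refine Finset.sum_congr rfl fun h _ => ?_
  change V.character (φ h) * V.character (φ h⁻¹) = V.character (φ h) * V.character (φ h)⁻¹
  rw [map_inv]

lemma cent_mulEquiv {H : Type} [Group H] (φ : H ≃* G) (x : H) : cent (φ x) = cent x := by
  refine (Nat.card_congr (φ.toEquiv.subtypeEquiv fun h => ?_)).symm
  change _ ↔ φ h * φ x = φ x * φ h
  rw [← map_mul, ← map_mul, φ.injective.eq_iff]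

lemma Prof.mulEquiv {H : Type} [Group H] [Finite G] {x : G} {f : ℕ → ℕ} (h : Prof G x f)
    (φ : G ≃* H) : Prof H (φ x) f := by
  obtain ⟨I, hI, e, d, h1, h2, h3, h4, h5, h6, h7, h8⟩ := h
  refine ⟨I, hI, fun i g => e i (φ.symm g), d, ?_, fun i => comp_mulEquiv_mem_Irr φ.symm (h2 i),
    fun i g => ?_, fun i => ?_, fun i hi => ?_, fun i hi => ?_, ?_, h8⟩
  · intro i j hij
    apply h1
    ext g
    simpa using congrFun hij (φ g)
  · simp only [map_inv, h3]
  · simpa using h4 i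
  · simpa using h5 i hi
  · simpa using h6 i hi
  · rw [cent_mulEquiv]
    simpa using h7

lemma Prof.of_isConj [Finite G] {x y : G} {f : ℕ → ℕ} (h : Prof G x f) (hxy : IsConj x y) :
    Prof G y f := by
  obtain ⟨g, rfl⟩ := isConj_iff.1 hxy
  exact h.mulEquiv (MulAut.conj g)

lemma hom_mem_Irr [Finite G] (θ : G →* ℤˣ) : (fun g => (((θ g : ℤˣ) : ℤ) : ℂ)) ∈ Irr G := by
  have := Fintype.ofFinite G
  let r : ℤ →+* (ℂ →ₗ[ℂ] ℂ) := Int.castRingHom _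
  let ρ : Representation ℂ G ℂ :=
    (r : ℤ →* (ℂ →ₗ[ℂ] ℂ)).comp ((Units.coeHom ℤ).comp θ)
  have hρ : ρ.character = fun g => (((θ g : ℤˣ) : ℤ) : ℂ) := by
    ext g
    change LinearMap.trace ℂ ℂ (((θ g : ℤˣ) : ℤ) : ℂ →ₗ[ℂ] ℂ) = _
    rcases Int.units_eq_one_or (θ g) with h | h <;> simp [h]
  rw [← hρ]
  apply character_mem_Irr
  rw [hρ]
  rw [Fintype.card_eq_sum_ones, Nat.cast_sum]
  refine Finset.sum_congr rfl fun g _ => ?_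
  rcases Int.units_eq_one_or (θ g) with h | h <;> simp [h]

/-- A homomorphism to `ℤˣ` as an integer-valued function. -/
def homChar (θ : G →* ℤˣ) (g : G) : ℤ := (θ g : ℤ)

lemma homChar_mem_Irr [Finite G] (θ : G →* ℤˣ) : (fun g => (homChar θ g : ℂ)) ∈ Irr G :=
  hom_mem_Irr θ

lemma homChar_injective : Function.Injective (homChar : (G →* ℤˣ) → G → ℤ) := by
  intro θ θ' h
  ext g
  exact congrFun h g

lemma homChar_inv (θ : G →* ℤˣ) (g : G) : homChar θ g⁻¹ = homChar θ g := by
  simp [homChar]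

lemma homChar_one (θ : G →* ℤˣ) : homChar θ 1 = 1 := by simp [homChar]

lemma homChar_eq (θ : G →* ℤˣ) (g : G) : homChar θ g = 1 ∨ homChar θ g = -1 := by
  rcases Int.units_eq_one_or (θ g) with h | h <;> simp [h, homChar]

lemma homChar_sq (θ : G →* ℤˣ) (g : G) : homChar θ g ^ 2 = 1 := by
  rcases homChar_eq θ g with h | h <;> simp [h]

lemma homChar_ne_zero (θ : G →* ℤˣ) (g : G) : homChar θ g ≠ 0 := by
  rcases homChar_eq θ g with h | h <;> simp [h]

instance [Finite G] : Finite (G →* ℤˣ) := 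
  Finite.of_injective (fun θ : G →* ℤˣ => (θ : G → ℤˣ)) DFunLike.coe_injective

/-- A group with as many homomorphisms to `ℤˣ` as the order of the centralizer of `c`. -/
def LinFull (G : Type) [Group G] (c : G) (m : ℕ) : Prop :=
  Nat.card (G →* ℤˣ) = m ∧ cent c = m

lemma LinFull.mk [Finite G] {c : G} {m : ℕ} (h1 : m ≤ Nat.card (G →* ℤˣ)) (h2 : cent c ≤ m) :
    LinFull G c m := by
  have := Fintype.ofFinite G
  have := Fintype.ofFinite (G →* ℤˣ)
  have h := bessel_le homChar_injective homChar_mem_Irr homChar_inv c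
  simp only [homChar_sq, Finset.sum_const, Finset.card_univ, nsmul_eq_mul, mul_one,
    ← Nat.card_eq_fintype_card] at h
  have h' : Nat.card (G →* ℤˣ) ≤ cent c := by exact_mod_cast h
  exact ⟨by omega, by omega⟩

lemma LinFull.sum_sq [Finite G] [Fintype (G →* ℤˣ)] {c : G} {m : ℕ} (h : LinFull G c m) :
    ∑ θ : G →* ℤˣ, homChar θ c ^ 2 = cent c := by
  simp [homChar_sq, ← Nat.card_eq_fintype_card, h.1, h.2]

end Profiles

section FullCycleType

open Equiv

variable {α β : Type} [Fintype α] [DecidableEq α] [Fintype β] [DecidableEq β]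

/-- The multiset of orbit sizes of a permutation. -/
def orbitSizes (σ : Perm α) : Multiset ℕ := σ.partition.parts

lemma orbitSizes_def (σ : Perm α) :
    orbitSizes σ = σ.cycleType + Multiset.replicate (Fintype.card α - σ.support.card) 1 := rfl

lemma sum_orbitSizes (σ : Perm α) : (orbitSizes σ).sum = Fintype.card α :=
  σ.partition.parts_sum

lemma pos_of_mem_orbitSizes {σ : Perm α} {k : ℕ} (h : k ∈ orbitSizes σ) : 0 < k :=
  σ.partition.parts_pos h

lemma isConj_iff_orbitSizes {σ τ : Perm α} : IsConj σ τ ↔ orbitSizes σ = orbitSizes τ := by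
  rw [Perm.partition_eq_of_isConj, Nat.Partition.ext_iff, orbitSizes, orbitSizes]

lemma orbitSizes_one : orbitSizes (1 : Perm α) = Multiset.replicate (Fintype.card α) 1 := by
  simp [orbitSizes_def]

lemma orbitSizes_permCongr (e : α ≃ β) (σ : Perm α) :
    orbitSizes (e.permCongr σ) = orbitSizes σ := by
  have h : e.permCongr σ =
      σ.extendDomain (e.trans (Equiv.subtypeUnivEquiv (p := fun _ : β => True)
        fun _ => trivial).symm) := by
    ext b
    rw [Perm.extendDomain_apply_subtype _ _ trivial]
    rfl
  have hc : (e.permCongr σ).cycleType = σ.cycleType := by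
    rw [h, Perm.cycleType_extendDomain]
  rw [orbitSizes_def, orbitSizes_def, ← Perm.sum_cycleType, ← Perm.sum_cycleType, hc,
    Fintype.card_congr e]

lemma cycleType_sumCongr_one (σ : Perm α) :
    (Perm.sumCongr σ (1 : Perm β)).cycleType = σ.cycleType := by
  let f : α ≃ {x : α ⊕ β // x.isLeft} :=
    ⟨fun a => ⟨.inl a, rfl⟩, fun x => x.1.getLeft x.2, fun a => rfl, fun x => by
      rcases x with ⟨a | b, h⟩
      · rfl
      · simp at h⟩
  have h : Perm.sumCongr σ (1 : Perm β) = σ.extendDomain f := by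
    ext x
    rcases x with a | b
    · exact (Perm.extendDomain_apply_image σ f a).symm
    · rw [Perm.extendDomain_apply_not_subtype _ _ (by simp)]
      rfl
  rw [h, Perm.cycleType_extendDomain]

lemma cycleType_sumCongr (σ : Perm α) (τ : Perm β) :
    (Perm.sumCongr σ τ).cycleType = σ.cycleType + τ.cycleType := by
  have h1 : Perm.sumCongr σ τ = Perm.sumCongr σ 1 * Perm.sumCongr 1 τ := by
    rw [Perm.sumCongr_mul]; simp
  have h2 : (Perm.sumCongr σ (1 : Perm β)).Disjoint (Perm.sumCongr (1 : Perm α) τ) := by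
    rintro (a | b)
    · right; simp
    · left; simp
  have h3 : Perm.sumCongr (1 : Perm α) τ
      = (Equiv.sumComm β α).permCongr (Perm.sumCongr τ (1 : Perm α)) := by
    ext (a | b) <;> simp
  have h4 : (Perm.sumCongr (1 : Perm α) τ).cycleType = τ.cycleType := by
    have h := orbitSizes_permCongr (Equiv.sumComm β α) (Perm.sumCongr τ (1 : Perm α))
    have h5 := congrArg (Multiset.filter fun n => 2 ≤ n) h
    rw [orbitSizes, orbitSizes, Perm.filter_parts_partition_eq_cycleType,
      Perm.filter_parts_partition_eq_cycleType, cycleType_sumCongr_one] at h5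
    rw [h3, h5]
  rw [h1, h2.cycleType_mul, cycleType_sumCongr_one, h4]

lemma orbitSizes_sumCongr (σ : Perm α) (τ : Perm β) :
    orbitSizes (Perm.sumCongr σ τ) = orbitSizes σ + orbitSizes τ := by
  have h1 := Perm.sum_cycleType_le σ
  have h2 := Perm.sum_cycleType_le τ
  simp only [orbitSizes_def, ← Perm.sum_cycleType, cycleType_sumCongr, Multiset.sum_add,
    Fintype.card_sum]
  rw [show Fintype.card α + Fintype.card β - (σ.cycleType.sum + τ.cycleType.sum)
    = (Fintype.card α - σ.cycleType.sum) + (Fintype.card β - τ.cycleType.sum) by omega,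
    Multiset.replicate_add]
  exact add_add_add_comm _ _ _ _

lemma one_mem_orbitSizes {σ : Perm α} (h : 1 ∈ orbitSizes σ) : ∃ a, σ a = a := by
  by_contra! hne
  have : σ.support = Finset.univ := by
    ext a; simp [hne a]
  rw [orbitSizes_def, this, Finset.card_univ, Nat.sub_self] at h
  simp only [Multiset.replicate_zero, add_zero] at h
  exact absurd (Perm.two_le_of_mem_cycleType h) (by norm_num)

lemma eq_singleton_of_card_mem {σ : Perm α} (h : Fintype.card α ∈ orbitSizes σ) :
    orbitSizes σ = {Fintype.card α} := by
  obtain ⟨t, ht⟩ := Multiset.exists_cons_of_mem h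
  have hs := sum_orbitSizes σ
  rw [ht, Multiset.sum_cons] at hs
  have h0 : t = 0 := by
    by_contra hne
    obtain ⟨k, hk⟩ := Multiset.exists_mem_of_ne_zero hne
    have h1 : 0 < k := pos_of_mem_orbitSizes (σ := σ)
      (by rw [ht]; exact Multiset.mem_cons_of_mem hk)
    have h2 := Multiset.le_sum_of_mem hk
    omega
  rw [ht, h0]
  rfl

lemma orbitSizes_finRotate (k : ℕ) : orbitSizes (finRotate (k + 1)) = {k + 1} := by
  rcases k with _ | k
  · have h : finRotate (0 + 1) = 1 := by
      ext i; fin_cases i; rfl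
    rw [h, orbitSizes_one]; rfl
  · rw [orbitSizes_def, cycleType_finRotate, support_finRotate]
    simp

lemma exists_orbitSizes_eq (M : Multiset ℕ) (hM : ∀ k ∈ M, 0 < k) (hs : M.sum = Fintype.card α) :
    ∃ σ : Perm α, orbitSizes σ = M := by
  have key : ∀ M : Multiset ℕ, (∀ k ∈ M, 0 < k) → ∃ σ : Perm (Fin M.sum), orbitSizes σ = M := by
    intro M
    induction M using Multiset.induction_on with
    | empty => exact fun _ => ⟨1, orbitSizes_one⟩
    | cons k M ih =>
      intro h
      obtain ⟨τ, hτ⟩ := ih fun j hj => h j (Multiset.mem_cons_of_mem hj)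
      obtain ⟨j, rfl⟩ := Nat.exists_eq_succ_of_ne_zero (h k (Multiset.mem_cons_self _ _)).ne'
      let e : Fin (j + 1) ⊕ Fin M.sum ≃ Fin ((j + 1) ::ₘ M).sum :=
        finSumFinEquiv.trans (finCongr (by rw [Multiset.sum_cons]))
      refine ⟨e.permCongr (Perm.sumCongr (finRotate (j + 1)) τ), ?_⟩
      rw [orbitSizes_permCongr, orbitSizes_sumCongr, orbitSizes_finRotate, hτ]
      rfl
  obtain ⟨σ, hσ⟩ := key M hM
  exact ⟨((finCongr hs).trans (Fintype.equivFin α).symm).permCongr σ,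
    by rw [orbitSizes_permCongr, hσ]⟩

end FullCycleType

section Products

variable {H K : Type} [Group H] [Group K]

lemma prod_mem_Irr [Finite H] [Finite K] {χ : H → ℂ} {ψ : K → ℂ} (hχ : χ ∈ Irr H)
    (hψ : ψ ∈ Irr K) : (fun p : H × K => χ p.1 * ψ p.2) ∈ Irr (H × K) := by
  have := Fintype.ofFinite H
  have := Fintype.ofFinite K
  have h1 := sum_mul_inv_of_mem_Irr hχ hχ
  have h2 := sum_mul_inv_of_mem_Irr hψ hψ
  rw [if_pos rfl] at h1 h2
  obtain ⟨V, hV, rfl⟩ := hχ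
  obtain ⟨W, hW, rfl⟩ := hψ
  let ρ : Representation ℂ (H × K) (TensorProduct ℂ V W) :=
    Representation.tprod (V.ρ.comp (MonoidHom.fst H K)) (W.ρ.comp (MonoidHom.snd H K))
  have hρ : ρ.character = fun p : H × K => V.character p.1 * W.character p.2 :=
    Representation.char_tensor _ _
  rw [← hρ]
  apply character_mem_Irr
  rw [hρ, Fintype.card_prod, Nat.cast_mul, ← h1, ← h2, Finset.sum_mul_sum, Fintype.sum_prod_type]
  refine Finset.sum_congr rfl fun a _ => Finset.sum_congr rfl fun b _ => ?_
  simp only [Prod.fst_inv, Prod.snd_inv]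
  ring

lemma cent_prod [Finite H] [Finite K] (h : H) (k : K) : cent (h, k) = cent h * cent k := by
  rw [cent, cent, cent, ← Nat.card_prod]
  refine Nat.card_congr ⟨fun p => (⟨p.1.1, congrArg Prod.fst p.2⟩, ⟨p.1.2, congrArg Prod.snd p.2⟩),
    fun p => ⟨(p.1.1, p.2.1), Prod.ext p.1.2 p.2.2⟩, fun p => rfl, fun p => rfl⟩

lemma Prof.prod [Finite H] [Finite K] {h : H} {k : K} {m : ℕ} {f : ℕ → ℕ} (hH : LinFull H h m)
    (hK : Prof K k f) : Prof (H × K) (h, k) (fun j => m * f j) := by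
  obtain ⟨I, hI, e, d, h1, h2, h3, h4, h5, h6, h7, h8⟩ := hK
  have := Fintype.ofFinite (H →* ℤˣ)
  refine ⟨(H →* ℤˣ) × I, inferInstance, fun i p => homChar i.1 p.1 * e i.2 p.2, fun i => d i.2,
    ?_, fun i => ?_, fun i p => ?_, fun i => ?_, fun i hi => ?_, fun i hi => ?_, ?_, fun j => ?_⟩
  · rintro ⟨θ, i⟩ ⟨θ', i'⟩ hii
    have hi : i = i' := by
      apply h1
      ext g
      simpa [homChar_one] using congrFun hii (1, g)
    subst hi
    have : θ = θ' := by
      apply homChar_injective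
      ext g
      have hg := congrFun hii (g, k)
      have hne : e i k ≠ 0 := by
        rcases eq_or_ne (d i) 0 with h0 | h0
        · have := h5 i h0
          intro h; simp [h] at this
        · have := h6 i h0
          intro h; simp [h] at this
      exact mul_right_cancel₀ hne hg
    rw [this]
  · have := prod_mem_Irr (homChar_mem_Irr i.1) (h2 i.2)
    push_cast
    exact this
  · simp only [Prod.fst_inv, Prod.snd_inv, homChar_inv, h3]
  · obtain ⟨n, hn, hn'⟩ := h4 i.2
    exact ⟨n, by simp [homChar_one, hn], hn'⟩
  · rcases homChar_eq i.1 h with h' | h' <;> simp [h', h5 i.2 hi]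
  · rcases homChar_eq i.1 h with h' | h' <;> simp [h', h6 i.2 hi]
  · simp only [mul_pow, homChar_sq, one_mul]
    rw [Fintype.sum_prod_type, cent_prod]
    simp [h7, hH.2, ← Nat.card_eq_fintype_card, hH.1]
  · change _ = m * f j
    rw [← h8 j, ← hH.1, ← Nat.card_prod]
    exact Nat.card_congr ⟨fun p => (p.1.1, ⟨p.1.2, p.2⟩), fun p => ⟨(p.1, p.2.1), p.2.2⟩,
      fun p => rfl, fun p => rfl⟩

end Products

section Wreath

lemma trace_prodMap_mul_swap {U : Type} [AddCommGroup U] [Module ℂ U] [FiniteDimensional ℂ U]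
    (A B : Module.End ℂ U) : LinearMap.trace ℂ (U × U)
      ((A.prodMap B) * ((LinearMap.snd ℂ U U).prod (LinearMap.fst ℂ U U))) = 0 := by
  have : (A.prodMap B) * ((LinearMap.snd ℂ U U).prod (LinearMap.fst ℂ U U)) =
      LinearMap.inl ℂ U U ∘ₗ (A ∘ₗ LinearMap.snd ℂ U U) +
      LinearMap.inr ℂ U U ∘ₗ (B ∘ₗ LinearMap.fst ℂ U U) := by
    ext u <;> simp
  have e1 : (A ∘ₗ LinearMap.snd ℂ U U) ∘ₗ LinearMap.inl ℂ U U = 0 := by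
    ext u; simp
  have e2 : (B ∘ₗ LinearMap.fst ℂ U U) ∘ₗ LinearMap.inr ℂ U U = 0 := by
    ext u; simp
  rw [this, map_add, LinearMap.trace_comp_comm', LinearMap.trace_comp_comm' _ (LinearMap.inr ℂ U U),
    e1, e2]
  simp

/-- The wreath product of `Q` with the group of order two. -/
@[ext] structure Wr (Q : Type) where
  /-- the first base coordinate -/
  a : Q
  /-- the second base coordinate -/
  b : Q
  /-- whether the two coordinates are swapped -/
  s : Bool

namespace Wr

variable {Q : Type}

/-- The underlying set of `Wr Q`. -/
def equivProd : Wr Q ≃ Q × Q × Bool :=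
  ⟨fun g => (g.a, g.b, g.s), fun p => ⟨p.1, p.2.1, p.2.2⟩, fun _ => rfl, fun _ => rfl⟩

instance [Fintype Q] : Fintype (Wr Q) := Fintype.ofEquiv _ equivProd.symm

instance [Finite Q] : Finite (Wr Q) := Finite.of_equiv _ equivProd.symm

lemma nat_card : Nat.card (Wr Q) = 2 * Nat.card Q ^ 2 := by
  rw [Nat.card_congr equivProd, Nat.card_prod, Nat.card_prod]
  simp; ring

lemma sum_eq [Fintype Q] {R : Type} [AddCommMonoid R] (F : Wr Q → R) :
    ∑ g, F g = ∑ a, ∑ b, (F ⟨a, b, false⟩ + F ⟨a, b, true⟩) := by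
  rw [← equivProd.symm.sum_comp, Fintype.sum_prod_type]
  refine Finset.sum_congr rfl fun a _ => ?_
  rw [Fintype.sum_prod_type]
  refine Finset.sum_congr rfl fun b _ => ?_
  rw [Fintype.sum_bool, add_comm]
  rfl

variable [Group Q]

instance : Mul (Wr Q) := ⟨fun g h =>
  ⟨g.a * (bif g.s then h.b else h.a), g.b * (bif g.s then h.a else h.b), xor g.s h.s⟩⟩

instance : One (Wr Q) := ⟨⟨1, 1, false⟩⟩

instance : Inv (Wr Q) := ⟨fun g =>
  ⟨bif g.s then g.b⁻¹ else g.a⁻¹, bif g.s then g.a⁻¹ else g.b⁻¹, g.s⟩⟩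

lemma mul_def (g h : Wr Q) : g * h =
  ⟨g.a * (bif g.s then h.b else h.a), g.b * (bif g.s then h.a else h.b), xor g.s h.s⟩ := rfl

lemma one_def : (1 : Wr Q) = ⟨1, 1, false⟩ := rfl

lemma inv_def (g : Wr Q) : g⁻¹ =
  ⟨bif g.s then g.b⁻¹ else g.a⁻¹, bif g.s then g.a⁻¹ else g.b⁻¹, g.s⟩ := rfl

instance : Group (Wr Q) := Group.ofLeftAxioms
  (by rintro ⟨a, b, _ | _⟩ ⟨a', b', _ | _⟩ ⟨a'', b'', _ | _⟩ <;> simp [mul_def, mul_assoc])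
  (by rintro ⟨a, b, _ | _⟩ <;> simp [mul_def, one_def])
  (by rintro ⟨a, b, _ | _⟩ <;> simp [mul_def, one_def, inv_def])

/-- A homomorphism out of a wreath product from its values on the base and on the swap. -/
def lift {M : Type} [Monoid M] (f : Q × Q →* M) (T : M) (hT : T * T = 1)
    (hf : ∀ a b, T * f (a, b) = f (b, a) * T) : Wr Q →* M where
  toFun g := f (g.a, g.b) * (bif g.s then T else 1)
  map_one' := by
    simp only [one_def, cond_false, mul_one]
    exact map_one f
  map_mul' := by
    rintro ⟨a, b, s⟩ ⟨a', b', s'⟩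
    have h : ∀ x y x' y', f (x * x', y * y') = f (x, y) * f (x', y') := fun x y x' y' => by
      rw [← map_mul]; rfl
    cases s <;> cases s' <;> simp only [mul_def, cond_true, cond_false, Bool.xor_true,
      Bool.xor_false, Bool.not_true, Bool.not_false, mul_one, h]
    · rw [mul_assoc]
    · rw [mul_assoc, mul_assoc, hf]
    · rw [mul_assoc, ← mul_assoc T, hf, mul_assoc (f (b', a')), hT, mul_one]

lemma cent_base [Finite Q] {c y : Q} (h : ¬ IsConj c y) :
    cent (⟨c, y, false⟩ : Wr Q) = cent c * cent y := by
  rw [cent, cent, cent, ← Nat.card_prod]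
  have key : ∀ g : Wr Q, g * ⟨c, y, false⟩ = ⟨c, y, false⟩ * g ↔
      g.s = false ∧ g.a * c = c * g.a ∧ g.b * y = y * g.b := by
    rintro ⟨a, b, _ | _⟩
    · simp [mul_def]
    · simp only [mul_def, cond_true, cond_false, mk.injEq]
      refine ⟨fun h' => absurd (isConj_iff.2 ⟨a⁻¹, ?_⟩) h, fun h' => by simp at h'⟩
      rw [inv_inv, mul_assoc, ← h'.1, inv_mul_cancel_left]
  refine Nat.card_congr ⟨fun p => (⟨p.1.a, ((key _).1 p.2).2.1⟩, ⟨p.1.b, ((key _).1 p.2).2.2⟩),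
    fun p => ⟨⟨p.1.1, p.2.1, false⟩, (key _).2 ⟨rfl, p.1.2, p.2.2⟩⟩, fun p => ?_, fun p => rfl⟩
  apply Subtype.ext
  apply Wr.ext
  · rfl
  · rfl
  · exact ((key _).1 p.2).1.symm

/-- The linear character of a wreath product extending `θ × θ`. -/
def linHom (p : (Q →* ℤˣ) × Bool) : Wr Q →* ℤˣ :=
  lift ((p.1.comp (MonoidHom.fst Q Q)) * (p.1.comp (MonoidHom.snd Q Q)))
    (bif p.2 then -1 else 1) (by cases p.2 <;> rfl)
    (fun a b => by
      simp only [MonoidHom.mul_apply, MonoidHom.comp_apply, MonoidHom.coe_fst, MonoidHom.coe_snd]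
      rw [mul_comm, mul_comm (p.1 a)])

lemma linHom_apply (p : (Q →* ℤˣ) × Bool) (g : Wr Q) :
    linHom p g = p.1 g.a * p.1 g.b * (bif g.s then (bif p.2 then -1 else 1) else 1) := rfl

lemma linHom_injective : Function.Injective (linHom : (Q →* ℤˣ) × Bool → Wr Q →* ℤˣ) := by
  rintro ⟨θ, s⟩ ⟨θ', s'⟩ h
  have h1 : θ = θ' := by
    ext g
    have := DFunLike.congr_fun h ⟨g, 1, false⟩
    simp only [linHom_apply, cond_false, map_one, mul_one] at this
    rw [this]
  have h2 := DFunLike.congr_fun h ⟨1, 1, true⟩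
  simp only [linHom_apply, cond_true, map_one, mul_one, one_mul] at h2
  rw [h1]
  cases s <;> cases s' <;> simp at h2 ⊢

lemma card_hom_le [Finite Q] : 2 * Nat.card (Q →* ℤˣ) ≤ Nat.card (Wr Q →* ℤˣ) := by
  have := Nat.card_le_card_of_injective _ (linHom_injective (Q := Q))
  rw [Nat.card_prod] at this
  simpa [mul_comm] using this

/-- The class function on `Wr Q` induced from `α × β`. -/
def pairFun {R : Type} [CommRing R] (α β : Q → R) (g : Wr Q) : R :=
  bif g.s then 0 else α g.a * β g.b + β g.a * α g.b

lemma pairFun_mem_Irr [Finite Q] {α β : Q → ℂ} (hα : α ∈ Irr Q) (hβ : β ∈ Irr Q) (hne : α ≠ β) :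
    pairFun α β ∈ Irr (Wr Q) := by
  have := Fintype.ofFinite Q
  have h1 := sum_mul_inv_of_mem_Irr hα hα
  have h2 := sum_mul_inv_of_mem_Irr hβ hβ
  have h3 := sum_mul_inv_of_mem_Irr hα hβ
  have h4 := sum_mul_inv_of_mem_Irr hβ hα
  rw [if_pos rfl] at h1 h2
  rw [if_neg hne] at h3
  rw [if_neg hne.symm] at h4
  obtain ⟨V, hV, rfl⟩ := hα
  obtain ⟨W, hW, rfl⟩ := hβ
  let U := TensorProduct ℂ V W
  let π : Representation ℂ (Q × Q) U :=
    Representation.tprod (V.ρ.comp (MonoidHom.fst Q Q)) (W.ρ.comp (MonoidHom.snd Q Q))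
  let π' : Representation ℂ (Q × Q) U :=
    Representation.tprod (V.ρ.comp (MonoidHom.snd Q Q)) (W.ρ.comp (MonoidHom.fst Q Q))
  have hπ : ∀ a b, π.character (a, b) = V.character a * W.character b := fun a b =>
    congrFun (Representation.char_tensor _ _) (a, b)
  have hπ' : ∀ a b, π'.character (a, b) = V.character b * W.character a := fun a b =>
    congrFun (Representation.char_tensor _ _) (a, b)
  have hsw : ∀ a b, π' (a, b) = π (b, a) := fun a b => rfl
  let T : Module.End ℂ (U × U) := (LinearMap.snd ℂ U U).prod (LinearMap.fst ℂ U U)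
  let ρ : Representation ℂ (Wr Q) (U × U) := lift (Representation.prod π π') T
    (LinearMap.ext fun u => rfl) (fun a b => LinearMap.ext fun u => rfl)
  have hρ : ρ.character = pairFun V.character W.character := by
    ext ⟨a, b, _ | _⟩
    · change LinearMap.trace ℂ (U × U) (((π (a, b)).prodMap (π' (a, b))) * 1) = _
      rw [mul_one, LinearMap.trace_prodMap']
      change π.character (a, b) + π'.character (a, b) = _
      rw [hπ, hπ']
      simp only [pairFun, cond_false]
      ring
    · change LinearMap.trace ℂ (U × U) (((π (a, b)).prodMap (π' (a, b))) * T) = 0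
      exact trace_prodMap_mul_swap _ _
  rw [← hρ]
  apply character_mem_Irr
  rw [hρ, sum_eq]
  have hc : (Fintype.card (Wr Q) : ℂ) = 2 * Fintype.card Q * Fintype.card Q := by
    rw [← Nat.card_eq_fintype_card, nat_card, Nat.card_eq_fintype_card]
    push_cast; ring
  simp only [pairFun, inv_def, cond_true, cond_false, mul_zero, add_zero]
  calc _ = (∑ a, V.character a * V.character a⁻¹) * (∑ a, W.character a * W.character a⁻¹)
      + (∑ a, V.character a * W.character a⁻¹) * (∑ a, W.character a * V.character a⁻¹)
      + (∑ a, W.character a * V.character a⁻¹) * (∑ a, V.character a * W.character a⁻¹)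
      + (∑ a, W.character a * W.character a⁻¹) * (∑ a, V.character a * V.character a⁻¹) := by
        simp only [Finset.sum_mul_sum, ← Finset.sum_add_distrib]
        refine Finset.sum_congr rfl fun a _ => Finset.sum_congr rfl fun b _ => by ring
    _ = _ := by
        rw [h1, h2, h3, h4, hc]; ring

end Wr

end Wreath

section WreathProfile

/-- The number of characters by `2`-part of the degree after a wreath product step. -/
def wreathCount (m : ℕ) (f : ℕ → ℕ) : ℕ → ℕ
  | 0 => 2 * m
  | 1 => (m ^ 2 - 2 * m) / 4
  | k + 2 => m * f (k + 1)

section PairSums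

variable {I : Type} [Fintype I]

lemma sum_pair_lt (u v : I → ℤ) (d : I → ℕ) (r : I ↪ ℕ)
    (hu : ∀ i, d i = 0 → u i ^ 2 = 1) (hv : ∀ i, d i = 0 → v i ^ 2 = 1)
    (hu' : ∀ i, d i ≠ 0 → u i = 0) (huv : ∑ i, u i * v i = 0) (m : ℕ)
    (hm : (Finset.univ.filter fun i => d i = 0).card = m) :
    ∑ i ∈ Finset.univ.filter (fun i => d i = 0),
    ∑ j ∈ Finset.univ.filter (fun i => d i = 0),
      (if r i < r j then (u i * v j + u j * v i) ^ 2 else 0) = (m : ℤ) ^ 2 - 2 * m := by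
  classical
  set S := Finset.univ.filter (fun i => d i = 0) with hS
  have hmem : ∀ i, i ∈ S ↔ d i = 0 := fun i => by simp [hS]
  have huv' : ∑ i ∈ S, u i * v i = 0 := by
    rw [← huv]
    refine Finset.sum_subset (Finset.subset_univ _) fun i _ hi => ?_
    rw [hu' i fun h => hi ((hmem i).2 h), zero_mul]
  have hT : ∑ i ∈ S, ∑ j ∈ S, (u i * v j + u j * v i) ^ 2 = 2 * (m : ℤ) ^ 2 := by
    have : ∀ i ∈ S, ∀ j ∈ S, (u i * v j + u j * v i) ^ 2
        = 2 + 2 * ((u i * v i) * (u j * v j)) := by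
      intro i hi j hj
      have h1 := hu i ((hmem i).1 hi)
      have h2 := hu j ((hmem j).1 hj)
      have h3 := hv i ((hmem i).1 hi)
      have h4 := hv j ((hmem j).1 hj)
      calc _ = u i ^ 2 * v j ^ 2 + u j ^ 2 * v i ^ 2 + 2 * ((u i * v i) * (u j * v j)) := by ring
        _ = _ := by rw [h1, h2, h3, h4]; ring
    rw [Finset.sum_congr rfl fun i hi => Finset.sum_congr rfl fun j hj => this i hi j hj]
    simp only [Finset.sum_add_distrib, ← Finset.mul_sum, huv']
    simp [hm]
    ring
  have hsplit : ∀ i ∈ S, ∀ j ∈ S, (u i * v j + u j * v i) ^ 2 =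
      (if r i < r j then (u i * v j + u j * v i) ^ 2 else 0) +
      (if r j < r i then (u j * v i + u i * v j) ^ 2 else 0) + (if i = j then 4 else 0) := by
    intro i hi j hj
    rcases lt_trichotomy (r i) (r j) with h | h | h
    · have : i ≠ j := fun e => by simp [e] at h
      simp [h, h.not_gt, this]
    · obtain rfl := r.injective h
      have h1 := hu i ((hmem i).1 hi)
      have h3 := hv i ((hmem i).1 hi)
      simp only [lt_self_iff_false, if_false, if_true, zero_add]
      calc _ = 4 * (u i ^ 2 * v i ^ 2) := by ring
        _ = 4 := by rw [h1, h3]; norm_num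
    · have : i ≠ j := fun e => by simp [e] at h
      simp [h, h.not_gt, this]
      ring
  rw [Finset.sum_congr rfl fun i hi => Finset.sum_congr rfl fun j hj => hsplit i hi j hj] at hT
  simp only [Finset.sum_add_distrib] at hT
  rw [Finset.sum_comm (f := fun i j => if r j < r i then (u j * v i + u i * v j) ^ 2 else 0)] at hT
  have hdiag : ∑ i ∈ S, ∑ j ∈ S, (if i = j then (4 : ℤ) else 0) = 4 * m := by
    rw [Finset.sum_congr rfl fun i hi => by rw [Finset.sum_ite_eq, if_pos hi]]
    simp [hm, mul_comm]
  rw [hdiag] at hT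
  linarith

lemma sum_pair (u v : I → ℤ) (d : I → ℕ) (r : I ↪ ℕ)
    (hu : ∀ i, d i = 0 → u i ^ 2 = 1) (hv : ∀ i, d i = 0 → v i ^ 2 = 1)
    (hu' : ∀ i, d i ≠ 0 → u i = 0) (huv : ∑ i, u i * v i = 0) (m : ℕ)
    (hm : (Finset.univ.filter fun i => d i = 0).card = m) :
    ∑ i, ∑ j, (if d i = 0 ∧ (d j = 0 → r i < r j) then (u i * v j + u j * v i) ^ 2 else 0)
      = (m : ℤ) * ∑ i, v i ^ 2 - 2 * m := by
  classical
  have hlt := sum_pair_lt u v d r hu hv hu' huv m hm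
  have hvs : ∑ i, v i ^ 2 = m + ∑ i ∈ Finset.univ.filter (fun i => ¬ d i = 0), v i ^ 2 := by
    rw [← Finset.sum_filter_add_sum_filter_not Finset.univ (fun i => d i = 0),
      Finset.sum_congr rfl fun i hi => hv i (Finset.mem_filter.1 hi).2]
    simp [hm]
  have h1 : ∀ i, ∑ j, (if d i = 0 ∧ (d j = 0 → r i < r j) then (u i * v j + u j * v i) ^ 2 else 0)
      = if d i = 0 then (∑ j ∈ Finset.univ.filter (fun i => d i = 0),
          (if r i < r j then (u i * v j + u j * v i) ^ 2 else 0)) +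
          ∑ j ∈ Finset.univ.filter (fun i => ¬ d i = 0), v j ^ 2 else 0 := by
    intro i
    split_ifs with hi
    · rw [← Finset.sum_filter_add_sum_filter_not Finset.univ (fun i => d i = 0)]
      congr 1
      · refine Finset.sum_congr rfl fun j hj => ?_
        simp [hi, (Finset.mem_filter.1 hj).2]
      · refine Finset.sum_congr rfl fun j hj => ?_
        have hj' := (Finset.mem_filter.1 hj).2
        simp only [hi, hj', true_and, false_imp_iff, if_true]
        rw [hu' j hj', zero_mul, add_zero, mul_pow, hu i hi, one_mul]
    · simp [hi]
  simp only [h1]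
  rw [← Finset.sum_filter, Finset.sum_add_distrib, hlt]
  simp only [Finset.sum_const, hm, hvs]
  simp
  ring

end PairSums

lemma Wr.pairFun_cast {Q : Type} (α β : Q → ℤ) : (fun g => ((Wr.pairFun α β g : ℤ) : ℂ)) =
    Wr.pairFun (fun a => (α a : ℂ)) (fun a => (β a : ℂ)) := by
  ext ⟨a, b, _ | _⟩ <;> simp [Wr.pairFun]

variable {Q : Type} [Group Q] [Finite Q]

lemma Wr.eq_or_eq_of_pairFun_eq {α β α' β' : Q → ℤ}
    (hα : (fun g => (α g : ℂ)) ∈ Irr Q) (hβ : (fun g => (β g : ℂ)) ∈ Irr Q)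
    (hα' : (fun g => (α' g : ℂ)) ∈ Irr Q) (hβ' : (fun g => (β' g : ℂ)) ∈ Irr Q)
    (hinv : ∀ g, α' g⁻¹ = α' g) (hne' : α' ≠ β') (h1 : β' 1 ≠ 0)
    (h : Wr.pairFun α β = Wr.pairFun α' β') : α = α' ∧ (α ≠ β → β = β') ∨ β = α' ∧ α = β' := by
  classical
  have := Fintype.ofFinite Q
  have key : ∀ b, (if α = α' then (Fintype.card Q : ℤ) else 0) * β b
      + (if β = α' then (Fintype.card Q : ℤ) else 0) * α b = Fintype.card Q * β' b := by
    intro b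
    have hsum : ∑ a, Wr.pairFun α β ⟨a, b, false⟩ * α' a
        = ∑ a, Wr.pairFun α' β' ⟨a, b, false⟩ * α' a := by rw [h]
    have e1 : ∀ γ δ : Q → ℤ, ∑ a, Wr.pairFun γ δ ⟨a, b, false⟩ * α' a
        = (∑ a, γ a * α' a) * δ b + (∑ a, δ a * α' a) * γ b := by
      intro γ δ
      simp only [Wr.pairFun, cond_false, Finset.sum_mul, ← Finset.sum_add_distrib]
      exact Finset.sum_congr rfl fun a _ => by ring
    rw [e1, e1, sum_mul_of_irr hα hα' hinv, sum_mul_of_irr hβ hα' hinv,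
      sum_mul_of_irr hα' hα' hinv, sum_mul_of_irr hβ' hα' hinv, if_pos rfl,
      if_neg hne'.symm, zero_mul, add_zero] at hsum
    exact hsum
  have hc : (Fintype.card Q : ℤ) ≠ 0 := by exact_mod_cast Fintype.card_ne_zero
  by_cases ha : α = α'
  · left
    refine ⟨ha, fun hne => ?_⟩
    have hb : ¬ β = α' := fun hb => hne (ha.trans hb.symm)
    ext b
    have := key b
    rw [if_pos ha, if_neg hb, zero_mul, add_zero] at this
    exact mul_left_cancel₀ hc this
  · by_cases hb : β = α'
    · right
      refine ⟨hb, ?_⟩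
      ext b
      have := key b
      rw [if_neg ha, if_pos hb, zero_mul, zero_add] at this
      exact mul_left_cancel₀ hc this
    · have := key 1
      rw [if_neg ha, if_neg hb, zero_mul, zero_mul, add_zero] at this
      exact absurd (mul_eq_zero.1 this.symm) (by simp [h1])

lemma Prof.wr {c y : Q} {m : ℕ} {f : ℕ → ℕ} (hc : LinFull Q c m) (hy : Prof Q y f)
    (hf : f 0 = m) (hcy : ¬ IsConj c y) :
    Prof (Wr Q) ⟨c, y, false⟩ (wreathCount m f) := by
  classical
  have := Fintype.ofFinite Q
  have := Fintype.ofFinite (Q →* ℤˣ)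
  obtain ⟨I, hI, e, d, h1, h2, h3, h4, h5, h6, h7, h8⟩ := hy
  have hexc := fun {χ : Q → ℂ} (hχ : χ ∈ Irr Q) h0 =>
    exists_eq_of_apply_ne_zero homChar_injective homChar_mem_Irr homChar_inv c hc.sum_sq
      (χ := χ) hχ h0
  have hexy := fun {χ : Q → ℂ} (hχ : χ ∈ Irr Q) h0 =>
    exists_eq_of_apply_ne_zero h1 h2 h3 y h7 (χ := χ) hχ h0
  have hcast : ∀ α β : Q → ℤ, ((fun g => (α g : ℂ)) = fun g => (β g : ℂ)) → α = β := fun α β h => by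
    ext g; exact_mod_cast congrFun h g
  have hθ : ∀ θ : Q →* ℤˣ, ∃ i : {i // d i = 0}, homChar θ = e i := by
    intro θ
    obtain ⟨i, hi⟩ := hexy (homChar_mem_Irr θ) (by exact_mod_cast homChar_ne_zero θ y)
    have hi' := hcast _ _ hi
    obtain ⟨n, hn, hn'⟩ := h4 i
    rw [← hi', homChar_one] at hn
    have : n = 1 := by exact_mod_cast hn.symm
    subst this
    exact ⟨⟨i, by rw [← hn']; simp⟩, hi'⟩
  choose t ht using hθ
  have htinj : Function.Injective t := fun θ θ' h => homChar_injective (by rw [ht, ht, h])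
  have htsurj : Function.Surjective t :=
    (Function.Injective.bijective_of_nat_card_le htinj (by rw [h8, hf, hc.1])).2
  have hhom : ∀ i, d i = 0 → ∃ θ, e i = homChar θ := fun i hi => by
    obtain ⟨θ, hθ⟩ := htsurj ⟨i, hi⟩
    exact ⟨θ, by rw [ht, hθ]⟩
  set u : I → ℤ := fun i => e i c with hu_def
  set v : I → ℤ := fun i => e i y with hv_def
  have hu : ∀ i, d i = 0 → u i ^ 2 = 1 := fun i hi => by
    obtain ⟨θ, h⟩ := hhom i hi
    simp only [hu_def, h, homChar_sq]
  have hv : ∀ i, d i = 0 → v i ^ 2 = 1 := fun i hi => by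
    obtain ⟨θ, h⟩ := hhom i hi
    simp only [hv_def, h, homChar_sq]
  have hu' : ∀ i, d i ≠ 0 → u i = 0 := fun i hi => by
    by_contra h0
    obtain ⟨θ, hθ⟩ := hexc (h2 i) (by exact_mod_cast h0)
    have h := (hcast _ _ hθ).trans (ht θ)
    exact hi (by rw [h1 h]; exact (t θ).2)
  have hm : (Finset.univ.filter fun i => d i = 0).card = m := by
    rw [← hf, ← h8, Nat.card_eq_fintype_card, Fintype.card_subtype]
  have hcent : ∑ i, e i c ^ 2 = cent c := by
    rw [hc.2, ← hm, ← Finset.sum_filter_add_sum_filter_not Finset.univ (fun i => d i = 0),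
      Finset.sum_congr rfl fun i hi => hu i (Finset.mem_filter.1 hi).2,
      Finset.sum_eq_zero (s := Finset.univ.filter fun i => ¬ d i = 0) fun i hi => by
        have := hu' i (Finset.mem_filter.1 hi).2
        simp only [hu_def] at this
        rw [this]; rfl]
    simp
  have huv : ∑ i, u i * v i = 0 :=
    sum_mul_eq_zero_of_not_isConj h1 h2 h3 c hcent hcy
  let r : I ↪ ℕ := (Fintype.equivFin I).toEmbedding.trans Fin.valEmbedding
  set x : Wr Q := ⟨c, y, false⟩ with hx
  have hpx : ∀ i j, Wr.pairFun (e i) (e j) x = u i * v j + u j * v i := fun i j => rfl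
  let R : I × I → Prop := fun p => (d p.1 = 0 ∧ (d p.2 = 0 → r p.1 < r p.2)) ∧
    Wr.pairFun (e p.1) (e p.2) x ≠ 0
  have hRne : ∀ p, R p → e p.1 ≠ e p.2 := by
    rintro ⟨i, j⟩ ⟨⟨ha, hb⟩, -⟩ hij
    obtain rfl : i = j := h1 hij
    exact lt_irrefl _ (hb ha)
  have hone : ∀ i, e i 1 ≠ 0 := fun i => by
    obtain ⟨n, hn, hn'⟩ := exists_apply_one_of_mem_Irr (h2 i)
    have : e i 1 = n := by exact_mod_cast hn'
    omega
  have hone0 : ∀ i, d i = 0 → e i 1 = 1 := fun i hi => by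
    obtain ⟨θ, h⟩ := hhom i hi
    rw [h, homChar_one]
  have hval0 : ∀ p, R p → d p.2 = 0 → Wr.pairFun (e p.1) (e p.2) x ^ 2 = 4 := by
    rintro ⟨i, j⟩ ⟨⟨ha, hb⟩, h0⟩ hj
    simp only at ha hb h0 hj
    rw [hpx] at h0 ⊢
    have hs : ∀ a : ℤ, a ^ 2 = 1 → a = 1 ∨ a = -1 := fun a h =>
      mul_self_eq_one_iff.1 (by rwa [← sq])
    rcases hs _ (hu i ha) with h1 | h1 <;> rcases hs _ (hu j hj) with h2 | h2 <;>
      rcases hs _ (hv i ha) with h3 | h3 <;> rcases hs _ (hv j hj) with h4 | h4 <;>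
      simp [h1, h2, h3, h4] at h0 ⊢
  have hval1 : ∀ p, R p → d p.2 ≠ 0 → Wr.pairFun (e p.1) (e p.2) x ^ 2 = 4 := by
    rintro ⟨i, j⟩ ⟨⟨ha, hb⟩, h0⟩ hj
    simp only at ha hj
    have := h6 j hj
    rw [hpx, hu' j hj, zero_mul, add_zero, mul_pow, hu i ha, one_mul, ← sq_abs]
    simp only [hv_def]
    rw [this]; norm_num
  have hval : ∀ p, R p → Wr.pairFun (e p.1) (e p.2) x ^ 2 = 4 := fun p hp => by
    by_cases h : d p.2 = 0
    exacts [hval0 p hp h, hval1 p hp h]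
  refine ⟨((Q →* ℤˣ) × Bool) ⊕ {p // R p}, inferInstance,
    Sum.elim (fun p => homChar (Wr.linHom p)) (fun p => Wr.pairFun (e p.1.1) (e p.1.2)),
    Sum.elim (fun _ => 0) (fun p => d p.1.2 + 1), ?_, ?_, ?_, ?_, ?_, ?_, ?_, ?_⟩
  · have hlin1 : ∀ p : (Q →* ℤˣ) × Bool, homChar (Wr.linHom p) 1 = 1 := fun p => homChar_one _
    have hpair1 : ∀ p : I × I, Wr.pairFun (e p.1) (e p.2) 1 = 2 * (e p.1 1 * e p.2 1) := fun p => by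
      simp only [Wr.pairFun, Wr.one_def, cond_false]
      ring
    rintro (p | p) (q | q) hpq
    · exact congrArg Sum.inl (Wr.linHom_injective (homChar_injective hpq))
    · have := congrFun hpq 1
      simp only [Sum.elim_inl, Sum.elim_inr, hlin1, hpair1] at this
      omega
    · have := congrFun hpq 1
      simp only [Sum.elim_inl, Sum.elim_inr, hlin1, hpair1] at this
      omega
    · obtain ⟨⟨i, j⟩, hp⟩ := p
      obtain ⟨⟨i', j'⟩, hq⟩ := q
      rcases Wr.eq_or_eq_of_pairFun_eq (h2 i) (h2 j) (h2 i') (h2 j') (h3 i') (hRne _ hq) (hone j')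
        hpq with ⟨ha, hb⟩ | ⟨ha, hb⟩
      · obtain rfl := h1 ha
        obtain rfl := h1 (hb (hRne _ hp))
        rfl
      · obtain rfl := h1 ha
        obtain rfl := h1 hb
        exact absurd (hp.1.2 hq.1.1) (hq.1.2 hp.1.1).not_gt
  · rintro (p | p)
    · exact homChar_mem_Irr _
    · simp only [Sum.elim_inr]
      rw [Wr.pairFun_cast]
      exact Wr.pairFun_mem_Irr (h2 _) (h2 _) fun h => hRne _ p.2 (hcast _ _ h)
  · rintro (p | p) g
    · exact homChar_inv _ _
    · obtain ⟨a, b, _ | _⟩ := g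
      · simp [Wr.pairFun, Wr.inv_def, h3]
      · simp [Wr.pairFun, Wr.inv_def]
  · rintro (p | p)
    · exact ⟨1, by simp [homChar_one]⟩
    · obtain ⟨n, hn, hn'⟩ := h4 p.1.2
      have hn0 : n ≠ 0 := fun h => hone p.1.2 (by rw [hn, h]; rfl)
      refine ⟨2 * n, ?_, ?_⟩
      · simp only [Sum.elim_inr, Wr.pairFun, Wr.one_def, cond_false, hn, hone0 _ p.2.1.1]
        push_cast; ring
      · rw [Nat.factorization_mul two_ne_zero hn0, Finsupp.add_apply, hn',
          Nat.Prime.factorization_self Nat.prime_two]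
        simp only [Sum.elim_inr]
        ring
  · rintro (p | p) hp
    · rcases homChar_eq (Wr.linHom p) x with h | h <;> simp [h]
    · simp at hp
  · rintro (p | p) hp
    · simp at hp
    · have := hval _ p.2
      rw [← sq_abs] at this
      simp only [Sum.elim_inr]
      nlinarith [abs_nonneg (Wr.pairFun (e p.1.1) (e p.1.2) x)]
  · rw [Fintype.sum_sum_type]
    simp only [Sum.elim_inl, Sum.elim_inr, homChar_sq]
    have hR : ∑ p : {p // R p}, Wr.pairFun (e p.1.1) (e p.1.2) x ^ 2
        = ∑ i, ∑ j, (if d i = 0 ∧ (d j = 0 → r i < r j) then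
            (u i * v j + u j * v i) ^ 2 else 0) := by
      rw [← Finset.sum_subtype (Finset.univ.filter R) (by simp)
        (fun p => Wr.pairFun (e p.1) (e p.2) x ^ 2), Finset.sum_filter, Fintype.sum_prod_type]
      refine Finset.sum_congr rfl fun i _ => Finset.sum_congr rfl fun j _ => ?_
      by_cases h0 : Wr.pairFun (e i) (e j) x = 0
      · have : ¬ R (i, j) := fun h => h.2 h0
        rw [if_neg this, ← hpx, h0]
        simp
      · simp only [ne_eq, h0, not_false_eq_true, and_true]
        rfl
    have h7' : ∑ i, v i ^ 2 = cent y := h7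
    rw [hR, sum_pair u v d r hu hv hu' huv m hm, h7', hx, Wr.cent_base hcy, hc.2]
    simp only [Finset.sum_const, Finset.card_univ, ← Nat.card_eq_fintype_card, Nat.card_prod, hc.1]
    simp only [Nat.card_eq_fintype_card, Fintype.card_bool, nsmul_eq_mul]
    push_cast
    ring
  · intro k
    have hA : ∀ k, Nat.card {i : ((Q →* ℤˣ) × Bool) ⊕ {p // R p} //
        Sum.elim (fun _ => 0) (fun p : {p // R p} => d p.1.2 + 1) i = k + 1}
        = Nat.card {p : {p // R p} // d p.1.2 = k} := fun k =>
      Nat.card_congr ⟨fun i => match i with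
        | ⟨.inr p, h⟩ => ⟨p, by simpa using h⟩
        | ⟨.inl p, h⟩ => absurd h (by simp), fun p => ⟨.inr p.1, by simp [p.2]⟩, by
          rintro ⟨p | p, h⟩
          · simp at h
          · rfl, fun p => rfl⟩
    match k with
    | 0 =>
      have : Nat.card {i : ((Q →* ℤˣ) × Bool) ⊕ {p // R p} //
          Sum.elim (fun _ => 0) (fun p : {p // R p} => d p.1.2 + 1) i = 0}
          = Nat.card ((Q →* ℤˣ) × Bool) :=
        Nat.card_congr ⟨fun i => match i with
          | ⟨.inl p, h⟩ => p
          | ⟨.inr p, h⟩ => absurd h (by simp), fun p => ⟨.inl p, rfl⟩, by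
            rintro ⟨p | p, h⟩
            · rfl
            · simp at h, fun p => rfl⟩
      rw [this, Nat.card_prod, hc.1, wreathCount]
      simp [mul_comm]
    | 1 =>
      rw [hA 0, wreathCount]
      have hlt := sum_pair_lt u v d r hu hv hu' huv m hm
      have hcard : Nat.card {p : {p // R p} // d p.1.2 = 0}
          = (Finset.univ.filter fun p : I × I => R p ∧ d p.2 = 0).card := by
        rw [← Fintype.card_subtype, ← Nat.card_eq_fintype_card]
        exact Nat.card_congr (Equiv.subtypeSubtypeEquivSubtypeInter R fun p => d p.2 = 0)
      have h4' : ∑ i ∈ Finset.univ.filter (fun i => d i = 0),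
          ∑ j ∈ Finset.univ.filter (fun i => d i = 0),
          (if r i < r j then (u i * v j + u j * v i) ^ 2 else 0)
          = ∑ p ∈ Finset.univ.filter (fun p : I × I => R p ∧ d p.2 = 0), 4 := by
        rw [← Finset.sum_product', ]
        rw [← Finset.sum_filter]
        symm
        refine Finset.sum_subset_zero_on_sdiff ?_ ?_ ?_
        · rintro ⟨i, j⟩ hp
          simp only [Finset.mem_filter, Finset.mem_univ, true_and, R] at hp
          simp [hp.1.1.1, hp.2, hp.1.1.2 hp.2]
        · rintro ⟨i, j⟩ hp
          simp only [Finset.mem_sdiff, Finset.mem_filter, Finset.mem_product, Finset.mem_univ,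
            true_and, R, not_and] at hp
          rw [← hpx]
          by_contra h0
          exact hp.2 ⟨⟨hp.1.1.1, fun _ => hp.1.2⟩, fun h => h0 (by rw [h]; rfl)⟩ hp.1.1.2
        · rintro ⟨i, j⟩ hp
          simp only [Finset.mem_filter, Finset.mem_univ, true_and] at hp
          rw [← hpx, hval _ hp.1]
      rw [hlt, Finset.sum_const, ← hcard, nsmul_eq_mul] at h4'
      have hle : 2 * m ≤ m ^ 2 := by
        have : (0 : ℤ) ≤ m ^ 2 - 2 * m := by rw [h4']; positivity
        zify; linarith
      zify [hle] at h4' ⊢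
      rw [h4']
      simp
    | k + 2 =>
      rw [hA (k + 1), wreathCount, ← h8, ← hf, ← h8, ← Nat.card_prod]
      refine Nat.card_congr ⟨fun p => (⟨p.1.1.1, p.1.2.1.1⟩, ⟨p.1.1.2, p.2⟩), fun p =>
        ⟨⟨(p.1.1, p.2.1), ⟨p.1.2, fun h => absurd h (by rw [p.2.2]; simp)⟩, ?_⟩, p.2.2⟩,
        fun p => rfl, fun p => rfl⟩
      have hd : d p.2.1 ≠ 0 := by rw [p.2.2]; simp
      rw [hpx, hu' _ hd, zero_mul, add_zero]
      refine mul_ne_zero (fun h => ?_) (fun h => ?_)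
      · have := hu _ p.1.2
        rw [h] at this; simp at this
      · have := h6 _ hd
        simp only [hv_def] at h
        rw [h] at this; simp at this

end WreathProfile

section Centralizers

open Equiv

/-- The order of the centralizer of a permutation with orbit sizes `M`. -/
def zNum (M : Multiset ℕ) : ℕ := M.prod * ∏ n ∈ M.toFinset, (M.count n).factorial

lemma zNum_cons (k : ℕ) (M : Multiset ℕ) : zNum (k ::ₘ M) = k * (M.count k + 1) * zNum M := by
  have h : ∀ N : Multiset ℕ, N ≤ k ::ₘ M → ∏ n ∈ N.toFinset, (N.count n).factorial =
      ∏ n ∈ (k ::ₘ M).toFinset, (N.count n).factorial := by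
    intro N hN
    refine Finset.prod_subset (Multiset.toFinset_subset.2 (Multiset.subset_of_le hN))
      fun n _ hn => ?_
    rw [Multiset.mem_toFinset] at hn
    rw [Multiset.count_eq_zero_of_notMem hn, Nat.factorial_zero]
  have hk : k ∈ (k ::ₘ M).toFinset := by simp
  rw [zNum, zNum, h M (Multiset.le_cons_self _ _), Multiset.prod_cons,
    ← Finset.mul_prod_erase _ _ hk, ← Finset.mul_prod_erase _ (fun n => (M.count n).factorial) hk,
    Multiset.count_cons_self, Nat.factorial_succ]
  have : ∏ n ∈ (k ::ₘ M).toFinset.erase k, ((k ::ₘ M).count n).factorial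
      = ∏ n ∈ (k ::ₘ M).toFinset.erase k, (M.count n).factorial :=
    Finset.prod_congr rfl fun n hn => by
      rw [Multiset.count_cons_of_ne (Finset.ne_of_mem_erase hn)]
  rw [this]
  ring

lemma zNum_zero : zNum 0 = 1 := by simp [zNum]

lemma zNum_singleton (k : ℕ) : zNum {k} = k := by
  rw [← Multiset.cons_zero, zNum_cons, zNum_zero]; simp

variable {α : Type} [Fintype α] [DecidableEq α]

lemma zNum_add_replicate (M : Multiset ℕ) (h : 1 ∉ M) (j : ℕ) :
    zNum (M + Multiset.replicate j 1) = j.factorial * zNum M := by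
  induction j with
  | zero => simp
  | succ j ih =>
    rw [Multiset.replicate_succ, Multiset.add_cons, zNum_cons, ih, Multiset.count_add,
      Multiset.count_eq_zero_of_notMem h, Multiset.count_replicate_self, Nat.factorial_succ]
    ring

lemma cent_perm (σ : Perm α) : cent σ = zNum (orbitSizes σ) := by
  have h1 : cent σ = Nat.card (Subgroup.centralizer {σ}) := by
    refine Nat.card_congr (Equiv.subtypeEquivRight fun h => ?_)
    rw [Subgroup.mem_centralizer_singleton_iff]
  have h2 : 1 ∉ σ.cycleType := fun h => absurd (Perm.two_le_of_mem_cycleType h) (by norm_num)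
  rw [h1, Perm.nat_card_centralizer, orbitSizes_def, zNum_add_replicate _ h2, zNum,
    ← Perm.sum_cycleType, mul_assoc]

lemma cent_subgroup_le {G : Type} [Group G] [Finite G] (H : Subgroup G) (x : H) :
    cent x ≤ cent (x : G) := by
  refine Nat.card_le_card_of_injective
    (fun h : {h : H // h * x = x * h} => (⟨h.1, congrArg Subtype.val h.2⟩ :
      {h : G // h * x = x * h})) fun h h' hh => ?_
  have h1 := congrArg Subtype.val hh
  exact Subtype.ext (Subtype.ext h1)

end Centralizers

section Valuations

lemma factorization_two_pow_add {b j : ℕ} (h0 : 0 < j) (hj : j < 2 ^ b) :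
    (2 ^ b + j).factorization 2 = j.factorization 2 := by
  have key : ∀ k, 2 ^ k ∣ 2 ^ b + j ↔ 2 ^ k ∣ j := by
    intro k
    rcases le_or_gt k b with hk | hk
    · exact Nat.dvd_add_right (pow_dvd_pow 2 hk)
    · have h1 : 2 ^ (b + 1) ≤ 2 ^ k := Nat.pow_le_pow_right two_pos hk
      rw [pow_succ] at h1
      constructor
      · intro h
        have := Nat.le_of_dvd (by omega) h
        omega
      · intro h
        have := Nat.le_of_dvd h0 h
        omega
  have h1 := fun k => (Nat.prime_two.pow_dvd_iff_le_factorization (k := k) (n := 2 ^ b + j)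
    (by omega))
  have h2 := fun k => (Nat.prime_two.pow_dvd_iff_le_factorization (k := k) h0.ne')
  refine le_antisymm ?_ ?_
  · rw [← h2, ← key, h1]
  · rw [← h1, key, h2]

lemma factorization_factorial_two_pow_add {b n : ℕ} (hn : n < 2 ^ b) :
    (2 ^ b + n).factorial.factorization 2
      = (2 ^ b).factorial.factorization 2 + n.factorial.factorization 2 := by
  induction n with
  | zero => simp
  | succ n ih =>
    rw [← add_assoc, Nat.factorial_succ, Nat.factorial_succ,
      Nat.factorization_mul (by omega) (Nat.factorial_ne_zero _),
      Nat.factorization_mul (by omega) (Nat.factorial_ne_zero _), Finsupp.add_apply,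
      Finsupp.add_apply, ih (by omega), add_assoc (2 ^ b),
      factorization_two_pow_add (Nat.succ_pos n) hn]
    ring

lemma factorization_factorial_two_pow_succ (b : ℕ) :
    (2 ^ (b + 1)).factorial.factorization 2 = 2 * (2 ^ b).factorial.factorization 2 + 1 := by
  have h : ∀ n : ℕ, (2 * n).factorial.factorization 2 =
      n.factorial.factorization 2 + n := fun n => by
    rw [Nat.factorization_def _ Nat.prime_two, Nat.factorization_def _ Nat.prime_two]
    exact padicValNat_factorial_mul n
  have h2 : (2 ^ b).factorial.factorization 2 + 1 = 2 ^ b := by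
    induction b with
    | zero => simp
    | succ b ih => rw [pow_succ', h]; omega
  rw [pow_succ', h]
  omega

end Valuations

/-- The recursive description of the distribution of `2`-parts of degrees of the irreducible
characters not vanishing at an element with orbit sizes `M`. -/
inductive IsProfile : ℕ → Multiset ℕ → (ℕ → ℕ) → Prop
  | base : IsProfile 2 {1, 1} (fun k => if k = 0 then 2 else 0)
  | double {b : ℕ} {M : Multiset ℕ} {f : ℕ → ℕ} : IsProfile (2 ^ b) M f → f 0 = 2 ^ b →
      IsProfile (2 ^ (b + 1)) (2 ^ b ::ₘ M) (wreathCount (2 ^ b) f)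
  | add {b n : ℕ} {M : Multiset ℕ} {f : ℕ → ℕ} : IsProfile n M f → n < 2 ^ b →
      IsProfile (2 ^ b + n) (2 ^ b ::ₘ M) (fun k => 2 ^ b * f k)

namespace IsProfile

variable {n : ℕ} {M : Multiset ℕ} {f : ℕ → ℕ}

lemma sum_eq (h : IsProfile n M f) : M.sum = n := by
  induction h with
  | base => rfl
  | double _ _ ih => rw [Multiset.sum_cons, ih]; ring
  | add _ _ ih => rw [Multiset.sum_cons, ih]

lemma one_mem (h : IsProfile n M f) : 1 ∈ M := by
  induction h with
  | base => simp
  | double _ _ ih => exact Multiset.mem_cons_of_mem ih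
  | add _ _ ih => exact Multiset.mem_cons_of_mem ih

lemma lt_of_mem (h : IsProfile n M f) : ∀ k ∈ M, k < n := by
  induction h with
  | base => simp
  | @double b M f _ _ ih =>
    intro k hk
    rw [pow_succ]
    have := Nat.two_pow_pos b
    rcases Multiset.mem_cons.1 hk with rfl | hk
    · omega
    · have := ih k hk
      omega
  | @add b n M f h _ ih =>
    intro k hk
    have h1 := Multiset.le_sum_of_mem h.one_mem
    rw [h.sum_eq] at h1
    rcases Multiset.mem_cons.1 hk with rfl | hk
    · omega
    · have := ih k hk
      omega

lemma two_pow_of_mem (h : IsProfile n M f) : ∀ k ∈ M, ∃ j, k = 2 ^ j := by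
  induction h with
  | base =>
    intro k hk
    exact ⟨0, by simpa using hk⟩
  | @double b M f _ _ ih =>
    intro k hk
    rcases Multiset.mem_cons.1 hk with rfl | hk
    exacts [⟨b, rfl⟩, ih k hk]
  | @add b n M f _ _ ih =>
    intro k hk
    rcases Multiset.mem_cons.1 hk with rfl | hk
    exacts [⟨b, rfl⟩, ih k hk]

end IsProfile

section SylowRecursion

open Equiv

lemma exists_mulEquiv_sylow {G K : Type} [Group G] [Group K] [Finite G] {p : ℕ} [Fact p.Prime]
    (φ : K →* G) (hφ : Function.Injective φ)
    (hK : Nat.card K = p ^ (Nat.card G).factorization p) (Q : Sylow p G) :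
    ∃ g : G, ∃ ψ : K ≃* Q, ∀ k, (ψ k : G) = g * φ k * g⁻¹ := by
  have hr : Nat.card φ.range = p ^ (Nat.card G).factorization p := by
    rw [← hK]
    exact (Nat.card_congr (MonoidHom.ofInjective hφ).toEquiv).symm
  obtain ⟨g, rfl⟩ := MulAction.exists_smul_eq G (Sylow.ofCard φ.range hr) Q
  exact ⟨g, (MonoidHom.ofInjective hφ).trans (Sylow.equivSMul (Sylow.ofCard φ.range hr) g),
    fun k => rfl⟩

/-- The imprimitive embedding of a wreath product of a permutation group. -/
def wrPerm {κ : Type} (H : Subgroup (Perm κ)) : Wr H →* Perm (κ ⊕ κ) :=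
  Wr.lift ((Perm.sumCongrHom κ κ).comp (H.subtype.prodMap H.subtype)) (Equiv.sumComm κ κ)
    (by ext (a | a) <;> rfl) (fun a b => by ext (a | a) <;> rfl)

lemma wrPerm_false {κ : Type} (H : Subgroup (Perm κ)) (a b : H) :
    wrPerm H ⟨a, b, false⟩ = Perm.sumCongr (a : Perm κ) (b : Perm κ) := rfl

lemma wrPerm_true_inl {κ : Type} (H : Subgroup (Perm κ)) (a b : H) (i : κ) :
    wrPerm H ⟨a, b, true⟩ (.inl i) = .inr ((b : Perm κ) i) := rfl

lemma wrPerm_true_inr {κ : Type} (H : Subgroup (Perm κ)) (a b : H) (i : κ) :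
    wrPerm H ⟨a, b, true⟩ (.inr i) = .inl ((a : Perm κ) i) := rfl

lemma wrPerm_injective {κ : Type} [Nonempty κ] (H : Subgroup (Perm κ)) :
    Function.Injective (wrPerm H) := by
  obtain ⟨i⟩ := ‹Nonempty κ›
  have hsum : ∀ a b a' b' : H, Perm.sumCongr (a : Perm κ) (b : Perm κ)
      = Perm.sumCongr (a' : Perm κ) (b' : Perm κ) → a = a' ∧ b = b' := by
    intro a b a' b' h
    constructor <;> ext j
    · simpa using congrArg (fun σ : Perm (κ ⊕ κ) => σ (.inl j)) h
    · simpa using congrArg (fun σ : Perm (κ ⊕ κ) => σ (.inr j)) h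
  rw [injective_iff_map_eq_one]
  rintro ⟨a, b, _ | _⟩ h
  · rw [wrPerm_false] at h
    obtain ⟨rfl, rfl⟩ := hsum a b 1 1 (by rw [h]; ext (j | j) <;> rfl)
    rfl
  · have := congrArg (fun σ : Perm (κ ⊕ κ) => σ (.inl i)) h
    rw [wrPerm_true_inl] at this
    simp at this

lemma card_sylow_perm {ι : Type} [Fintype ι] [DecidableEq ι] (Q : Sylow 2 (Perm ι)) :
    Nat.card Q = 2 ^ (Fintype.card ι).factorial.factorization 2 := by
  rw [Q.card_eq_multiplicity, Nat.card_eq_fintype_card, Fintype.card_perm]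

lemma exists_wr_mulEquiv {b : ℕ} {ι : Type} [Fintype ι] [DecidableEq ι]
    (e : Fin (2 ^ b) ⊕ Fin (2 ^ b) ≃ ι) (H : Sylow 2 (Perm (Fin (2 ^ b))))
    (Q : Sylow 2 (Perm ι)) : ∃ g : Perm ι, ∃ ψ : Wr H ≃* Q, ∀ w,
      (ψ w : Perm ι) = g * e.permCongr (wrPerm (H : Subgroup (Perm (Fin (2 ^ b)))) w) * g⁻¹ := by
  have hc : Fintype.card ι = 2 ^ (b + 1) := by
    rw [← Fintype.card_congr e]; simp [pow_succ, mul_two]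
  have : Nonempty (Fin (2 ^ b)) := ⟨⟨0, Nat.two_pow_pos b⟩⟩
  refine exists_mulEquiv_sylow (e.permCongrHom.toMonoidHom.comp (wrPerm H.1))
    (e.permCongrHom.injective.comp (wrPerm_injective H.1)) ?_ Q
  rw [Wr.nat_card, card_sylow_perm, Nat.card_eq_fintype_card, Fintype.card_perm, hc,
    factorization_factorial_two_pow_succ, Fintype.card_fin, ← pow_mul]
  ring

lemma le_card_hom_sylow (a : ℕ) {ι : Type} [Fintype ι] [DecidableEq ι]
    (hι : Fintype.card ι = 2 ^ a) (Q : Sylow 2 (Perm ι)) : 2 ^ a ≤ Nat.card (Q →* ℤˣ) := by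
  induction a generalizing ι with
  | zero => exact Nat.card_pos
  | succ a ih =>
    have e : Fin (2 ^ a) ⊕ Fin (2 ^ a) ≃ ι := Fintype.equivOfCardEq (by
      rw [hι]; simp [pow_succ, mul_two])
    obtain ⟨H⟩ : Nonempty (Sylow 2 (Perm (Fin (2 ^ a)))) := inferInstance
    obtain ⟨g, ψ, -⟩ := exists_wr_mulEquiv e H Q
    have h1 := Wr.card_hom_le (Q := H)
    have h2 := ih (by simp) H
    rw [Nat.card_congr (MulEquiv.monoidHomCongrLeftEquiv ψ)] at h1
    rw [pow_succ']
    omega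

lemma linFull_sylow {b : ℕ} {ι : Type} [Fintype ι] [DecidableEq ι]
    (hι : Fintype.card ι = 2 ^ b) (Q : Sylow 2 (Perm ι)) (c : Q)
    (hc : orbitSizes (c : Perm ι) = {2 ^ b}) : LinFull Q c (2 ^ b) := by
  refine LinFull.mk (le_card_hom_sylow b hι Q) ((cent_subgroup_le _ c).trans ?_)
  rw [cent_perm, hc, zNum_singleton]

end SylowRecursion

section SylowProfile

open Equiv

lemma LinFull.prof {G : Type} [Group G] [Finite G] {c : G} {m : ℕ} (h : LinFull G c m) :
    Prof G c (fun k => if k = 0 then m else 0) := by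
  have := Fintype.ofFinite (G →* ℤˣ)
  refine ⟨G →* ℤˣ, inferInstance, homChar, fun _ => 0, homChar_injective, homChar_mem_Irr,
    homChar_inv, fun i => ⟨1, by simp [homChar_one], by simp⟩, fun i _ => ?_,
    fun i hi => absurd rfl hi, h.sum_sq, fun k => ?_⟩
  · rcases homChar_eq i c with h | h <;> simp [h]
  · beta_reduce
    split_ifs with hk
    · subst hk
      rw [← h.1]
      exact Nat.card_congr (Equiv.subtypeUnivEquiv fun _ => rfl)
    · have : IsEmpty {i : G →* ℤˣ // 0 = k} := ⟨fun i => hk i.2.symm⟩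
      exact Nat.card_of_isEmpty

lemma orbitSizes_conj {ι : Type} [Fintype ι] [DecidableEq ι] (g σ : Perm ι) :
    orbitSizes (g * σ * g⁻¹) = orbitSizes σ :=
  (isConj_iff_orbitSizes.1 (isConj_iff.2 ⟨g, rfl⟩)).symm

lemma orbitSizes_split {b : ℕ} {κ : Type} [Fintype κ] [DecidableEq κ]
    {M : Multiset ℕ} {s : Perm (Fin (2 ^ b))} {t : Perm κ}
    (hst : orbitSizes s + orbitSizes t = 2 ^ b ::ₘ M) (hs : 2 ^ b ∈ orbitSizes s) :
    orbitSizes s = {2 ^ b} ∧ orbitSizes t = M := by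
  have h := eq_singleton_of_card_mem (σ := s) (by simpa using hs)
  rw [Fintype.card_fin] at h
  refine ⟨h, ?_⟩
  rw [h, Multiset.singleton_add] at hst
  exact (Multiset.cons_inj_right _).1 hst

lemma prof_wr {b : ℕ} {M : Multiset ℕ} {f : ℕ → ℕ} (hf : IsProfile (2 ^ b) M f)
    (h0 : f 0 = 2 ^ b) (H : Sylow 2 (Perm (Fin (2 ^ b))))
    (ih : ∀ y : H, orbitSizes (y : Perm (Fin (2 ^ b))) = M → Prof H y f) (s t : H)
    (hst : orbitSizes (s : Perm (Fin (2 ^ b))) + orbitSizes (t : Perm (Fin (2 ^ b))) = 2 ^ b ::ₘ M)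
    (hs : 2 ^ b ∈ orbitSizes (s : Perm (Fin (2 ^ b)))) :
    Prof (Wr H) ⟨s, t, false⟩ (wreathCount (2 ^ b) f) := by
  obtain ⟨h1, h2⟩ := orbitSizes_split hst hs
  refine Prof.wr (linFull_sylow (by simp) H s h1) (ih t h2) h0 fun hc => ?_
  have hc' : IsConj (s : Perm (Fin (2 ^ b))) (t : Perm (Fin (2 ^ b))) := by
    obtain ⟨g, hg⟩ := isConj_iff.1 hc
    exact isConj_iff.2 ⟨g, congrArg Subtype.val hg⟩
  rw [isConj_iff_orbitSizes, h2] at hc'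
  rw [hc'] at hs
  exact lt_irrefl _ (hf.lt_of_mem _ hs)

theorem prof_sylow {n : ℕ} {M : Multiset ℕ} {f : ℕ → ℕ} (h : IsProfile n M f) {ι : Type}
    [Fintype ι] [DecidableEq ι] (hι : Fintype.card ι = n) (Q : Sylow 2 (Perm ι)) (x : Q)
    (hx : orbitSizes (x : Perm ι) = M) : Prof Q x f := by
  induction h generalizing ι with
  | base =>
    have h1 : x = 1 := by
      have : IsConj (1 : Perm ι) (x : Perm ι) := by
        rw [isConj_iff_orbitSizes, hx, orbitSizes_one, hι]; rfl
      exact Subtype.ext (by simpa using this.symm)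
    subst h1
    refine LinFull.prof (LinFull.mk (le_card_hom_sylow 1 hι Q) ?_)
    refine (cent_subgroup_le (Q : Subgroup (Perm ι)) 1).trans ?_
    have h2 : cent ((1 : Q) : Perm ι) = zNum {1, 1} := by rw [cent_perm, hx]
    refine h2.trans_le ?_
    rw [zNum, Multiset.insert_eq_cons]
    simp
  | @double b M f hf h0 ih =>
    have e : Fin (2 ^ b) ⊕ Fin (2 ^ b) ≃ ι := Fintype.equivOfCardEq (by
      rw [hι]; simp [pow_succ, mul_two])
    obtain ⟨H⟩ : Nonempty (Sylow 2 (Perm (Fin (2 ^ b)))) := inferInstance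
    obtain ⟨g, ψ, hψ⟩ := exists_wr_mulEquiv e H Q
    obtain ⟨w, rfl⟩ := ψ.surjective x
    refine Prof.mulEquiv ?_ ψ
    rw [hψ, orbitSizes_conj, orbitSizes_permCongr] at hx
    obtain ⟨i, hi⟩ := one_mem_orbitSizes (hx ▸ Multiset.mem_cons_of_mem hf.one_mem)
    rcases w with ⟨s, t, _ | _⟩
    · rw [wrPerm_false, orbitSizes_sumCongr] at hx
      have ih' := fun y hy => ih (by simp) H y hy
      have hm : 2 ^ b ∈ orbitSizes (s : Perm (Fin (2 ^ b))) + orbitSizes (t : Perm (Fin (2 ^ b))) :=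
        hx ▸ Multiset.mem_cons_self _ _
      rcases Multiset.mem_add.1 hm with hs | ht
      · exact prof_wr hf h0 H ih' s t hx hs
      · rw [add_comm] at hx
        refine (prof_wr hf h0 H ih' t s hx ht).of_isConj (isConj_iff.2 ⟨⟨1, 1, true⟩, ?_⟩)
        simp [Wr.mul_def, Wr.inv_def]
    · rcases i with i | i
      · rw [wrPerm_true_inl] at hi; simp at hi
      · rw [wrPerm_true_inr] at hi; simp at hi
  | @add b n M f hf hn ih =>
    have e : Fin (2 ^ b) ⊕ Fin n ≃ ι := Fintype.equivOfCardEq (by rw [hι]; simp)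
    obtain ⟨H⟩ : Nonempty (Sylow 2 (Perm (Fin (2 ^ b)))) := inferInstance
    obtain ⟨K⟩ : Nonempty (Sylow 2 (Perm (Fin n))) := inferInstance
    obtain ⟨g, ψ, hψ⟩ := exists_mulEquiv_sylow (e.permCongrHom.toMonoidHom.comp
      ((Perm.sumCongrHom _ _).comp
        ((H : Subgroup (Perm (Fin (2 ^ b)))).subtype.prodMap
          (K : Subgroup (Perm (Fin n))).subtype)))
      (e.permCongrHom.injective.comp (Perm.sumCongrHom_injective.comp
        (Prod.map_injective.2 ⟨Subtype.val_injective, Subtype.val_injective⟩))) (by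
        rw [Nat.card_prod, card_sylow_perm, card_sylow_perm, Nat.card_eq_fintype_card,
          Fintype.card_perm, hι, factorization_factorial_two_pow_add hn, pow_add, Fintype.card_fin,
          Fintype.card_fin]) Q
    obtain ⟨⟨s, t⟩, rfl⟩ := ψ.surjective x
    have hx' : orbitSizes (s : Perm (Fin (2 ^ b))) + orbitSizes (t : Perm (Fin n)) =
        2 ^ b ::ₘ M := by
      rw [hψ, orbitSizes_conj] at hx
      rw [← orbitSizes_sumCongr, ← hx]
      exact (orbitSizes_permCongr e _).symm
    have hm : 2 ^ b ∈ orbitSizes (s : Perm (Fin (2 ^ b))) + orbitSizes (t : Perm (Fin n)) :=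
      hx' ▸ Multiset.mem_cons_self _ _
    have hs : 2 ^ b ∈ orbitSizes (s : Perm (Fin (2 ^ b))) := by
      refine (Multiset.mem_add.1 hm).resolve_right fun ht => ?_
      have h1 := Multiset.le_sum_of_mem ht
      rw [sum_orbitSizes, Fintype.card_fin] at h1
      omega
    obtain ⟨h1, h2⟩ := orbitSizes_split hx' hs
    exact (Prof.prod (linFull_sylow (by simp) H s h1) (ih (by simp) K t h2)).mulEquiv ψ

lemma padicCycleMultiset_two_pow_add {b k : ℕ} (hk : k < 2 ^ b) :
    padicCycleMultiset 2 (2 ^ b + k) = 2 ^ b ::ₘ padicCycleMultiset 2 k := by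
  have key : ∀ (m b : ℕ), m < 2 ^ b → padicCycleMultiset 2 m = ∑ i ∈ Finset.range b,
      Multiset.replicate (m / 2 ^ i % 2) (2 ^ i) := by
    intro m b hm
    rw [padicCycleMultiset]
    have h1 : (Nat.digits 2 m).length ≤ b := by
      rw [Nat.digits_length_le_iff (by norm_num)]; exact hm
    rw [← Finset.sum_range_add_sum_Ico _ h1]
    have h2 : ∀ i, (Nat.digits 2 m).getD i 0 = m / 2 ^ i % 2 := fun i =>
      Nat.getD_digits m i (by norm_num)
    rw [Finset.sum_congr rfl fun i _ => by rw [h2]]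
    symm
    convert add_zero _ using 2
    refine Finset.sum_eq_zero fun i hi => ?_
    rw [← h2, List.getD_eq_default _ _ (Finset.mem_Ico.1 hi).1]
    rfl
  rw [key _ (b + 1) (by rw [pow_succ]; omega), key k b hk, Finset.sum_range_succ, add_comm,
    ← Multiset.singleton_add]
  congr 1
  · rw [Nat.add_div_of_dvd_right dvd_rfl, Nat.div_self (Nat.two_pow_pos b), Nat.div_eq_of_lt hk]
    rfl
  · refine Finset.sum_congr rfl fun i hi => ?_
    have hi := Finset.mem_range.1 hi
    congr 1
    obtain ⟨j, rfl⟩ := Nat.exists_eq_add_of_lt hi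
    rw [show 2 ^ (i + j + 1) = 2 ^ i * (2 * 2 ^ j) by ring, Nat.mul_add_div (Nat.two_pow_pos i),
      Nat.mul_add_mod]

lemma exists_isProfile (k : ℕ) (hk : Even k) :
    ∃ f, IsProfile (k + 2) (padicCycleMultiset 2 k + Multiset.replicate 2 1) f ∧
      ∀ b, k + 2 = 2 ^ b → f 0 = 2 ^ b := by
  induction k using Nat.strong_induction_on with
  | _ k ih =>
    rcases Nat.eq_zero_or_pos k with rfl | h0
    · refine ⟨_, by simpa [padicCycleMultiset] using IsProfile.base, fun b hb => by simpa using hb⟩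
    obtain ⟨b, k', hk', rfl⟩ : ∃ b k', k' < 2 ^ b ∧ k = 2 ^ b + k' :=
      ⟨Nat.log 2 k, k - 2 ^ Nat.log 2 k, by
        have := Nat.lt_pow_succ_log_self (b := 2) (by norm_num) k
        rw [pow_succ] at this
        omega, by
        have := Nat.pow_log_le_self 2 h0.ne'
        omega⟩
    obtain ⟨b, rfl⟩ : ∃ c, b = c + 1 := by
      refine Nat.exists_eq_succ_of_ne_zero ?_
      rintro rfl
      have : k' = 0 := by simpa using hk'
      subst this
      simp at hk
    have hk2 : Even k' := by
      rw [Nat.even_add] at hk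
      exact hk.1 (by simp [pow_succ])
    obtain ⟨f, hf, hf0⟩ := ih k' (by have := Nat.two_pow_pos (b + 1); omega) hk2
    rw [padicCycleMultiset_two_pow_add hk', Multiset.cons_add]
    have h2 : k' + 2 ≤ 2 ^ (b + 1) := by
      obtain ⟨r, rfl⟩ := hk2
      rw [pow_succ] at hk' ⊢
      omega
    rcases h2.lt_or_eq with h2 | h2
    · refine ⟨_, add_assoc (2 ^ (b + 1)) k' 2 ▸ hf.add h2, fun c hc => absurd hc ?_⟩
      intro hc
      have h3 : 2 ^ (b + 1) < 2 ^ c := by omega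
      have h4 : 2 ^ c < 2 ^ (b + 1 + 1) := by rw [pow_succ 2 (b + 1)]; omega
      have h5 := (Nat.pow_lt_pow_iff_right (by norm_num)).1 h3
      have h6 := (Nat.pow_lt_pow_iff_right (by norm_num)).1 h4
      omega
    · have hd : IsProfile (2 ^ (b + 1 + 1)) _ _ := (h2 ▸ hf).double (hf0 _ h2)
      have h3 : 2 ^ (b + 1) + k' + 2 = 2 ^ (b + 1 + 1) := by rw [pow_succ 2 (b + 1)]; omega
      refine ⟨_, h3 ▸ hd, fun c hc => ?_⟩
      rw [← hc, h3, pow_succ' 2 (b + 1)]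
      rfl

end SylowProfile

section Configurations

open Equiv

variable {N : ℕ}

/-- The alternating function supported on the rearrangements of `(0, 1, …, N - 1)`. -/
def vac (α : Fin N → ℤ) : ℤ :=
  ∑ w : Perm (Fin N), if α = (fun i => ((w i : ℕ) : ℤ)) then (Perm.sign w : ℤ) else 0

/-- Multiplication by a power sum, on coefficient functions. -/
def up (k : ℕ) (φ : (Fin N → ℤ) → ℤ) (α : Fin N → ℤ) : ℤ :=
  ∑ i, φ (α - Pi.single i (k : ℤ))

instance : LeftCommutative (up (N := N)) where
  left_comm k l φ := by
    ext α
    simp only [up]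
    rw [Finset.sum_comm]
    exact Finset.sum_congr rfl fun i _ => Finset.sum_congr rfl fun j _ => by rw [sub_right_comm]

/-- The coefficients of the product of the Vandermonde polynomial with power sums. -/
def coeffs (L : Multiset ℕ) : (Fin N → ℤ) → ℤ := L.foldr up vac

lemma coeffs_zero : coeffs (N := N) 0 = vac := rfl

lemma coeffs_cons (k : ℕ) (L : Multiset ℕ) (α : Fin N → ℤ) :
    coeffs (k ::ₘ L) α = ∑ i, coeffs L (α - Pi.single i (k : ℤ)) := by
  rw [coeffs, Multiset.foldr_cons]
  rfl

lemma vac_comp_perm (w : Perm (Fin N)) (α : Fin N → ℤ) :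
    vac (α ∘ w) = (Perm.sign w : ℤ) * vac α := by
  rw [vac, vac, Finset.mul_sum, ← Equiv.sum_comp (Equiv.mulRight w)]
  refine Finset.sum_congr rfl fun v _ => ?_
  have : α ∘ w = (fun i => (((v * w) i : ℕ) : ℤ)) ↔ α = fun i => ((v i : ℕ) : ℤ) := by
    rw [← w.surjective.injective_comp_right.eq_iff (a := α)]
    rfl
  simp only [Equiv.coe_mulRight, this]
  split_ifs
  · rw [Perm.sign_mul, Units.val_mul, mul_comm]
  · rw [mul_zero]

lemma sub_single_comp_perm (w : Perm (Fin N)) (α : Fin N → ℤ) (i : Fin N) (k : ℤ) :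
    α ∘ w - Pi.single i k = (α - Pi.single (w i) k) ∘ w := by
  ext j
  simp [Pi.single_apply, w.injective.eq_iff]

lemma coeffs_comp_perm (L : Multiset ℕ) (w : Perm (Fin N)) (α : Fin N → ℤ) :
    coeffs L (α ∘ w) = (Perm.sign w : ℤ) * coeffs L α := by
  induction L using Multiset.induction_on generalizing α with
  | empty => exact vac_comp_perm w α
  | cons k L ih =>
    rw [coeffs_cons, coeffs_cons, Finset.mul_sum]
    refine Eq.trans (Finset.sum_congr rfl fun i _ => ?_) (Equiv.sum_comp w _)
    rw [sub_single_comp_perm, ih]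

lemma eq_zero_of_alternating {φ : (Fin N → ℤ) → ℤ}
    (hφ : ∀ (w : Perm (Fin N)) α, φ (α ∘ w) = (Perm.sign w : ℤ) * φ α) {α : Fin N → ℤ}
    {i j : Fin N} (hij : i ≠ j) (h : α i = α j) : φ α = 0 := by
  have h1 := hφ (swap i j) α
  have h2 : α ∘ swap i j = α := by
    ext l
    simp only [Function.comp_apply, swap_apply_def]
    split_ifs with h1 h2 <;> simp_all
  rw [h2, Perm.sign_swap hij] at h1
  simp at h1
  omega

lemma injective_of_coeffs_ne_zero {L : Multiset ℕ} {α : Fin N → ℤ} (h : coeffs L α ≠ 0) :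
    Function.Injective α := by
  intro i j hij
  by_contra hne
  exact h (eq_zero_of_alternating (coeffs_comp_perm L) hne hij)

lemma exists_of_vac_ne_zero {α : Fin N → ℤ} (h : vac α ≠ 0) :
    ∃ w : Perm (Fin N), α = fun i => ((w i : ℕ) : ℤ) := by
  obtain ⟨w, -, hw⟩ := Finset.exists_ne_zero_of_sum_ne_zero h
  exact ⟨w, by by_contra hne; exact hw (if_neg hne)⟩

lemma exists_of_coeffs_cons_ne_zero {k : ℕ} {L : Multiset ℕ} {α : Fin N → ℤ}
    (h : coeffs (k ::ₘ L) α ≠ 0) : ∃ i, coeffs L (α - Pi.single i (k : ℤ)) ≠ 0 := by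
  rw [coeffs_cons] at h
  obtain ⟨i, -, hi⟩ := Finset.exists_ne_zero_of_sum_ne_zero h
  exact ⟨i, hi⟩

lemma nonneg_of_coeffs_ne_zero {L : Multiset ℕ} {α : Fin N → ℤ} (h : coeffs L α ≠ 0)
    (i : Fin N) : 0 ≤ α i := by
  induction L using Multiset.induction_on generalizing α with
  | empty =>
    obtain ⟨w, rfl⟩ := exists_of_vac_ne_zero h
    positivity
  | cons k L ih =>
    obtain ⟨j, hj⟩ := exists_of_coeffs_cons_ne_zero h
    have := ih hj
    simp only [Pi.sub_apply, Pi.single_apply] at this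
    split_ifs at this <;> omega

lemma sum_of_coeffs_ne_zero {L : Multiset ℕ} {α : Fin N → ℤ} (h : coeffs L α ≠ 0) :
    ∑ i, α i = ∑ i : Fin N, ((i : ℕ) : ℤ) + L.sum := by
  induction L using Multiset.induction_on generalizing α with
  | empty =>
    obtain ⟨w, rfl⟩ := exists_of_vac_ne_zero h
    simpa using Equiv.sum_comp w fun i : Fin N => ((i : ℕ) : ℤ)
  | cons k L ih =>
    obtain ⟨j, hj⟩ := exists_of_coeffs_cons_ne_zero h
    have := ih hj
    simp only [Pi.sub_apply, Finset.sum_sub_distrib, Finset.sum_pi_single', Finset.mem_univ,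
      if_true] at this
    rw [Multiset.sum_cons]
    push_cast at this ⊢
    linarith

lemma exists_eq_of_coeffs_ne_zero {L : Multiset ℕ} {α : Fin N → ℤ} (hL : ∀ k ∈ L, 0 < k)
    (h : coeffs L α ≠ 0) {p : ℕ} (hp : p + L.sum < N) : ∃ i, α i = p := by
  induction L using Multiset.induction_on generalizing α p with
  | empty =>
    obtain ⟨w, rfl⟩ := exists_of_vac_ne_zero h
    exact ⟨w.symm ⟨p, by simpa using hp⟩, by simp⟩
  | cons k L ih =>
    obtain ⟨i, hi⟩ := exists_of_coeffs_cons_ne_zero h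
    have hk := hL k (Multiset.mem_cons_self _ _)
    have hL' : ∀ k ∈ L, 0 < k := fun j hj => hL j (Multiset.mem_cons_of_mem hj)
    rw [Multiset.sum_cons] at hp
    obtain ⟨j, hj⟩ := ih hL' hi (p := p) (by omega)
    obtain ⟨l, hl⟩ := ih hL' hi (p := p + k) (by omega)
    have hinj := injective_of_coeffs_ne_zero h
    simp only [Pi.sub_apply, Pi.single_apply] at hj hl
    by_cases hji : j = i
    · subst hji
      rw [if_pos rfl] at hj
      by_cases hlj : l = j
      · subst hlj
        rw [if_pos rfl] at hl
        push_cast at hl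
        omega
      · rw [if_neg hlj, sub_zero] at hl
        exact absurd (hinj (by push_cast at hl; omega : α l = α j)) hlj
    · rw [if_neg hji, sub_zero] at hj
      exact ⟨j, hj⟩

/-- Replacing two equal power sums by the one of twice the degree does not change the
parity. -/
lemma coeffs_double (k : ℕ) (L : Multiset ℕ) (α : Fin N → ℤ) :
    (2 : ℤ) ∣ coeffs (k ::ₘ k ::ₘ L) α - coeffs ((2 * k) ::ₘ L) α := by
  set c : Fin N → Fin N → ℤ := fun i j =>
    coeffs L (α - Pi.single i (k : ℤ) - Pi.single j (k : ℤ)) with hc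
  have hcs : ∀ i j, c i j = c j i := fun i j => by rw [hc]; simp only; rw [sub_right_comm]
  have h1 : coeffs (k ::ₘ k ::ₘ L) α = ∑ p : Fin N × Fin N, c p.1 p.2 := by
    rw [Fintype.sum_prod_type, coeffs_cons]
    exact Finset.sum_congr rfl fun i _ => coeffs_cons _ _ _
  have h2 : coeffs ((2 * k) ::ₘ L) α = ∑ i, c i i := by
    rw [coeffs_cons]
    refine Finset.sum_congr rfl fun i _ => ?_
    rw [hc]
    simp only
    rw [sub_sub, ← Pi.single_add]
    congr 3
    push_cast; ring
  have h3 : ∑ i, c i i = ∑ p : Fin N × Fin N, if p.1 = p.2 then c p.1 p.2 else 0 := by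
    rw [Fintype.sum_prod_type]
    simp
  rw [h1, h2, h3, ← Finset.sum_sub_distrib]
  refine (ZMod.intCast_zmod_eq_zero_iff_dvd _ 2).1 ?_
  rw [Int.cast_sum]
  refine Finset.sum_ninvolution Prod.swap (fun p => ?_) (fun p hp hpp => ?_)
    (fun p => Finset.mem_univ _)
    fun p => Prod.swap_swap p
  · simp only [Prod.fst_swap, Prod.snd_swap, hcs p.2 p.1, eq_comm (a := p.2)]
    exact CharTwo.add_self_eq_zero _
  · apply hp
    rw [if_pos (show p.1 = p.2 from congrArg Prod.snd hpp)]
    simp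

end Configurations

section BeadSets

open Equiv

variable {N : ℕ}

/-- The increasing enumeration of a set of `N` beads. -/
def enum (N : ℕ) (A : Finset ℕ) : Fin N → ℤ :=
  if h : A.card = N then fun i => ((A.orderEmbOfFin h i : ℕ) : ℤ) else 0

/-- The value, on elements with orbit sizes `L`, of the virtual character attached to a
set of beads. -/
def cha (N : ℕ) (L : Multiset ℕ) (A : Finset ℕ) : ℤ := coeffs L (enum N A)

lemma enum_apply {A : Finset ℕ} (h : A.card = N) (i : Fin N) :
    enum N A i = ((A.orderEmbOfFin h i : ℕ) : ℤ) := by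
  rw [enum, dif_pos h]

lemma enum_injective {A : Finset ℕ} (h : A.card = N) : Function.Injective (enum N A) := by
  intro i j hij
  rw [enum_apply h, enum_apply h] at hij
  exact (A.orderEmbOfFin h).injective (by exact_mod_cast hij)

lemma exists_mem_enum {A : Finset ℕ} (h : A.card = N) (i : Fin N) :
    ∃ a ∈ A, enum N A i = (a : ℤ) :=
  ⟨_, A.orderEmbOfFin_mem h i, enum_apply h i⟩

lemma exists_enum_eq {A : Finset ℕ} (h : A.card = N) {a : ℕ} (ha : a ∈ A) :
    ∃ i, enum N A i = (a : ℤ) := by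
  have : a ∈ Set.range (A.orderEmbOfFin h) := by rw [Finset.range_orderEmbOfFin]; exact ha
  obtain ⟨i, rfl⟩ := this
  exact ⟨i, enum_apply h i⟩

lemma sum_enum {M : Type} [AddCommMonoid M] {A : Finset ℕ} (h : A.card = N) (F : ℤ → M) :
    ∑ i, F (enum N A i) = ∑ a ∈ A, F a := by
  rw [← Finset.sum_coe_sort A, ← Equiv.sum_comp (A.orderIsoOfFin h).toEquiv]
  exact Finset.sum_congr rfl fun i _ => by rw [enum_apply h]; rfl

lemma exists_perm_enum {A : Finset ℕ} (h : A.card = N) {α : Fin N → ℤ}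
    (hα : Function.Injective α) (hm : ∀ i, ∃ a ∈ A, α i = (a : ℤ)) :
    ∃ w : Perm (Fin N), α = enum N A ∘ w := by
  choose a ha hα' using hm
  choose w hw using fun i => exists_enum_eq h (ha i)
  have hinj : Function.Injective w := by
    intro i j hij
    apply hα
    rw [hα', hα', ← hw, ← hw, hij]
  refine ⟨Equiv.ofBijective w (Finite.injective_iff_bijective.1 hinj), ?_⟩
  ext i
  rw [hα', ← hw]
  rfl

/-- The sets of `N` beads corresponding to partitions of `n`. -/
def level (N n : ℕ) : Finset (Finset ℕ) :=
  {A ∈ (Finset.range (∑ i ∈ Finset.range N, i + n + 1)).powerset |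
    A.card = N ∧ ∑ a ∈ A, a = ∑ i ∈ Finset.range N, i + n}

lemma mem_level {n : ℕ} {A : Finset ℕ} :
    A ∈ level N n ↔ A.card = N ∧ ∑ a ∈ A, a = ∑ i ∈ Finset.range N, i + n := by
  rw [level, Finset.mem_filter, and_iff_right_iff_imp, Finset.mem_powerset]
  intro h a ha
  rw [Finset.mem_range, ← h.2]
  exact Nat.lt_succ_of_le (Finset.single_le_sum (f := fun a : ℕ => a) (fun _ _ => Nat.zero_le _) ha)

/-- The beads which can be moved down by `k`. -/
def removable (A : Finset ℕ) (k : ℕ) : Finset ℕ := {b ∈ A | k ≤ b ∧ b - k ∉ A}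

/-- The beads which can be moved up by `k`. -/
def addable (A : Finset ℕ) (k : ℕ) : Finset ℕ := {b ∈ A | b + k ∉ A}

/-- Move a bead from `b` to `c`. -/
def move (A : Finset ℕ) (b c : ℕ) : Finset ℕ := insert c (A.erase b)

lemma card_move {A : Finset ℕ} {b c : ℕ} (hb : b ∈ A) (hc : c ∉ A) :
    (move A b c).card = A.card := by
  rw [move, Finset.card_insert_of_notMem fun h => hc (Finset.mem_of_mem_erase h),
    Finset.card_erase_add_one hb]

lemma sum_move {M : Type} [AddCommMonoid M] {A : Finset ℕ} {b c : ℕ} (hb : b ∈ A) (hc : c ∉ A)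
    (F : ℕ → M) : ∑ a ∈ move A b c, F a + F b = ∑ a ∈ A, F a + F c := by
  rw [move, Finset.sum_insert fun h => hc (Finset.mem_of_mem_erase h), add_assoc,
    Finset.sum_erase_add _ _ hb, add_comm]

lemma move_move {A : Finset ℕ} {b c : ℕ} (hb : b ∈ A) (hc : c ∉ A) :
    move (move A b c) c b = A := by
  rw [move, move, Finset.erase_insert fun h => hc (Finset.mem_of_mem_erase h),
    Finset.insert_erase hb]

/-- The Murnaghan--Nakayama rule, up to signs. -/
lemma exists_cha_cons {A : Finset ℕ} (h : A.card = N) {k : ℕ} (hk : 0 < k) :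
    ∃ ε : ℕ → ℤ, (∀ b, ε b = 1 ∨ ε b = -1) ∧ ∀ L, cha N (k ::ₘ L) A =
      ∑ b ∈ removable A k, ε b * cha N L (move A b (b - k)) := by
  have key : ∀ b ∈ A, ∃ ε : ℤ, (ε = 1 ∨ ε = -1) ∧ ∀ L i, enum N A i = b →
      coeffs L (enum N A - Pi.single i (k : ℤ)) =
        if k ≤ b ∧ b - k ∉ A then ε * cha N L (move A b (b - k)) else 0 := by
    intro b hb
    obtain ⟨j, hj⟩ := exists_enum_eq h hb
    by_cases hc : k ≤ b ∧ b - k ∉ A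
    · have hcard := (card_move hb hc.2).trans h
      obtain ⟨w, hw⟩ := exists_perm_enum hcard (α := enum N A - Pi.single j (k : ℤ)) (by
        intro i l hil
        have hne : ∀ i, i ≠ j → enum N A i ≠ b - k := by
          intro i _ hi'
          obtain ⟨a, ha, ha'⟩ := exists_mem_enum h i
          rw [ha'] at hi'
          apply hc.2
          rwa [show b - k = a by omega]
        simp only [Pi.sub_apply, Pi.single_apply] at hil
        by_cases h1 : i = j <;> by_cases h2 : l = j
        · rw [h1, h2]
        · rw [if_pos h1, if_neg h2, h1, hj, sub_zero] at hil
          exact absurd hil.symm (hne l h2)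
        · rw [if_pos h2, if_neg h1, h2, hj, sub_zero] at hil
          exact absurd hil (hne i h1)
        · rw [if_neg h1, if_neg h2, sub_zero, sub_zero] at hil
          exact enum_injective h hil) (by
        intro i
        simp only [Pi.sub_apply, Pi.single_apply]
        by_cases h1 : i = j
        · rw [if_pos h1, h1, hj]
          exact ⟨b - k, Finset.mem_insert_self _ _, by omega⟩
        · rw [if_neg h1, sub_zero]
          obtain ⟨a, ha, ha'⟩ := exists_mem_enum h i
          refine ⟨a, Finset.mem_insert_of_mem (Finset.mem_erase.2 ⟨?_, ha⟩), ha'⟩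
          rintro rfl
          exact h1 (enum_injective h (ha'.trans hj.symm)))
      refine ⟨Perm.sign w, Int.isUnit_iff.1 (Units.isUnit _), fun L i hi => ?_⟩
      rw [if_pos hc, enum_injective h (hi.trans hj.symm), hw, coeffs_comp_perm]
      rfl
    · refine ⟨1, Or.inl rfl, fun L i hi => ?_⟩
      rw [if_neg hc]
      by_contra hne
      have h1 := nonneg_of_coeffs_ne_zero hne i
      simp only [Pi.sub_apply, Pi.single_eq_same, hi] at h1
      have hmem : b - k ∈ A := by
        by_contra h2
        exact hc ⟨by omega, h2⟩
      obtain ⟨l, hl⟩ := exists_enum_eq h hmem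
      have hli : l ≠ i := by
        rintro rfl
        omega
      refine hli (injective_of_coeffs_ne_zero hne ?_)
      simp only [Pi.sub_apply, Pi.single_eq_same, Pi.single_eq_of_ne hli, hl, hi]
      omega
  choose! ε hε hε' using key
  refine ⟨fun b => if b ∈ A then ε b else 1, fun b => ?_, fun L => ?_⟩
  · beta_reduce
    split_ifs with hb
    exacts [hε b hb, Or.inl rfl]
  · rw [cha, coeffs_cons, removable, Finset.sum_filter, ← Finset.sum_coe_sort A,
      ← Equiv.sum_comp (A.orderIsoOfFin h).toEquiv]
    refine Finset.sum_congr rfl fun i _ => ?_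
    have hi : ((A.orderIsoOfFin h).toEquiv i : ℕ) ∈ A := Subtype.property _
    rw [hε' _ hi L i (enum_apply h i)]
    beta_reduce
    rw [if_pos hi]

lemma cha_double (k : ℕ) (L : Multiset ℕ) (A : Finset ℕ) :
    (2 : ℤ) ∣ cha N (k ::ₘ k ::ₘ L) A - cha N ((2 * k) ::ₘ L) A :=
  coeffs_double k L _

lemma two_dvd_cha_sub (L : Multiset ℕ) (hL : ∀ k ∈ L, ∃ j, k = 2 ^ j) (A : Finset ℕ) :
    (2 : ℤ) ∣ cha N (Multiset.replicate L.sum 1) A - cha N L A := by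
  have hpow : ∀ (j : ℕ) (L : Multiset ℕ),
      (2 : ℤ) ∣ cha N (Multiset.replicate (2 ^ j) 1 + L) A - cha N (2 ^ j ::ₘ L) A := by
    intro j
    induction j with
    | zero => intro L; simp [Multiset.replicate_one]
    | succ j ih =>
      intro L
      have h1 := ih (Multiset.replicate (2 ^ j) 1 + L)
      have h2 := ih (2 ^ j ::ₘ L)
      have h3 := cha_double (N := N) (2 ^ j) L A
      rw [← add_assoc, ← Multiset.replicate_add] at h1
      rw [Multiset.add_cons] at h2
      rw [pow_succ, mul_two, ← two_mul (2 ^ j)]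
      rw [← two_mul (2 ^ j)] at h1
      have := dvd_add (dvd_add h1 h2) h3
      rwa [sub_add_sub_cancel, sub_add_sub_cancel] at this
  suffices h : ∀ K L : Multiset ℕ, (∀ k ∈ L, ∃ j, k = 2 ^ j) →
      (2 : ℤ) ∣ cha N (Multiset.replicate L.sum 1 + K) A - cha N (L + K) A by
    simpa using h 0 L hL
  intro K L hL
  induction L using Multiset.induction_on generalizing K with
  | empty => simp
  | cons k L ih =>
    obtain ⟨j, rfl⟩ := hL k (Multiset.mem_cons_self _ _)
    have h1 := hpow j (Multiset.replicate L.sum 1 + K)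
    have h2 := ih (2 ^ j ::ₘ K) fun k hk => hL k (Multiset.mem_cons_of_mem hk)
    rw [Multiset.add_cons, Multiset.add_cons] at h2
    rw [← add_assoc, ← Multiset.replicate_add] at h1
    rw [Multiset.sum_cons, Multiset.cons_add]
    have := dvd_add h1 h2
    rwa [sub_add_sub_cancel] at this

end BeadSets

section Levels

variable {N : ℕ}

lemma sum_range_add_card_le {A : Finset ℕ} (h : A.card = N) :
    ∑ i ∈ Finset.range N, i + (A \ Finset.range N).card ≤ ∑ a ∈ A, a := by
  have hc : (A \ Finset.range N).card = (Finset.range N \ A).card :=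
    Finset.card_sdiff_comm (by rw [h, Finset.card_range])
  rw [← Finset.sum_inter_add_sum_sdiff A (Finset.range N),
    ← Finset.sum_inter_add_sum_sdiff (Finset.range N) A, Finset.inter_comm, add_assoc]
  refine Nat.add_le_add_left ?_ _
  have h1 : (A \ Finset.range N).card • N ≤ ∑ a ∈ A \ Finset.range N, a :=
    Finset.card_nsmul_le_sum _ _ _ fun a ha => by
      simpa using (Finset.mem_sdiff.1 ha).2
  have h2 : ∑ a ∈ Finset.range N \ A, (a + 1) ≤ (Finset.range N \ A).card • N :=
    Finset.sum_le_card_nsmul _ _ _ fun a ha => by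
      simpa using (Finset.mem_sdiff.1 ha).1
  rw [Finset.sum_add_distrib, Finset.sum_const, smul_eq_mul, mul_one] at h2
  rw [← hc] at h2
  omega

lemma level_zero : level N 0 = {Finset.range N} := by
  ext A
  rw [mem_level, Finset.mem_singleton]
  constructor
  · rintro ⟨h, hs⟩
    have h1 := sum_range_add_card_le h
    have h2 : A \ Finset.range N = ∅ := by
      rw [← Finset.card_eq_zero]; omega
    exact Finset.eq_of_subset_of_card_le (Finset.sdiff_eq_empty_iff_subset.1 h2) (by simp [h])
  · rintro rfl
    simp

lemma move_mem_level {n m : ℕ} {A : Finset ℕ} {b c : ℕ} (hA : A ∈ level N n) (hb : b ∈ A)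
    (hc : c ∉ A) (h : n + c = m + b) : move A b c ∈ level N m := by
  rw [mem_level] at hA ⊢
  refine ⟨(card_move hb hc).trans hA.1, ?_⟩
  have := sum_move hb hc (fun a => a)
  omega

lemma sub_le_of_mem_level {n : ℕ} {A : Finset ℕ} {b c : ℕ} (hA : A ∈ level N n) (hb : b ∈ A)
    (hc : c ∉ A) : b ≤ n + c := by
  rw [mem_level] at hA
  have h1 := sum_range_add_card_le ((card_move hb hc).trans hA.1)
  have := sum_move hb hc (fun a => a)
  omega

lemma mem_of_mem_level {n : ℕ} {A : Finset ℕ} {p : ℕ} (hA : A ∈ level N n) (hp : p + n < N) :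
    p ∈ A := by
  by_contra h
  obtain ⟨b, hb, hbN⟩ : ∃ b ∈ A, N ≤ b := by
    by_contra! hlt
    have hsub : A ⊆ (Finset.range N).erase p := fun a ha =>
      Finset.mem_erase.2 ⟨fun hap => h (hap ▸ ha), Finset.mem_range.2 (hlt a ha)⟩
    have h1 := Finset.card_le_card hsub
    rw [Finset.card_erase_of_mem (Finset.mem_range.2 (by omega)), Finset.card_range,
      (mem_level.1 hA).1] at h1
    omega
  have := sub_le_of_mem_level hA hb h
  omega

end Levels

section Gram

open Equiv

variable {N : ℕ}

lemma coeffs_eq_zero_of_neg {L : Multiset ℕ} {α : Fin N → ℤ} {i : Fin N} (h : α i < 0) :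
    coeffs L α = 0 := by
  by_contra hne
  have := nonneg_of_coeffs_ne_zero hne i
  omega

lemma add_single_comp_perm (w : Perm (Fin N)) (α : Fin N → ℤ) (i : Fin N) (k : ℤ) :
    α ∘ w + Pi.single i k = (α + Pi.single (w i) k) ∘ w := by
  ext j
  simp [Pi.single_apply, w.injective.eq_iff]

lemma sum_small {L : Multiset ℕ} (hL : ∀ k ∈ L, 0 < k) {k l : ℕ}
    (hlN : L.sum + l ≤ N) {α : Fin N → ℤ} (hα : ∀ i, 0 ≤ α i) :
    ∑ i, (if α i < l then coeffs L (α + Pi.single i ((k : ℤ) - l)) else 0) =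
      if k = l then l * coeffs L α else 0 := by
  split_ifs with hkl
  · subst hkl
    simp only [sub_self, Pi.single_zero, add_zero]
    by_cases h0 : coeffs L α = 0
    · simp [h0]
    rw [← Finset.sum_filter, Finset.sum_const, nsmul_eq_mul]
    congr 2
    refine (Finset.card_nbij (t := Finset.range k) (fun i => (α i).toNat) (fun i hi => ?_)
      (fun i _ j _ hij => ?_) fun p hp => ?_).trans (Finset.card_range k)
    · have := (Finset.mem_filter.1 hi).2
      have := hα i
      exact Finset.mem_range.2 (show (α i).toNat < k by omega)
    · have := hα i
      have := hα j
      exact injective_of_coeffs_ne_zero h0 (by simp only at hij; omega)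
    · have hp := Finset.mem_range.1 (Finset.mem_coe.1 hp)
      obtain ⟨i, hi⟩ := exists_eq_of_coeffs_ne_zero hL h0 (p := p) (by omega)
      exact ⟨i, Finset.mem_coe.2 (Finset.mem_filter.2 ⟨Finset.mem_univ _, by omega⟩), by simp [hi]⟩
  · by_contra hne
    obtain ⟨i, -, hi⟩ := Finset.exists_ne_zero_of_sum_ne_zero hne
    have hil : α i < l := by
      by_contra h; exact hi (if_neg h)
    rw [if_pos hil] at hi
    have := hα i
    obtain ⟨j, hj⟩ := exists_eq_of_coeffs_ne_zero hL hi (p := (α i).toNat) (by omega)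
    have hji : j ≠ i := by
      rintro rfl
      rw [Pi.add_apply, Pi.single_eq_same] at hj
      omega
    rw [Pi.add_apply, Pi.single_eq_of_ne hji, add_zero, Int.toNat_of_nonneg this] at hj
    refine hne (eq_zero_of_alternating (φ := fun α : Fin N → ℤ => ∑ i, (if α i < l then
      coeffs L (α + Pi.single i ((k : ℤ) - l)) else 0)) (fun w β => ?_) hji hj)
    rw [Finset.mul_sum]
    refine Eq.trans (Finset.sum_congr rfl fun i _ => ?_) (Equiv.sum_comp w _)
    rw [add_single_comp_perm, coeffs_comp_perm, mul_ite, mul_zero]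
    rfl

lemma sum_coeffs_zero_add_single {k : ℕ} (hk : 0 < k) {α : Fin N → ℤ} (hα : ∀ i, 0 ≤ α i) :
    ∑ i, coeffs 0 (α + Pi.single i (k : ℤ)) = 0 := by
  generalize hL : (0 : Multiset ℕ) = L
  by_contra hne
  obtain ⟨i, -, hi⟩ := Finset.exists_ne_zero_of_sum_ne_zero hne
  have hi' := hi
  rw [← hL, coeffs_zero] at hi'
  obtain ⟨w, hw⟩ := exists_of_vac_ne_zero hi'
  have h1 := congrFun hw i
  rw [Pi.add_apply, Pi.single_eq_same] at h1
  have h2 := hα i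
  have h3 := (w i).2
  obtain ⟨j, hj⟩ := exists_eq_of_coeffs_ne_zero (by simp [← hL]) hi (p := (α i).toNat)
    (by rw [← hL, Multiset.sum_zero]; omega)
  have hji : j ≠ i := by
    rintro rfl
    rw [Pi.add_apply, Pi.single_eq_same] at hj
    omega
  rw [Pi.add_apply, Pi.single_eq_of_ne hji, add_zero, Int.toNat_of_nonneg h2] at hj
  have halt : ∀ (w : Perm (Fin N)) (β : Fin N → ℤ),
      ∑ i, coeffs L (β ∘ w + Pi.single i (k : ℤ)) =
        Perm.sign w * ∑ i, coeffs L (β + Pi.single i (k : ℤ)) := by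
    intro w β
    rw [Finset.mul_sum]
    refine Eq.trans (Finset.sum_congr rfl fun i _ => ?_) (Equiv.sum_comp w _)
    rw [add_single_comp_perm, coeffs_comp_perm]
  exact hne (eq_zero_of_alternating (α := α)
    (φ := fun β : Fin N → ℤ => ∑ i, coeffs L (β + Pi.single i (k : ℤ))) halt hji hj)

/-- The derivation with respect to a power sum. -/
lemma sum_coeffs_add_single {L : Multiset ℕ} (hL : ∀ k ∈ L, 0 < k) {k : ℕ} (hk : 0 < k)
    (hN : L.sum ≤ N) {α : Fin N → ℤ} (hα : ∀ i, 0 ≤ α i) :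
    ∑ i, coeffs L (α + Pi.single i (k : ℤ)) = k * L.count k * coeffs (L.erase k) α := by
  induction L using Multiset.induction_on generalizing α with
  | empty => simpa using sum_coeffs_zero_add_single hk hα
  | cons l L ih =>
    have hL' : ∀ k ∈ L, 0 < k := fun j hj => hL j (Multiset.mem_cons_of_mem hj)
    rw [Multiset.sum_cons] at hN
    have hj : ∀ j, ∑ i, coeffs L (α + Pi.single i (k : ℤ) - Pi.single j (l : ℤ)) =
        k * L.count k * coeffs (L.erase k) (α - Pi.single j (l : ℤ)) +
          if α j < l then coeffs L (α + Pi.single j ((k : ℤ) - l)) else 0 := by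
      intro j
      split_ifs with hlt
      · rw [coeffs_eq_zero_of_neg (L := L.erase k) (i := j), mul_zero, zero_add,
          Finset.sum_eq_single j]
        · rw [add_sub_assoc, ← Pi.single_sub]
        · intro i _ hij
          refine coeffs_eq_zero_of_neg (i := j) ?_
          simp only [Pi.sub_apply, Pi.add_apply, Pi.single_eq_same, Pi.single_eq_of_ne hij.symm]
          omega
        · simp
        · simp only [Pi.sub_apply, Pi.single_eq_same]
          omega
      · rw [add_zero, ← ih hL' (by omega)]
        · exact Finset.sum_congr rfl fun i _ => by rw [add_sub_right_comm]
        · intro i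
          by_cases hij : i = j
          · subst hij
            simp only [Pi.sub_apply, Pi.single_eq_same]
            omega
          · simp only [Pi.sub_apply, Pi.single_eq_of_ne hij, sub_zero]
            exact hα i
    simp only [coeffs_cons]
    rw [Finset.sum_comm, Finset.sum_congr rfl fun j _ => hj j, Finset.sum_add_distrib,
      ← Finset.mul_sum, ← coeffs_cons, sum_small hL' (by omega) hα]
    split_ifs with hkl
    · subst hkl
      rw [Multiset.erase_cons_head, Multiset.count_cons_self]
      by_cases hmem : k ∈ L
      · rw [Multiset.cons_erase hmem]
        push_cast
        ring
      · rw [Multiset.count_eq_zero_of_notMem hmem]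
        push_cast
        ring
    · rw [Multiset.erase_cons_tail _ (Ne.symm hkl), Multiset.count_cons_of_ne hkl, add_zero]

lemma finite_support_coeffs (L : Multiset ℕ) : (Function.support (coeffs (N := N) L)).Finite := by
  refine (Set.finite_Icc (0 : Fin N → ℤ)
    (fun _ => ∑ i : Fin N, ((i : ℕ) : ℤ) + L.sum)).subset fun α hα => ⟨fun i => ?_, fun i => ?_⟩
  · exact nonneg_of_coeffs_ne_zero hα i
  · rw [← sum_of_coeffs_ne_zero hα]
    exact Finset.single_le_sum (fun i _ => nonneg_of_coeffs_ne_zero hα i) (Finset.mem_univ i)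

lemma finsum_coeffs_cons (k : ℕ) (L L' : Multiset ℕ) :
    ∑ᶠ α : Fin N → ℤ, coeffs (k ::ₘ L) α * coeffs L' α =
      ∑ᶠ α : Fin N → ℤ, coeffs L α * ∑ i, coeffs L' (α + Pi.single i (k : ℤ)) := by
  have hfin : ∀ f : (Fin N → ℤ) → ℤ, (Function.support fun α => f α * coeffs L' α).Finite :=
    fun f => (finite_support_coeffs L').subset fun α hα h =>
      hα (by simp [show coeffs L' α = 0 from h])
  have hfin' : ∀ f : (Fin N → ℤ) → ℤ, (Function.support fun α => coeffs L α * f α).Finite :=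
    fun f => (finite_support_coeffs L).subset fun α hα h =>
      hα (by simp [show coeffs L α = 0 from h])
  simp only [coeffs_cons, Finset.sum_mul, Finset.mul_sum]
  rw [finsum_sum_comm _ _ fun i _ => hfin _, finsum_sum_comm _ _ fun i _ => hfin' _]
  refine Finset.sum_congr rfl fun i _ => ?_
  rw [← finsum_comp_equiv (Equiv.addRight (Pi.single i (k : ℤ) : Fin N → ℤ))]
  simp

lemma finsum_coeffs_eq {L : Multiset ℕ} (L' : Multiset ℕ) :
    ∑ᶠ α : Fin N → ℤ, coeffs L α * coeffs L' α =
      N.factorial * ∑ A ∈ level N L.sum, cha N L A * cha N L' A := by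
  let F : Finset ℕ × Perm (Fin N) → Fin N → ℤ := fun p => enum N p.1 ∘ p.2
  have hinj : Set.InjOn F
      ((level N L.sum ×ˢ Finset.univ : Finset (Finset ℕ × Perm (Fin N))) : Set _) := by
    rintro ⟨A, w⟩ h ⟨A', w'⟩ h' heq
    have hA := (mem_level.1 (Finset.mem_product.1 (Finset.mem_coe.1 h)).1).1
    have hA' := (mem_level.1 (Finset.mem_product.1 (Finset.mem_coe.1 h')).1).1
    simp only [F] at heq hA hA'
    have hsub : ∀ {A A' : Finset ℕ} {w w' : Perm (Fin N)}, A.card = N → A'.card = N →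
        enum N A ∘ w = enum N A' ∘ w' → A ⊆ A' := by
      intro A A' w w' hA hA' heq a ha
      obtain ⟨i, hi⟩ := exists_enum_eq hA ha
      have h1 := congrFun heq (w.symm i)
      simp only [Function.comp_apply, Equiv.apply_symm_apply, hi] at h1
      obtain ⟨b, hb, hb'⟩ := exists_mem_enum hA' (w' (w.symm i))
      rw [← h1] at hb'
      rwa [show a = b by exact_mod_cast hb']
    obtain rfl := (hsub hA hA' heq).antisymm (hsub hA' hA heq.symm)
    congr 1
    ext i
    have := enum_injective hA (congrFun heq i)
    rw [this]
  rw [finsum_eq_sum_of_support_subset (s := (level N L.sum ×ˢ Finset.univ).image F),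
    Finset.sum_image hinj, Finset.sum_product, Finset.mul_sum]
  · refine Finset.sum_congr rfl fun A _ => ?_
    have : ∀ w : Perm (Fin N), coeffs L (F (A, w)) * coeffs L' (F (A, w)) =
        cha N L A * cha N L' A := by
      intro w
      simp only [F, coeffs_comp_perm, cha]
      have h1 : ((Perm.sign w : ℤˣ) : ℤ) * (Perm.sign w : ℤˣ) = 1 := by
        rw [← Units.val_mul, Int.units_mul_self, Units.val_one]
      linear_combination (coeffs L (enum N A) * coeffs L' (enum N A)) * h1
    rw [Finset.sum_congr rfl fun w _ => this w, Finset.sum_const, Finset.card_univ,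
      Fintype.card_perm, Fintype.card_fin, nsmul_eq_mul]
  · intro α hα
    have hα : coeffs L α ≠ 0 := left_ne_zero_of_mul hα
    have hcard : (Finset.univ.image fun i => (α i).toNat).card = N := by
      rw [Finset.card_image_of_injective, Finset.card_univ, Fintype.card_fin]
      intro i j hij
      have h1 := nonneg_of_coeffs_ne_zero hα i
      have h2 := nonneg_of_coeffs_ne_zero hα j
      exact injective_of_coeffs_ne_zero hα (by simp only at hij; omega)
    have hsum := sum_of_coeffs_ne_zero hα
    obtain ⟨w, hw⟩ := exists_perm_enum hcard (injective_of_coeffs_ne_zero hα) fun i =>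
      ⟨(α i).toNat, Finset.mem_image_of_mem _ (Finset.mem_univ i),
        (Int.toNat_of_nonneg (nonneg_of_coeffs_ne_zero hα i)).symm⟩
    refine Finset.mem_coe.2 (Finset.mem_image.2 ⟨(_, w), Finset.mem_product.2
      ⟨mem_level.2 ⟨hcard, ?_⟩, Finset.mem_univ _⟩, hw.symm⟩)
    have h1 := sum_enum hcard (fun z => z)
    have h2 : ∑ i, enum N (Finset.univ.image fun i => (α i).toNat) i = ∑ i, α i := by
      nth_rewrite 2 [hw]
      exact (Equiv.sum_comp w _).symm
    rw [h2, hsum, Fin.sum_univ_eq_sum_range (fun i : ℕ => (i : ℤ))] at h1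
    refine Nat.cast_injective (R := ℤ) ?_
    rw [Nat.cast_add, Nat.cast_sum, Nat.cast_sum]
    exact h1.symm

lemma enum_range (N : ℕ) : enum N (Finset.range N) = fun i : Fin N => ((i : ℕ) : ℤ) := by
  have h := Finset.card_range N
  obtain ⟨w, hw⟩ := exists_perm_enum h (α := fun i : Fin N => ((i : ℕ) : ℤ))
    (fun i j hij => Fin.ext (by simpa using hij)) fun i => ⟨i, Finset.mem_range.2 i.2, rfl⟩
  have hm : StrictMono w := by
    intro i j hij
    have h1 := congrFun hw i
    have h2 := congrFun hw j
    simp only [Function.comp_apply, enum_apply h] at h1 h2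
    refine ((Finset.range N).orderEmbOfFin h).lt_iff_lt.1 ?_
    have : (i : ℕ) < j := hij
    omega
  have hw1 : (w : Fin N → Fin N) = id := by
    have := Subsingleton.elim (hm.orderIsoOfSurjective w w.surjective) (OrderIso.refl _)
    ext i
    exact congrArg (fun f : Fin N ≃o Fin N => ((f i : Fin N) : ℕ)) this
  rw [hw, hw1, Function.comp_id]

lemma cha_zero_range : cha N 0 (Finset.range N) = 1 := by
  rw [cha, enum_range, coeffs_zero, vac, Finset.sum_eq_single 1]
  · simp
  · intro w _ hw
    refine if_neg fun h => hw ?_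
    ext i
    have := congrFun h i
    simpa using (by omega : ((w i : Fin N) : ℕ) = i)
  · simp

lemma finsum_gram {L L' : Multiset ℕ} (hL : ∀ k ∈ L, 0 < k) (hL' : ∀ k ∈ L', 0 < k)
    (hs : L.sum = L'.sum) (hN : L.sum ≤ N) :
    ∑ᶠ α : Fin N → ℤ, coeffs L α * coeffs L' α =
      N.factorial * if L = L' then (zNum L : ℤ) else 0 := by
  induction L using Multiset.induction_on generalizing L' with
  | empty =>
    have h0 : L' = 0 := by
      rw [Multiset.eq_zero_iff_forall_notMem]
      intro k hk
      have := Multiset.le_sum_of_mem hk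
      have := hL' k hk
      simp at hs
      omega
    subst h0
    rw [finsum_coeffs_eq, Multiset.sum_zero, level_zero, Finset.sum_singleton, cha_zero_range,
      if_pos rfl, zNum_zero]
    rfl
  | cons k L ih =>
    have hk := hL k (Multiset.mem_cons_self _ _)
    have hpos : ∀ k ∈ L, 0 < k := fun j hj => hL j (Multiset.mem_cons_of_mem hj)
    have h1 : ∀ α : Fin N → ℤ, coeffs L α * ∑ i, coeffs L' (α + Pi.single i (k : ℤ)) =
        (k * L'.count k : ℤ) * (coeffs L α * coeffs (L'.erase k) α) := by
      intro α
      by_cases h0 : coeffs L α = 0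
      · simp [h0]
      · rw [sum_coeffs_add_single hL' hk (hs ▸ hN) (nonneg_of_coeffs_ne_zero h0)]
        ring
    rw [finsum_coeffs_cons, finsum_congr h1]
    by_cases hmem : k ∈ L'
    · obtain ⟨K, rfl⟩ := Multiset.exists_cons_of_mem hmem
      rw [← mul_finsum, Multiset.erase_cons_head]
      · rw [Multiset.sum_cons, Multiset.sum_cons] at hs
        rw [Multiset.sum_cons] at hN
        rw [ih hpos (fun j hj => hL' j (Multiset.mem_cons_of_mem hj)) (by omega) (by omega),
          Multiset.count_cons_self]
        simp only [Multiset.cons_inj_right]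
        split_ifs with h
        · subst h
          rw [zNum_cons]
          push_cast
          ring
        · ring
    · rw [Multiset.count_eq_zero_of_notMem hmem, if_neg fun h => hmem (by
        rw [← h]; exact Multiset.mem_cons_self _ _)]
      simp

theorem gram {L L' : Multiset ℕ} (hL : ∀ k ∈ L, 0 < k) (hL' : ∀ k ∈ L', 0 < k)
    (hs : L.sum = L'.sum) (hN : L.sum ≤ N) :
    ∑ A ∈ level N L.sum, cha N L A * cha N L' A = if L = L' then (zNum L : ℤ) else 0 := by
  have h := finsum_gram hL hL' hs hN
  rw [finsum_coeffs_eq] at h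
  exact mul_left_cancel₀ (by exact_mod_cast N.factorial_ne_zero) h

end Gram

section Colorings

open Equiv

variable {N : ℕ} {ι κ : Type} [Fintype ι] [Fintype κ]

/-- The number of points of each colour. -/
def content (f : ι → Fin N) : Fin N → ℤ := fun i => (Finset.univ.filter fun a => f a = i).card

lemma content_comp_equiv (f : κ → Fin N) (e : ι ≃ κ) : content (f ∘ e) = content f := by
  funext i
  refine congrArg Nat.cast (Finset.card_bij (fun a _ => e a) (fun a ha => ?_)
    (fun a _ b _ h => e.injective h) fun b hb => ⟨e.symm b, ?_, by simp⟩)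
  · simpa using ha
  · simpa using hb

lemma content_sumElim (f : ι → Fin N) (g : κ → Fin N) :
    content (Sum.elim f g) = content f + content g := by
  funext i
  simp only [content, Pi.add_apply, Finset.card_filter, Fintype.sum_sum_type, Sum.elim_inl,
    Sum.elim_inr]
  exact Nat.cast_add _ _

lemma content_const (c : Fin N) :
    content (fun _ : ι => c) = Pi.single c (Fintype.card ι : ℤ) := by
  funext i
  by_cases h : c = i
  · subst h
    simp [content]
  · simp [content, h, Ne.symm h]

/-- The colourings with prescribed content. -/
def Coloring (ι : Type) [Fintype ι] (β : Fin N → ℤ) : Type := {f : ι → Fin N // content f = β}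

instance (β : Fin N → ℤ) : MulAction (Perm ι) (Coloring ι β) where
  smul σ f := ⟨f.1 ∘ σ.symm, (content_comp_equiv _ _).trans f.2⟩
  one_smul _ := rfl
  mul_smul _ _ _ := rfl

lemma Coloring.smul_eq_iff {β : Fin N → ℤ} {σ : Perm ι} {f : Coloring ι β} :
    σ • f = f ↔ f.1 ∘ σ = f.1 := by
  have h : σ • f = f ↔ f.1 ∘ σ.symm = f.1 := Subtype.ext_iff
  rw [h]
  exact ⟨fun h => by nth_rewrite 1 [← h]; funext a; simp,
    fun h => by nth_rewrite 1 [← h]; funext a; simp⟩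

variable [DecidableEq ι] [DecidableEq κ]

/-- The alternating count of the colourings invariant under a permutation. -/
def colorSum (σ : Perm ι) (α : Fin N → ℤ) : ℤ :=
  ∑ f : ι → Fin N, if f ∘ σ = f then vac (α - content f) else 0

lemma colorSum_eq_of_equiv {σ : Perm ι} {τ : Perm κ} (e : ι ≃ κ) (h : ∀ a, e (σ a) = τ (e a))
    (α : Fin N → ℤ) : colorSum σ α = colorSum τ α := by
  refine (Fintype.sum_equiv (e.symm.arrowCongr (Equiv.refl (Fin N))) _ _ fun f => ?_).symm
  have h1 : e.symm.arrowCongr (Equiv.refl (Fin N)) f = f ∘ e := rfl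
  rw [h1, content_comp_equiv]
  refine if_congr ⟨fun hf => ?_, fun hf => ?_⟩ rfl rfl
  · funext a
    simp only [Function.comp_apply, h]
    exact congrFun hf (e a)
  · funext b
    have := congrFun hf (e.symm b)
    simpa [h] using this

lemma comp_finRotate_eq_iff {k : ℕ} {f : Fin (k + 1) → Fin N} :
    f ∘ finRotate (k + 1) = f ↔ f = fun _ => f 0 := by
  constructor
  · intro h
    funext i
    induction i using Fin.induction with
    | zero => rfl
    | succ i ih =>
      rw [← ih, ← congrFun h i.castSucc, Function.comp_apply, finRotate_apply,
        Fin.coeSucc_eq_succ]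
  · intro h
    rw [h]
    rfl

lemma colorSum_sumCongr_finRotate (k : ℕ) (τ : Perm κ) (α : Fin N → ℤ) :
    colorSum (Perm.sumCongr (finRotate (k + 1)) τ) α =
      ∑ i, colorSum τ (α - Pi.single i ((k + 1 : ℕ) : ℤ)) := by
  have h1 : ∀ (f : Fin (k + 1) → Fin N) (g : κ → Fin N),
      Sum.elim f g ∘ Perm.sumCongr (finRotate (k + 1)) τ = Sum.elim f g ↔
        f = (fun _ => f 0) ∧ g ∘ τ = g := by
    intro f g
    rw [← comp_finRotate_eq_iff, show
      ⇑(Perm.sumCongr (finRotate (k + 1)) τ) = Sum.map (finRotate (k + 1)) τ from rfl,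
      Sum.elim_comp_map]
    exact ⟨fun h => ⟨funext fun a => congrFun h (Sum.inl a),
      funext fun b => congrFun h (Sum.inr b)⟩,
      fun h => by rw [h.1, h.2]⟩
  unfold colorSum
  refine (Equiv.sum_comp (Equiv.sumArrowEquivProdArrow (Fin (k + 1)) κ (Fin N)).symm
    _).symm.trans ?_
  rw [Fintype.sum_prod_type]
  have h2 : ∀ (f : Fin (k + 1) → Fin N) (g : κ → Fin N),
      (Equiv.sumArrowEquivProdArrow (Fin (k + 1)) κ (Fin N)).symm (f, g) = Sum.elim f g :=
    fun _ _ => rfl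
  simp only [h2, h1, content_sumElim]
  have hinj : Function.Injective fun (c : Fin N) (_ : Fin (k + 1)) => c :=
    fun c d h => congrFun h 0
  refine (Finset.sum_subset (Finset.subset_univ (Finset.univ.image fun (c : Fin N)
    (_ : Fin (k + 1)) => c)) fun f _ hf => ?_).symm.trans ?_
  · refine Finset.sum_eq_zero fun g _ => if_neg fun h => hf ?_
    exact Finset.mem_image.2 ⟨f 0, Finset.mem_univ _, h.1.symm⟩
  · rw [Finset.sum_image fun c _ d _ h => hinj h]
    refine Finset.sum_congr rfl fun c _ => Finset.sum_congr rfl fun g _ => ?_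
    rw [content_const, Fintype.card_fin, sub_sub]
    simp

theorem coeffs_orbitSizes (σ : Perm ι) (α : Fin N → ℤ) :
    coeffs (orbitSizes σ) α = colorSum σ α := by
  obtain ⟨M, hM⟩ : ∃ M, orbitSizes σ = M := ⟨_, rfl⟩
  have hpos : ∀ k ∈ M, 0 < k := fun k hk => pos_of_mem_orbitSizes (hM ▸ hk)
  rw [hM]
  induction M using Multiset.induction_on generalizing ι α with
  | empty =>
    have hc := sum_orbitSizes σ
    rw [hM, Multiset.sum_zero] at hc
    have := Fintype.card_eq_zero_iff.1 hc.symm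
    rw [coeffs_zero, colorSum, Fintype.sum_unique, if_pos (Subsingleton.elim _ _)]
    congr 1
    funext i
    simp [content]
  | cons k M ih =>
    have hk := hpos k (Multiset.mem_cons_self _ _)
    have hpos' : ∀ k ∈ M, 0 < k := fun j hj => hpos j (Multiset.mem_cons_of_mem hj)
    obtain ⟨k, rfl⟩ := Nat.exists_eq_succ_of_ne_zero hk.ne'
    obtain ⟨τ, hτ⟩ := exists_orbitSizes_eq (α := Fin M.sum) M hpos' (by simp)
    have hc := sum_orbitSizes σ
    rw [hM, Multiset.sum_cons] at hc
    have e : ι ≃ Fin (k + 1) ⊕ Fin M.sum := Fintype.equivOfCardEq (by simp [← hc])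
    have hconj : IsConj (e.permCongr σ) (Perm.sumCongr (finRotate (k + 1)) τ) := by
      rw [isConj_iff_orbitSizes, orbitSizes_permCongr, orbitSizes_sumCongr, orbitSizes_finRotate,
        hM, hτ]
      rfl
    obtain ⟨g, hg⟩ := isConj_iff.1 hconj
    rw [colorSum_eq_of_equiv (e.trans g) (τ := Perm.sumCongr (finRotate (k + 1)) τ),
      colorSum_sumCongr_finRotate, coeffs_cons]
    · exact Finset.sum_congr rfl fun i _ => ih τ _ hτ hpos'
    · intro a
      rw [← hg]
      simp

instance (β : Fin N → ℤ) : Fintype (Coloring ι β) :=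
  inferInstanceAs (Fintype {f : ι → Fin N // content f = β})

instance (β : Fin N → ℤ) : DecidableEq (Coloring ι β) :=
  inferInstanceAs (DecidableEq {f : ι → Fin N // content f = β})

lemma character_ofMulAction (G X : Type) [Group G] [MulAction G X] [Fintype X] [DecidableEq X]
    (g : G) :
    (Representation.ofMulAction ℂ G X).character g =
      ((Finset.univ.filter fun x : X => g • x = x).card : ℂ) := by
  change LinearMap.trace ℂ _ _ = _
  rw [LinearMap.trace_eq_matrix_trace ℂ (MonoidAlgebra.basis X ℂ), Matrix.trace]
  rw [← Finset.sum_boole]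
  refine Finset.sum_congr rfl fun x _ => ?_
  rw [Matrix.diag_apply, LinearMap.toMatrix_apply, MonoidAlgebra.basis_apply,
    Representation.ofMulAction_single, ← MonoidAlgebra.basis_apply, Module.Basis.repr_self,
    Finsupp.single_apply]

theorem cha_orbitSizes (A : Finset ℕ) (σ : Perm ι) :
    (cha N (orbitSizes σ) A : ℂ) = ∑ w : Perm (Fin N), ((Perm.sign w : ℤ) : ℂ) *
      (Representation.ofMulAction ℂ (Perm ι)
        (Coloring ι (enum N A - fun i => (((w i : Fin N) : ℕ) : ℤ)))).character σ := by
  simp only [character_ofMulAction]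
  rw [cha, coeffs_orbitSizes, colorSum]
  have h : ∀ w : Perm (Fin N), (Finset.univ.filter fun f : Coloring ι (enum N A -
      fun i => (((w i : Fin N) : ℕ) : ℤ)) => σ • f = f).card =
      ∑ f : ι → Fin N, if f ∘ σ = f ∧ content f = enum N A - fun i => (((w i : Fin N) : ℕ) : ℤ)
        then 1 else 0 := by
    intro w
    rw [← Finset.card_filter]
    refine Finset.card_bij (fun f _ => f.1) (fun f hf => ?_) (fun f _ g _ h => Subtype.ext h)
      fun f hf => ?_
    · exact Finset.mem_filter.2 ⟨Finset.mem_univ _,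
        Coloring.smul_eq_iff.1 (Finset.mem_filter.1 hf).2, f.2⟩
    · have := (Finset.mem_filter.1 hf).2
      exact ⟨⟨f, this.2⟩, Finset.mem_filter.2 ⟨Finset.mem_univ _,
        Coloring.smul_eq_iff.2 this.1⟩, rfl⟩
  simp only [h]
  push_cast
  simp only [Finset.mul_sum]
  rw [Finset.sum_comm]
  refine Finset.sum_congr rfl fun f _ => ?_
  by_cases hf : f ∘ σ = f
  · simp only [hf, true_and, if_true, vac]
    push_cast
    refine Finset.sum_congr rfl fun w _ => ?_
    rw [mul_ite, mul_one, mul_zero]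
    refine if_congr ⟨fun h => ?_, fun h => ?_⟩ rfl rfl
    · rw [← h]; simp
    · rw [h]; simp
  · simp [hf]

end Colorings

section HookFormula

open Equiv

variable {N : ℕ}

/-- The reciprocal of the factorial, extended by zero to negative integers. -/
def invFact (z : ℤ) : ℚ := if z < 0 then 0 else ((z.toNat.factorial : ℕ) : ℚ)⁻¹

lemma invFact_natCast (a : ℕ) : invFact a = ((a.factorial : ℕ) : ℚ)⁻¹ := by
  simp [invFact]

lemma mul_invFact (z : ℤ) : z * invFact z = invFact (z - 1) := by
  rcases lt_trichotomy z 0 with h | rfl | h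
  · rw [invFact, invFact, if_pos h, if_pos (by omega), mul_zero]
  · simp [invFact]
  · obtain ⟨a, rfl⟩ : ∃ a : ℕ, z = (a + 1 : ℕ) := ⟨z.toNat - 1, by omega⟩
    rw [show (((a + 1 : ℕ) : ℤ) - 1) = (a : ℤ) by push_cast; ring, invFact_natCast,
      invFact_natCast, Nat.factorial_succ]
    have := Nat.factorial_ne_zero a
    push_cast
    field_simp

/-- The alternating sum of multinomial coefficients. -/
def detSum (α : Fin N → ℤ) : ℚ :=
  ∑ w : Perm (Fin N), ((Perm.sign w : ℤ) : ℚ) * ∏ i, invFact (α i - ((w i : Fin N) : ℕ))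

lemma sum_coe_perm (w : Perm (Fin N)) :
    ∑ i, ((((w i : Fin N) : ℕ) : ℤ)) = ∑ i : Fin N, ((i : ℕ) : ℤ) :=
  Equiv.sum_comp w fun i : Fin N => ((i : ℕ) : ℤ)

lemma detSum_eq_vac {α : Fin N → ℤ} (hα : ∑ i, α i = ∑ i : Fin N, ((i : ℕ) : ℤ)) :
    detSum α = vac α := by
  rw [detSum, vac]
  push_cast
  refine Finset.sum_congr rfl fun w _ => ?_
  split_ifs with h
  · rw [h]
    simp [invFact]
  · rw [mul_eq_zero]
    right
    by_contra hne
    refine h (funext fun i => ?_)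
    have hnn : ∀ i ∈ Finset.univ, 0 ≤ α i - ((w i : Fin N) : ℕ) := by
      intro i hi
      by_contra hlt
      exact Finset.prod_ne_zero_iff.1 hne i hi (if_pos (by omega))
    have hsum : ∑ i, (α i - ((w i : Fin N) : ℕ)) = 0 := by
      rw [Finset.sum_sub_distrib, sum_coe_perm, hα, sub_self]
    have := (Finset.sum_eq_zero_iff_of_nonneg hnn).1 hsum i (Finset.mem_univ i)
    omega

lemma sum_detSum_sub {α : Fin N → ℤ} {n : ℕ}
    (hα : ∑ i, α i = ∑ i : Fin N, ((i : ℕ) : ℤ) + n) :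
    ∑ i, detSum (α - Pi.single i 1) = n * detSum α := by
  simp only [detSum]
  rw [Finset.sum_comm, Finset.mul_sum]
  refine Finset.sum_congr rfl fun w _ => ?_
  have h : ∀ i, ∏ j, invFact ((α - Pi.single i 1 : Fin N → ℤ) j - ((w j : Fin N) : ℕ)) =
      ((α i - ((w i : Fin N) : ℕ) : ℤ) : ℚ) * ∏ j, invFact (α j - ((w j : Fin N) : ℕ)) := by
    intro i
    rw [← Finset.mul_prod_erase _ _ (Finset.mem_univ i),
      ← Finset.mul_prod_erase _ (fun j => invFact (α j - ((w j : Fin N) : ℕ))) (Finset.mem_univ i),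
      ← mul_assoc, mul_invFact]
    congr 1
    · rw [Pi.sub_apply, Pi.single_eq_same, sub_right_comm]
    · refine Finset.prod_congr rfl fun j hj => ?_
      rw [Pi.sub_apply, Pi.single_eq_of_ne (Finset.ne_of_mem_erase hj), sub_zero]
  have hs : ∑ i, ((α i - ((w i : Fin N) : ℕ) : ℤ) : ℚ) = n := by
    rw [← Int.cast_sum, Finset.sum_sub_distrib, sum_coe_perm, hα]
    simp
  simp only [h]
  rw [← Finset.mul_sum, ← Finset.sum_mul, hs]
  ring

lemma coeffs_replicate_one (n : ℕ) {α : Fin N → ℤ}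
    (hα : ∑ i, α i = ∑ i : Fin N, ((i : ℕ) : ℤ) + n) :
    (coeffs (Multiset.replicate n 1) α : ℚ) = n.factorial * detSum α := by
  induction n generalizing α with
  | zero =>
    rw [Multiset.replicate_zero, coeffs_zero, detSum_eq_vac (by simpa using hα)]
    simp
  | succ n ih =>
    rw [Multiset.replicate_succ, coeffs_cons, Int.cast_sum]
    have h : ∀ i, ∑ j, (α - Pi.single i ((1 : ℕ) : ℤ) : Fin N → ℤ) j =
        ∑ i : Fin N, ((i : ℕ) : ℤ) + n := by
      intro i
      simp only [Pi.sub_apply]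
      rw [Finset.sum_sub_distrib, hα, Finset.sum_pi_single']
      push_cast
      simp
      ring
    rw [Finset.sum_congr rfl fun i _ => ih (h i), ← Finset.mul_sum, Nat.cast_one,
      sum_detSum_sub hα, Nat.factorial_succ]
    push_cast
    ring

lemma detSum_natCast (a : Fin N → ℕ) :
    detSum (fun i => (a i : ℤ)) * ∏ i, ((a i).factorial : ℚ) =
      ∏ i, ∏ j ∈ Finset.Ioi i, ((a j : ℚ) - a i) := by
  have h : ∀ i j : Fin N, invFact ((a i : ℤ) - ((j : ℕ) : ℤ)) =
      ((a i).factorial : ℚ)⁻¹ * ((a i).descFactorial j : ℚ) := by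
    intro i j
    rcases lt_or_ge (a i) j with hlt | hle
    · rw [Nat.descFactorial_eq_zero_iff_lt.2 hlt, invFact, if_pos (by omega)]
      simp
    · rw [← Nat.cast_sub hle, invFact_natCast, ← Nat.factorial_mul_descFactorial hle]
      have h1 := Nat.factorial_ne_zero (a i - j)
      have h2 : (a i).descFactorial j ≠ 0 := by
        rw [Ne, Nat.descFactorial_eq_zero_iff_lt]; omega
      push_cast
      field_simp
  have h1 : detSum (fun i => (a i : ℤ)) =
      (Matrix.of fun i j : Fin N => ((a i).factorial : ℚ)⁻¹ *
        (Matrix.of fun i j : Fin N => ((a i).descFactorial j : ℚ)) i j).det := by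
    rw [← Matrix.det_transpose, Matrix.det_apply', detSum]
    refine Finset.sum_congr rfl fun w _ => ?_
    congr 1
    exact Finset.prod_congr rfl fun i _ => h _ _
  have h2 := Matrix.det_eval_matrixOfPolynomials_eq_det_vandermonde (fun i => (a i : ℚ))
    (fun j => descPochhammer ℚ j) (fun j => descPochhammer_natDegree ℚ j)
    fun j => monic_descPochhammer ℚ j
  simp only [descPochhammer_eval_eq_descFactorial] at h2
  rw [h1, Matrix.det_mul_column, ← h2, Matrix.det_vandermonde, mul_right_comm,
    ← Finset.prod_mul_distrib]
  have h3 : ∀ i, ((a i).factorial : ℚ)⁻¹ * (a i).factorial = 1 := fun i =>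
    inv_mul_cancel₀ (by exact_mod_cast Nat.factorial_ne_zero _)
  simp [h3]

/-- The product of the hook lengths. -/
def hookProd (A : Finset ℕ) : ℕ := ∏ b ∈ A, ∏ c ∈ Finset.range b \ A, (b - c)

lemma hookProd_pos (A : Finset ℕ) : 0 < hookProd A :=
  Finset.prod_pos fun b _ => Finset.prod_pos fun c hc => by
    have := Finset.mem_range.1 (Finset.mem_sdiff.1 hc).1
    omega

lemma prod_range_sub (b : ℕ) : ∏ c ∈ Finset.range b, (b - c) = b.factorial := by
  rw [← Finset.prod_range_add_one_eq_factorial, ← Finset.prod_range_reflect]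
  refine Finset.prod_congr rfl fun c hc => ?_
  have := Finset.mem_range.1 hc
  omega

lemma hookProd_mul (A : Finset ℕ) :
    hookProd A * ∏ b ∈ A, ∏ c ∈ A with c < b, (b - c) = ∏ b ∈ A, b.factorial := by
  rw [hookProd, ← Finset.prod_mul_distrib]
  refine Finset.prod_congr rfl fun b _ => ?_
  rw [← prod_range_sub, ← Finset.prod_sdiff (Finset.inter_subset_left : Finset.range b ∩ A ⊆ _),
    Finset.sdiff_inter_self_left]
  congr 1
  refine Finset.prod_congr ?_ fun _ _ => rfl
  ext c
  simp [and_comm]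

lemma prod_orderEmbOfFin {M : Type} [CommMonoid M] {A : Finset ℕ} (h : A.card = N) (F : ℕ → M) :
    ∏ i, F (A.orderEmbOfFin h i) = ∏ a ∈ A, F a := by
  conv_rhs => rw [← Finset.map_orderEmbOfFin_univ A h, Finset.prod_map]
  rfl

theorem cha_replicate_mul_hookProd {n : ℕ} {A : Finset ℕ} (hA : A ∈ level N n) :
    cha N (Multiset.replicate n 1) A * hookProd A = n.factorial := by
  obtain ⟨h, hs⟩ := mem_level.1 hA
  have hsum : ∑ i, enum N A i = ∑ i : Fin N, ((i : ℕ) : ℤ) + n := by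
    rw [sum_enum h fun z => z, Fin.sum_univ_eq_sum_range fun i : ℕ => (i : ℤ)]
    rw [← Nat.cast_sum, ← Nat.cast_sum, hs, Nat.cast_add]
  have he : enum N A = fun i => ((A.orderEmbOfFin h i : ℕ) : ℤ) := funext (enum_apply h)
  have h1 := coeffs_replicate_one n hsum
  have h2 := detSum_natCast (N := N) fun i => A.orderEmbOfFin h i
  rw [← he] at h2
  have h3 : ∏ i, ((A.orderEmbOfFin h i).factorial : ℚ) = ((∏ b ∈ A, b.factorial : ℕ) : ℚ) := by
    rw [prod_orderEmbOfFin h fun b => (b.factorial : ℚ)]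
    push_cast
    rfl
  have h4 : ∏ i, ∏ j ∈ Finset.Ioi i, ((A.orderEmbOfFin h j : ℚ) - A.orderEmbOfFin h i) =
      ((∏ b ∈ A, ∏ c ∈ A with c < b, (b - c) : ℕ) : ℚ) := by
    have h5 : ∏ b ∈ A, ∏ c ∈ A with c < b, (b - c) = ∏ c ∈ A, ∏ b ∈ A with c < b, (b - c) :=
      Finset.prod_comm' fun b c => by simp only [Finset.mem_filter]; tauto
    rw [h5, ← prod_orderEmbOfFin h]
    push_cast
    refine Finset.prod_congr rfl fun i _ => ?_
    rw [Finset.prod_filter, ← prod_orderEmbOfFin h]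
    simp only [(A.orderEmbOfFin h).lt_iff_lt]
    rw [← Finset.prod_filter]
    refine Finset.prod_congr (by ext j; simp) fun j hj => ?_
    rw [Nat.cast_sub ((A.orderEmbOfFin h).lt_iff_lt.2 (Finset.mem_filter.1 hj).2).le]
  rw [h3, h4, ← hookProd_mul] at h2
  have hV : ((∏ b ∈ A, ∏ c ∈ A with c < b, (b - c) : ℕ) : ℚ) ≠ 0 := by
    rw [Nat.cast_ne_zero, Finset.prod_ne_zero_iff]
    refine fun b _ => Finset.prod_ne_zero_iff.2 fun c hc => ?_
    have := (Finset.mem_filter.1 hc).2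
    omega
  have h6 : detSum (enum N A) * hookProd A = 1 := by
    rw [Nat.cast_mul, ← mul_assoc] at h2
    exact mul_right_cancel₀ hV (h2.trans (one_mul _).symm)
  have h7 : ((cha N (Multiset.replicate n 1) A : ℤ) : ℚ) * hookProd A = n.factorial := by
    rw [cha, h1, mul_assoc, h6, mul_one]
  exact_mod_cast h7

lemma cha_replicate_pos {n : ℕ} {A : Finset ℕ} (hA : A ∈ level N n) :
    0 < cha N (Multiset.replicate n 1) A := by
  have h := cha_replicate_mul_hookProd hA
  have h1 : (0 : ℤ) < n.factorial := by exact_mod_cast n.factorial_pos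
  rw [← h] at h1
  exact pos_of_mul_pos_left h1 (by positivity)

end HookFormula

section HookValuation

variable {N : ℕ}

/-- The number of hooks of length divisible by `q`. -/
def hookCount (q : ℕ) (A : Finset ℕ) : ℕ :=
  ∑ b ∈ A, ((Finset.range b \ A).filter fun c => q ∣ b - c).card

lemma factorization_eq_card_Ico {m B : ℕ} (hm : m ≠ 0) (h : m < 2 ^ B) :
    m.factorization 2 = ((Finset.Ico 1 B).filter fun k => 2 ^ k ∣ m).card := by
  have h1 : (Finset.Ico 1 B).filter (fun k => 2 ^ k ∣ m) =
      Finset.Ico 1 (m.factorization 2 + 1) := by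
    ext k
    rw [Finset.mem_filter, Finset.mem_Ico, Finset.mem_Ico,
      Nat.prime_two.pow_dvd_iff_le_factorization hm]
    have h2 : 2 ^ m.factorization 2 < 2 ^ B :=
      (Nat.le_of_dvd (Nat.pos_of_ne_zero hm) (Nat.ordProj_dvd m 2)).trans_lt h
    have := (Nat.pow_lt_pow_iff_right (by norm_num : 1 < 2)).1 h2
    omega
  rw [h1, Nat.card_Ico, Nat.add_sub_cancel]

lemma factorization_hookProd {n B : ℕ} {A : Finset ℕ} (hA : A ∈ level N n) (h : n < 2 ^ B) :
    (hookProd A).factorization 2 = ∑ k ∈ Finset.Ico 1 B, hookCount (2 ^ k) A := by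
  have hpos : ∀ b ∈ A, ∀ c ∈ Finset.range b \ A, b - c ≠ 0 ∧ b - c < 2 ^ B := by
    intro b hb c hc
    rw [Finset.mem_sdiff, Finset.mem_range] at hc
    have := sub_le_of_mem_level hA hb hc.2
    omega
  rw [hookProd, Nat.factorization_prod_apply fun b hb =>
    Finset.prod_ne_zero_iff.2 fun c hc => (hpos b hb c hc).1]
  simp only [hookCount]
  rw [Finset.sum_comm]
  refine Finset.sum_congr rfl fun b hb => ?_
  rw [Nat.factorization_prod_apply fun c hc => (hpos b hb c hc).1]
  rw [Finset.sum_congr rfl fun c hc =>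
    factorization_eq_card_Ico (hpos b hb c hc).1 (hpos b hb c hc).2]
  simp only [Finset.card_filter]
  exact Finset.sum_comm

/-- The `2`-adic valuation of the degree. -/
def degVal (N n : ℕ) (A : Finset ℕ) : ℕ :=
  (cha N (Multiset.replicate n 1) A).natAbs.factorization 2

lemma degVal_add_sum {n B : ℕ} {A : Finset ℕ} (hA : A ∈ level N n) (h : n < 2 ^ B) :
    degVal N n A + ∑ k ∈ Finset.Ico 1 B, hookCount (2 ^ k) A = ∑ k ∈ Finset.Ico 1 B, n / 2 ^ k := by
  have h1 := congrArg Int.natAbs (cha_replicate_mul_hookProd hA)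
  rw [Int.natAbs_mul, Int.natAbs_natCast, Int.natAbs_natCast] at h1
  rw [← factorization_hookProd hA h, degVal, ← Finsupp.add_apply,
    ← Nat.factorization_mul (Int.natAbs_pos.2 (cha_replicate_pos hA).ne').ne' (hookProd_pos A).ne',
    h1]
  rcases eq_or_ne n 0 with rfl | hn
  · simp
  · exact Nat.factorization_factorial Nat.prime_two (Nat.log_lt_of_lt_pow hn h)

lemma card_range_filter_dvd (b q : ℕ) :
    ((Finset.range b).filter fun c => q ∣ b - c).card = b / q := by
  rw [← Nat.Ioc_filter_dvd_card_eq_div]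
  refine Finset.card_bij (fun c _ => b - c) (fun c hc => ?_) (fun c hc d hd h => ?_) fun x hx => ?_
  · rw [Finset.mem_filter, Finset.mem_range] at hc
    rw [Finset.mem_filter, Finset.mem_Ioc]
    exact ⟨by omega, hc.2⟩
  · rw [Finset.mem_filter, Finset.mem_range] at hc hd
    omega
  · rw [Finset.mem_filter, Finset.mem_Ioc] at hx
    refine ⟨b - x, ?_, by omega⟩
    rw [Finset.mem_filter, Finset.mem_range, show b - (b - x) = x by omega]
    exact ⟨by omega, hx.2⟩

lemma two_mul_hookCount_add (q : ℕ) (A : Finset ℕ) :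
    2 * hookCount q A + ∑ b ∈ A, ∑ c ∈ A, (if b ≡ c [MOD q] then 1 else 0) =
      2 * ∑ b ∈ A, b / q + A.card := by
  have h1 : ∀ b ∈ A, ((Finset.range b \ A).filter fun c => q ∣ b - c).card +
      ∑ c ∈ A, (if c < b ∧ b ≡ c [MOD q] then 1 else 0) = b / q := by
    intro b _
    rw [← card_range_filter_dvd, ← Finset.card_filter,
      ← Finset.card_union_of_disjoint]
    · congr 1
      ext c
      simp only [Finset.mem_union, Finset.mem_filter, Finset.mem_sdiff, Finset.mem_range]
      have h2 : c < b → (b ≡ c [MOD q] ↔ q ∣ b - c) := fun hlt =>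
        ⟨fun h => (Nat.modEq_iff_dvd' hlt.le).1 h.symm,
          fun h => ((Nat.modEq_iff_dvd' hlt.le).2 h).symm⟩
      by_cases hlt : c < b
      · rw [h2 hlt]; tauto
      · tauto
    · rw [Finset.disjoint_left]
      intro c hc hc'
      exact (Finset.mem_sdiff.1 (Finset.mem_filter.1 hc).1).2 (Finset.mem_filter.1 hc').1
  have h2 : hookCount q A + ∑ b ∈ A, ∑ c ∈ A, (if c < b ∧ b ≡ c [MOD q] then 1 else 0) =
      ∑ b ∈ A, b / q := by
    rw [hookCount, ← Finset.sum_add_distrib]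
    exact Finset.sum_congr rfl h1
  have h3 : ∑ b ∈ A, ∑ c ∈ A, (if b < c ∧ b ≡ c [MOD q] then 1 else 0) =
      ∑ b ∈ A, ∑ c ∈ A, (if c < b ∧ b ≡ c [MOD q] then 1 else 0) := by
    rw [Finset.sum_comm]
    exact Finset.sum_congr rfl fun b _ => Finset.sum_congr rfl fun c _ =>
      if_congr ⟨fun h => ⟨h.1, h.2.symm⟩, fun h => ⟨h.1, h.2.symm⟩⟩ rfl rfl
  have h4 : ∑ b ∈ A, ∑ c ∈ A, (if b ≡ c [MOD q] then 1 else 0) =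
      ∑ b ∈ A, ∑ c ∈ A, (if c < b ∧ b ≡ c [MOD q] then 1 else 0) +
      ∑ b ∈ A, ∑ c ∈ A, (if b < c ∧ b ≡ c [MOD q] then 1 else 0) + A.card := by
    rw [Finset.card_eq_sum_ones, ← Finset.sum_add_distrib, ← Finset.sum_add_distrib]
    refine Finset.sum_congr rfl fun b hb => ?_
    rw [← Finset.sum_add_distrib]
    have : ∑ c ∈ A, (if b = c then 1 else 0) = 1 := by
      rw [Finset.sum_ite_eq, if_pos hb]
    rw [← this, ← Finset.sum_add_distrib]
    refine Finset.sum_congr rfl fun c _ => ?_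
    rcases lt_trichotomy b c with h | rfl | h
    · simp [h, h.not_gt, h.ne]
    · simp [Nat.ModEq.refl, hb]
    · simp [h, h.not_gt, h.ne']
  omega

lemma hookCount_move {q t b c : ℕ} (hq : 0 < q) {A : Finset ℕ} (hb : b ∈ A) (hc : c ∉ A)
    (h : b = c + q * t) : hookCount q A = hookCount q (move A b c) + t := by
  have h1 := two_mul_hookCount_add q A
  have h2 := two_mul_hookCount_add q (move A b c)
  have hbc : b ≡ c [MOD q] := by
    rw [h, Nat.ModEq, Nat.add_mul_mod_self_left]
  have hinner : ∀ a, ∑ d ∈ move A b c, (if a ≡ d [MOD q] then 1 else 0) =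
      ∑ d ∈ A, if a ≡ d [MOD q] then 1 else 0 := by
    intro a
    have := sum_move hb hc fun d => if a ≡ d [MOD q] then 1 else 0
    have h3 : (a ≡ b [MOD q] ↔ a ≡ c [MOD q]) := ⟨fun h => h.trans hbc, fun h => h.trans hbc.symm⟩
    simp only [h3] at this
    omega
  have h4 : ∑ a ∈ move A b c, ∑ d ∈ A, (if a ≡ d [MOD q] then 1 else 0) =
      ∑ a ∈ A, ∑ d ∈ A, if a ≡ d [MOD q] then 1 else 0 := by
    have := sum_move hb hc fun a => ∑ d ∈ A, if a ≡ d [MOD q] then 1 else 0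
    have h3 : ∀ d, (b ≡ d [MOD q] ↔ c ≡ d [MOD q]) := fun d =>
      ⟨fun h => hbc.symm.trans h, fun h => hbc.trans h⟩
    simp only [h3] at this
    omega
  simp only [hinner] at h2
  rw [h4, card_move hb hc] at h2
  have h5 := sum_move hb hc fun a => a / q
  have h6 : b / q = c / q + t := by rw [h, Nat.add_mul_div_left _ _ hq]
  omega

lemma hookCount_eq_zero {n q : ℕ} {A : Finset ℕ} (hA : A ∈ level N n) (h : n < q) :
    hookCount q A = 0 := by
  refine Finset.sum_eq_zero fun b hb => Finset.card_eq_zero.2 (Finset.filter_eq_empty_iff.2 ?_)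
  intro c hc hdvd
  rw [Finset.mem_sdiff, Finset.mem_range] at hc
  have := sub_le_of_mem_level hA hb hc.2
  have := Nat.le_of_dvd (by omega) hdvd
  omega

lemma degVal_move {s n : ℕ} (hn : n ≤ 2 ^ s) {A : Finset ℕ} (hA : A ∈ level N (2 ^ s + n))
    {b c : ℕ} (hb : b ∈ A) (hc : c ∉ A) (h : b = c + 2 ^ s) :
    degVal N (2 ^ s + n) A + hookCount (2 ^ (s + 1)) A =
      degVal N n (move A b c) + (2 ^ s + n) / 2 ^ (s + 1) := by
  have hA' : move A b c ∈ level N n := move_mem_level hA hb hc (by omega)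
  have hs : 2 ^ (s + 1) = 2 * 2 ^ s := by ring
  have hs2 : 2 ^ (s + 2) = 4 * 2 ^ s := by ring
  have hpos : 0 < 2 ^ s := by positivity
  have h1 := degVal_add_sum hA (B := s + 2) (by omega)
  have h2 := degVal_add_sum hA' (B := s + 1) (hn.trans_lt (by omega))
  rw [Finset.sum_Ico_succ_top (by omega), Finset.sum_Ico_succ_top (by omega : 1 ≤ s + 1)] at h1
  have h3 : ∀ k ∈ Finset.Ico 1 (s + 1), hookCount (2 ^ k) A =
      hookCount (2 ^ k) (move A b c) + 2 ^ (s - k) := by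
    intro k hk
    have := Finset.mem_Ico.1 hk
    exact hookCount_move (by positivity) hb hc (by rw [← pow_add, h]; congr 2; omega)
  have h4 : ∀ k ∈ Finset.Ico 1 (s + 1), (2 ^ s + n) / 2 ^ k = n / 2 ^ k + 2 ^ (s - k) := by
    intro k hk
    have := Finset.mem_Ico.1 hk
    rw [show 2 ^ s = 2 ^ k * 2 ^ (s - k) by rw [← pow_add]; congr 1; omega,
      Nat.mul_add_div (by positivity), add_comm]
  rw [Finset.sum_congr rfl h3, Finset.sum_congr rfl h4, Finset.sum_add_distrib,
    Finset.sum_add_distrib] at h1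
  omega

end HookValuation

section Beads

variable {N : ℕ}

lemma card_addable {n m : ℕ} {A : Finset ℕ} (hA : A ∈ level N n) (h : n + m ≤ N) :
    (addable A m).card = (removable A m).card + m := by
  have h1 : (A.filter fun b => b + m ∈ A).card = (A.filter fun b => m ≤ b ∧ b - m ∈ A).card := by
    refine Finset.card_bij (fun b _ => b + m) (fun b hb => ?_) (fun b _ c _ h => by omega)
      fun c hc => ?_
    · rw [Finset.mem_filter] at hb ⊢
      exact ⟨hb.2, by omega, by rw [Nat.add_sub_cancel]; exact hb.1⟩
    · rw [Finset.mem_filter] at hc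
      refine ⟨c - m, ?_, by omega⟩
      rw [Finset.mem_filter, Nat.sub_add_cancel hc.2.1]
      exact ⟨hc.2.2, hc.1⟩
  have h2 := Finset.card_filter_add_card_filter_not (s := A) (fun b => b + m ∈ A)
  have h3 := Finset.card_filter_add_card_filter_not (s := A) (fun b => m ≤ b)
  have h4 := Finset.card_filter_add_card_filter_not (s := A.filter fun b => m ≤ b)
    (fun b => b - m ∈ A)
  rw [Finset.filter_filter, Finset.filter_filter] at h4
  have h5 : (A.filter fun b => ¬ m ≤ b) = Finset.range m := by
    ext p
    rw [Finset.mem_filter, Finset.mem_range, not_le]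
    exact ⟨fun h => h.2, fun hp => ⟨mem_of_mem_level hA (by omega), hp⟩⟩
  rw [h5, Finset.card_range] at h3
  rw [addable, removable]
  omega

lemma hookCount_eq_add {n m : ℕ} (hm : 0 < m) {A : Finset ℕ} (hA : A ∈ level N n) (h : n < 3 * m) :
    hookCount m A = (removable A m).card + hookCount (2 * m) A := by
  rw [removable, Finset.card_filter, hookCount, hookCount, ← Finset.sum_add_distrib]
  refine Finset.sum_congr rfl fun b hb => ?_
  have h1 : (Finset.range b \ A).filter (fun c => m ∣ b - c) =
      (if m ≤ b ∧ b - m ∉ A then {b - m} else ∅) ∪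
        (Finset.range b \ A).filter fun c => 2 * m ∣ b - c := by
    ext c
    rw [Finset.mem_union, Finset.mem_filter, Finset.mem_filter, Finset.mem_sdiff, Finset.mem_range]
    constructor
    · rintro ⟨⟨hc, hcA⟩, t, ht⟩
      have hle := sub_le_of_mem_level hA hb hcA
      have ht3 : t < 3 := by
        by_contra! h3
        have := Nat.mul_le_mul_left m h3
        omega
      interval_cases t
      · omega
      · left
        have : c = b - m := by omega
        subst this
        rw [if_pos ⟨by omega, hcA⟩, Finset.mem_singleton]
      · exact Or.inr ⟨⟨hc, hcA⟩, 1, by omega⟩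
    · rintro (h1 | ⟨h1, h2⟩)
      · split_ifs at h1 with h2
        · rw [Finset.mem_singleton] at h1
          subst h1
          exact ⟨⟨by omega, h2.2⟩, 1, by omega⟩
        · simp at h1
      · exact ⟨h1, (Dvd.intro_left 2 rfl).trans h2⟩
  rw [h1, Finset.card_union_of_disjoint]
  · split_ifs <;> simp
  · split_ifs with h2
    · rw [Finset.disjoint_singleton_left, Finset.mem_filter, not_and]
      intro _ h3
      have := Nat.le_of_dvd (by omega) h3
      omega
    · exact Finset.disjoint_empty_left _

lemma sum_card_removable {n m : ℕ} (R : Finset ℕ → Prop) [DecidablePred R] :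
    ∑ A ∈ level N (m + n), ((removable A m).filter fun b => R (move A b (b - m))).card =
      ∑ A ∈ level N n with R A, (addable A m).card := by
  rw [← Finset.card_sigma, ← Finset.card_sigma]
  have hmem : ∀ A : Finset ℕ, ∀ b, b ∈ removable A m ↔ b ∈ A ∧ m ≤ b ∧ b - m ∉ A := fun A b => by
    rw [removable, Finset.mem_filter]
  have hmem' : ∀ A : Finset ℕ, ∀ b, b ∈ addable A m ↔ b ∈ A ∧ b + m ∉ A := fun A b => by
    rw [addable, Finset.mem_filter]
  refine Finset.card_nbij' (fun q => ⟨move q.1 q.2 (q.2 - m), q.2 - m⟩)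
    (fun q => ⟨move q.1 q.2 (q.2 + m), q.2 + m⟩) ?_ ?_ ?_ ?_
  · rintro ⟨A, b⟩ hq
    simp only [Finset.mem_coe, Finset.mem_sigma, Finset.mem_filter, hmem] at hq
    obtain ⟨hA, ⟨hb, hmb, hc⟩, hR⟩ := hq
    simp only [Finset.mem_coe, Finset.mem_sigma, Finset.mem_filter, hmem']
    refine ⟨⟨move_mem_level hA hb hc (by omega), hR⟩, Finset.mem_insert_self _ _, ?_⟩
    rw [Nat.sub_add_cancel hmb, move, Finset.mem_insert, not_or]
    exact ⟨fun h => hc (h ▸ hb), Finset.notMem_erase _ _⟩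
  · rintro ⟨A, b⟩ hq
    simp only [Finset.mem_coe, Finset.mem_sigma, Finset.mem_filter, hmem'] at hq
    obtain ⟨⟨hA, hR⟩, hb, hc⟩ := hq
    simp only [Finset.mem_coe, Finset.mem_sigma, Finset.mem_filter, hmem, Nat.add_sub_cancel]
    refine ⟨move_mem_level hA hb hc (by omega), ⟨Finset.mem_insert_self _ _, by omega, ?_⟩, ?_⟩
    · rw [move, Finset.mem_insert, not_or]
      exact ⟨fun h => hc (h ▸ hb), Finset.notMem_erase _ _⟩
    · rw [move_move hb hc]
      exact hR
  · rintro ⟨A, b⟩ hq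
    simp only [Finset.mem_coe, Finset.mem_sigma, Finset.mem_filter, hmem] at hq
    obtain ⟨hA, ⟨hb, hmb, hc⟩, hR⟩ := hq
    simp only [Nat.sub_add_cancel hmb, move_move hb hc]
  · rintro ⟨A, b⟩ hq
    simp only [Finset.mem_coe, Finset.mem_sigma, Finset.mem_filter, hmem'] at hq
    obtain ⟨⟨hA, hR⟩, hb, hc⟩ := hq
    simp only [Nat.add_sub_cancel, move_move hb hc]

lemma two_dvd_cha_iff {L : Multiset ℕ} (hL : ∀ k ∈ L, ∃ j, k = 2 ^ j) {n : ℕ} (hn : L.sum = n)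
    {A : Finset ℕ} (hA : A ∈ level N n) : (2 : ℤ) ∣ cha N L A ↔ degVal N n A ≠ 0 := by
  have h := two_dvd_cha_sub (N := N) L hL A
  rw [hn] at h
  have hpos := cha_replicate_pos hA
  rw [degVal, ← Nat.one_le_iff_ne_zero, ← Nat.prime_two.pow_dvd_iff_le_factorization
    (Int.natAbs_pos.2 hpos.ne').ne', pow_one]
  omega

end Beads

section CharProfile

variable {N : ℕ}

/-- The values at cycle type `M` of the characters of the symmetric group on `n` points: they are
`±1` for odd degree, `0` or `±2` for even degree, and exactly `f k` of the characters with
nonzero value have degree of `2`-adic valuation `k`. -/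
structure CharProfile (N n : ℕ) (M : Multiset ℕ) (f : ℕ → ℕ) : Prop where
  odd : ∀ A ∈ level N n, degVal N n A = 0 → (cha N M A).natAbs = 1
  even : ∀ A ∈ level N n, degVal N n A ≠ 0 → cha N M A ≠ 0 → (cha N M A).natAbs = 2
  count : ∀ k, {A ∈ level N n | cha N M A ≠ 0 ∧ degVal N n A = k}.card = f k

lemma mem_removable {A : Finset ℕ} {b k : ℕ} :
    b ∈ removable A k ↔ b ∈ A ∧ k ≤ b ∧ b - k ∉ A := by
  rw [removable, Finset.mem_filter]

lemma cha_cons_eq_zero {A : Finset ℕ} (h : A.card = N) {k : ℕ} (hk : 0 < k)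
    (hr : removable A k = ∅) (L : Multiset ℕ) : cha N (k ::ₘ L) A = 0 := by
  obtain ⟨ε, -, h1⟩ := exists_cha_cons h hk
  rw [h1, hr, Finset.sum_empty]

lemma natAbs_cha_cons {A : Finset ℕ} (h : A.card = N) {k b : ℕ} (hk : 0 < k)
    (hr : removable A k = {b}) (L : Multiset ℕ) :
    (cha N (k ::ₘ L) A).natAbs = (cha N L (move A b (b - k))).natAbs := by
  obtain ⟨ε, h0, h1⟩ := exists_cha_cons h hk
  rw [h1, hr, Finset.sum_singleton]
  rcases h0 b with h0 | h0 <;> simp [h0]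

lemma removable_eq_singleton {A : Finset ℕ} {k b : ℕ} (hb : b ∈ removable A k)
    (h : (removable A k).card ≤ 1) : removable A k = {b} :=
  Finset.eq_singleton_iff_unique_mem.2 ⟨hb, fun _ hc => Finset.card_le_one.1 h _ hc _ hb⟩

lemma card_add_four_mul_card {n : ℕ} {L : Multiset ℕ} (hL : ∀ k ∈ L, ∃ j, k = 2 ^ j)
    (hLs : L.sum = n) (hn : n ≤ N)
    (h1 : ∀ A ∈ level N n, degVal N n A = 0 → (cha N L A).natAbs = 1)
    (h2 : ∀ A ∈ level N n, degVal N n A ≠ 0 → cha N L A ≠ 0 → (cha N L A).natAbs = 2) :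
    {A ∈ level N n | cha N L A ≠ 0 ∧ degVal N n A = 0}.card +
      4 * {A ∈ level N n | cha N L A ≠ 0 ∧ degVal N n A ≠ 0}.card = zNum L := by
  have hpos : ∀ k ∈ L, 0 < k := by
    intro k hk
    obtain ⟨j, rfl⟩ := hL k hk
    positivity
  have hg := gram (N := N) hpos hpos rfl (hLs ▸ hn)
  rw [if_pos rfl, hLs] at hg
  zify
  rw [← hg, Finset.card_filter, Finset.card_filter]
  push_cast
  rw [Finset.mul_sum, ← Finset.sum_add_distrib]
  refine Finset.sum_congr rfl fun A hA => ?_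
  rw [← Int.natAbs_mul_self]
  rcases eq_or_ne (degVal N n A) 0 with hd | hd
  · have h3 := h1 A hA hd
    have h0 : cha N L A ≠ 0 := by rintro h0; simp [h0] at h3
    simp [hd, h3, h0]
  · rcases eq_or_ne (cha N L A) 0 with h0 | h0
    · simp [h0]
    · simp [hd, h0, h2 A hA hd h0]

namespace CharProfile

lemma base (hN : 2 ≤ N) : CharProfile N 2 {1, 1} (fun k => if k = 0 then 2 else 0) := by
  have hrep : (Multiset.replicate 2 1 : Multiset ℕ) = {1, 1} := rfl
  have h1 : ∀ A ∈ level N 2, cha N {1, 1} A = 1 := by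
    intro A hA
    have h2 := cha_replicate_mul_hookProd hA
    have h3 := cha_replicate_pos hA
    have hg := gram (N := N) (L := {1, 1}) (L' := {1, 1}) (by simp) (by simp) rfl
      (by simpa using hN)
    rw [if_pos rfl] at hg
    have hz : zNum {1, 1} = 2 := by decide
    have hs : ({1, 1} : Multiset ℕ).sum = 2 := rfl
    rw [hz, hs] at hg
    have h4 := Finset.single_le_sum (f := fun A => cha N {1, 1} A * cha N {1, 1} A)
      (fun B _ => mul_self_nonneg _) hA
    rw [hrep] at h3
    rw [hg] at h4
    push_cast at h4
    nlinarith
  have h2 : ∀ A ∈ level N 2, degVal N 2 A = 0 := by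
    intro A hA
    rw [degVal, hrep, h1 A hA]
    simp
  have hcard : (level N 2).card = 2 := by
    have hg := gram (N := N) (L := {1, 1}) (L' := {1, 1}) (by simp) (by simp) rfl
      (by simpa using hN)
    rw [if_pos rfl] at hg
    have hz : zNum {1, 1} = 2 := by decide
    have hs : ({1, 1} : Multiset ℕ).sum = 2 := rfl
    rw [hz, hs, Finset.sum_congr rfl fun A hA => by rw [h1 A hA]] at hg
    rw [Finset.sum_const, mul_one, nsmul_one] at hg
    exact_mod_cast hg
  refine ⟨fun A hA _ => by rw [h1 A hA]; rfl, fun A hA h => absurd (h2 A hA) h, fun k => ?_⟩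
  split_ifs with hk
  · rw [Finset.filter_true_of_mem, hcard]
    exact fun A hA => ⟨by rw [h1 A hA]; exact one_ne_zero, by rw [h2 A hA, hk]⟩
  · rw [Finset.card_eq_zero, Finset.filter_eq_empty_iff]
    rintro A hA ⟨-, h⟩
    exact hk (h ▸ h2 A hA)

variable {b n : ℕ} {M : Multiset ℕ} {f : ℕ → ℕ}

lemma add (h : CharProfile N n M f) (hM : ∀ k ∈ M, ∃ j, k = 2 ^ j) (hs : M.sum = n)
    (hn : n < 2 ^ b) (hN : 2 ^ b + n ≤ N) :
    CharProfile N (2 ^ b + n) (2 ^ b ::ₘ M) (fun k => 2 ^ b * f k) := by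
  have hm : 0 < 2 ^ b := by positivity
  have hM' : ∀ k ∈ 2 ^ b ::ₘ M, ∃ j, k = 2 ^ j := by
    intro k hk
    rcases Multiset.mem_cons.1 hk with rfl | hk
    exacts [⟨b, rfl⟩, hM k hk]
  have hs' : (2 ^ b ::ₘ M).sum = 2 ^ b + n := by rw [Multiset.sum_cons, hs]
  have key : ∀ A ∈ level N (2 ^ b + n), ∀ c ∈ removable A (2 ^ b),
      removable A (2 ^ b) = {c} ∧ move A c (c - 2 ^ b) ∈ level N n ∧
      degVal N (2 ^ b + n) A = degVal N n (move A c (c - 2 ^ b)) ∧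
      (cha N (2 ^ b ::ₘ M) A).natAbs = (cha N M (move A c (c - 2 ^ b))).natAbs := by
    intro A hA c hc
    obtain ⟨h1, h2, h3⟩ := mem_removable.1 hc
    have hmv : move A c (c - 2 ^ b) ∈ level N n := move_mem_level hA h1 h3 (by omega)
    have h4 := hookCount_eq_add hm hA (by omega)
    have h5 : hookCount (2 * 2 ^ b) A = 0 := hookCount_eq_zero hA (by omega)
    have h6 := hookCount_move hm (t := 1) h1 h3 (by omega)
    have h7 : hookCount (2 ^ b) (move A c (c - 2 ^ b)) = 0 := hookCount_eq_zero hmv hn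
    have hr := removable_eq_singleton hc (by omega)
    have h8 := degVal_move hn.le hA h1 h3 (by omega)
    rw [pow_succ', h5, Nat.div_eq_of_lt (by omega)] at h8
    exact ⟨hr, hmv, h8, natAbs_cha_cons (mem_level.1 hA).1 hm hr M⟩
  have hex : ∀ A ∈ level N (2 ^ b + n), cha N (2 ^ b ::ₘ M) A ≠ 0 → ∃ c, c ∈ removable A (2 ^ b) :=
    fun A hA h0 => Finset.nonempty_iff_ne_empty.2 fun he =>
      h0 (cha_cons_eq_zero (mem_level.1 hA).1 hm he M)
  refine ⟨fun A hA hd => ?_, fun A hA hd h0 => ?_, fun k => ?_⟩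
  · have h0 : cha N (2 ^ b ::ₘ M) A ≠ 0 := by
      intro h0
      exact (two_dvd_cha_iff hM' hs' hA).1 (h0 ▸ dvd_zero _) hd
    obtain ⟨c, hc⟩ := hex A hA h0
    obtain ⟨-, h1, h2, h3⟩ := key A hA c hc
    rw [h3]
    exact h.odd _ h1 (h2 ▸ hd)
  · obtain ⟨c, hc⟩ := hex A hA h0
    obtain ⟨-, h1, h2, h3⟩ := key A hA c hc
    rw [h3]
    refine h.even _ h1 (h2 ▸ hd) ?_
    rwa [← Int.natAbs_ne_zero, ← h3, Int.natAbs_ne_zero]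
  · rw [← h.count k]
    have h1 := sum_card_removable (N := N) (n := n) (m := 2 ^ b)
      fun A => cha N M A ≠ 0 ∧ degVal N n A = k
    have h2 : ∀ A ∈ level N n, (removable A (2 ^ b)).card = 0 := by
      intro A hA
      have := hookCount_eq_add hm hA (by omega)
      rw [hookCount_eq_zero hA hn] at this
      omega
    have h3 : ∀ A ∈ (level N n).filter fun A => cha N M A ≠ 0 ∧ degVal N n A = k,
        (addable A (2 ^ b)).card = 2 ^ b := by
      intro A hA
      rw [card_addable (Finset.mem_filter.1 hA).1 (by omega), h2 A (Finset.mem_filter.1 hA).1,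
        zero_add]
    rw [Finset.sum_congr rfl h3, Finset.sum_const, smul_eq_mul, mul_comm] at h1
    rw [← h1, Finset.card_filter]
    refine Finset.sum_congr rfl fun A hA => ?_
    rcases (removable A (2 ^ b)).eq_empty_or_nonempty with he | ⟨c, hc⟩
    · rw [he, Finset.filter_empty, Finset.card_empty,
        cha_cons_eq_zero (mem_level.1 hA).1 hm he M, if_neg fun h => h.1 rfl]
    · obtain ⟨hr, -, h2, h3⟩ := key A hA c hc
      have h4 : cha N (2 ^ b ::ₘ M) A ≠ 0 ↔ cha N M (move A c (c - 2 ^ b)) ≠ 0 := by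
        rw [← Int.natAbs_ne_zero, h3, Int.natAbs_ne_zero]
      simp only [hr, Finset.filter_singleton, h2, h4]
      split_ifs <;> rfl

set_option maxHeartbeats 1000000 in
lemma double (h : CharProfile N (2 ^ b) M f) (hM : ∀ k ∈ M, ∃ j, k = 2 ^ j) (hs : M.sum = 2 ^ b)
    (hlt : ∀ k ∈ M, k < 2 ^ b) (hf : f 0 = 2 ^ b) (hN : 2 ^ (b + 1) ≤ N) :
    CharProfile N (2 ^ (b + 1)) (2 ^ b ::ₘ M) (wreathCount (2 ^ b) f) := by
  have hm : 0 < 2 ^ b := by positivity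
  have h22 : 2 ^ (b + 1) = 2 ^ b + 2 ^ b := by ring
  have hM' : ∀ k ∈ 2 ^ b ::ₘ M, ∃ j, k = 2 ^ j := by
    intro k hk
    rcases Multiset.mem_cons.1 hk with rfl | hk
    exacts [⟨b, rfl⟩, hM k hk]
  have hs' : (2 ^ b ::ₘ M).sum = 2 ^ (b + 1) := by rw [Multiset.sum_cons, hs, h22]
  have hsingle : ∀ (s : ℕ) (A : Finset ℕ), A ∈ level N (2 ^ s) → ∀ c ∈ removable A (2 ^ s),
      degVal N (2 ^ s) A = 0 ∧ hookCount (2 ^ s) A = 1 := by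
    intro s A hA c hc
    have hpos := Nat.two_pow_pos s
    obtain ⟨h1, h2, h3⟩ := mem_removable.1 hc
    have hmv : move A c (c - 2 ^ s) ∈ level N 0 := move_mem_level hA h1 h3 (by omega)
    have h6 := hookCount_move hpos (t := 1) h1 h3 (by omega)
    rw [hookCount_eq_zero hmv hpos] at h6
    have h4 := degVal_add_sum hA (B := s + 1) (by rw [pow_succ]; omega)
    have h5 : ∀ k ∈ Finset.Ico 1 (s + 1), hookCount (2 ^ k) A = 2 ^ s / 2 ^ k := by
      intro k hk
      have hk' := Finset.mem_Ico.1 hk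
      rw [Nat.pow_div (by omega) two_pos]
      have h7 := hookCount_move (q := 2 ^ k) (t := 2 ^ (s - k)) (by positivity) h1 h3 (by
        rw [← pow_add, show k + (s - k) = s by omega]; omega)
      rw [h7, hookCount_eq_zero hmv (by positivity), zero_add]
    rw [Finset.sum_congr rfl h5] at h4
    omega
  have key : ∀ A ∈ level N (2 ^ (b + 1)), ∀ c ∈ removable A (2 ^ b),
      move A c (c - 2 ^ b) ∈ level N (2 ^ b) ∧
      (removable A (2 ^ b)).card + hookCount (2 ^ (b + 1)) A =
        hookCount (2 ^ b) (move A c (c - 2 ^ b)) + 1 ∧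
      degVal N (2 ^ (b + 1)) A + hookCount (2 ^ (b + 1)) A =
        degVal N (2 ^ b) (move A c (c - 2 ^ b)) + 1 := by
    intro A hA c hc
    obtain ⟨h1, h2, h3⟩ := mem_removable.1 hc
    rw [h22] at hA
    have h4 := hookCount_eq_add hm hA (by omega)
    have h6 := hookCount_move hm (t := 1) h1 h3 (by omega)
    have h8 := degVal_move le_rfl hA h1 h3 (by omega)
    rw [← h22, Nat.div_self (by positivity)] at h8
    rw [← pow_succ'] at h4
    exact ⟨move_mem_level hA h1 h3 (by omega), by omega, h8⟩
  have hw' : ∀ A ∈ level N (2 ^ b), hookCount (2 ^ b) A = (removable A (2 ^ b)).card := by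
    intro A hA
    have := hookCount_eq_add hm hA (by omega)
    rwa [hookCount_eq_zero hA (by omega : 2 ^ b < 2 * 2 ^ b), add_zero] at this
  have hw2 : ∀ A ∈ level N (2 ^ b), hookCount (2 ^ b) A = 0 ∨
      hookCount (2 ^ b) A = 1 ∧ degVal N (2 ^ b) A = 0 := by
    intro A hA
    rcases (removable A (2 ^ b)).eq_empty_or_nonempty with he | ⟨c, hc⟩
    · left; rw [hw' A hA, he, Finset.card_empty]
    · exact Or.inr ⟨(hsingle b A hA c hc).2, (hsingle b A hA c hc).1⟩
  have hw : ∀ A ∈ level N (2 ^ (b + 1)), hookCount (2 ^ (b + 1)) A =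
      (removable A (2 ^ (b + 1))).card := by
    intro A hA
    have h2 : 0 < 2 ^ (b + 1) := by positivity
    have := hookCount_eq_add h2 hA (by omega)
    rwa [hookCount_eq_zero hA (by omega : 2 ^ (b + 1) < 2 * 2 ^ (b + 1)), add_zero] at this
  have hw3 : ∀ A ∈ level N (2 ^ (b + 1)), hookCount (2 ^ (b + 1)) A = 0 ∨
      hookCount (2 ^ (b + 1)) A = 1 ∧ degVal N (2 ^ (b + 1)) A = 0 := by
    intro A hA
    rcases (removable A (2 ^ (b + 1))).eq_empty_or_nonempty with he | ⟨c, hc⟩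
    · left; rw [hw A hA, he, Finset.card_empty]
    · exact Or.inr ⟨(hsingle (b + 1) A hA c hc).2, (hsingle (b + 1) A hA c hc).1⟩
  have hex : ∀ A ∈ level N (2 ^ (b + 1)), cha N (2 ^ b ::ₘ M) A ≠ 0 →
      ∃ c, c ∈ removable A (2 ^ b) :=
    fun A hA h0 => Finset.nonempty_iff_ne_empty.2 fun he =>
      h0 (cha_cons_eq_zero (mem_level.1 hA).1 hm he M)
  have hne : ∀ A ∈ level N (2 ^ (b + 1)), degVal N (2 ^ (b + 1)) A = 0 →
      cha N (2 ^ b ::ₘ M) A ≠ 0 := fun A hA hd h0 =>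
    (two_dvd_cha_iff hM' hs' hA).1 (h0 ▸ dvd_zero _) hd
  have hodd : ∀ A ∈ level N (2 ^ (b + 1)), degVal N (2 ^ (b + 1)) A = 0 →
      (cha N (2 ^ b ::ₘ M) A).natAbs = 1 ∧ hookCount (2 ^ (b + 1)) A = 1 := by
    intro A hA hd
    obtain ⟨c, hc⟩ := hex A hA (hne A hA hd)
    obtain ⟨h1, h2, h3⟩ := key A hA c hc
    have h4 := hw2 _ h1
    have h5 := hw3 _ hA
    have hr := removable_eq_singleton hc (by omega)
    rw [natAbs_cha_cons (mem_level.1 hA).1 hm hr]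
    exact ⟨h.odd _ h1 (by omega), by omega⟩
  have heven : ∀ A ∈ level N (2 ^ (b + 1)), degVal N (2 ^ (b + 1)) A ≠ 0 →
      cha N (2 ^ b ::ₘ M) A ≠ 0 → (cha N (2 ^ b ::ₘ M) A).natAbs = 2 ∧
      ((∃ c, removable A (2 ^ b) = {c} ∧ degVal N (2 ^ (b + 1)) A =
          degVal N (2 ^ b) (move A c (c - 2 ^ b)) + 1 ∧
          degVal N (2 ^ b) (move A c (c - 2 ^ b)) ≠ 0) ∨ degVal N (2 ^ (b + 1)) A = 1) := by
    intro A hA hd h0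
    obtain ⟨c, hc⟩ := hex A hA h0
    obtain ⟨h1, h2, h3⟩ := key A hA c hc
    have h4 := hw2 _ h1
    have h5 := hw3 _ hA
    have h2dvd := (two_dvd_cha_iff hM' hs' hA).2 hd
    by_cases hone : (removable A (2 ^ b)).card ≤ 1
    · have hr := removable_eq_singleton hc hone
      have hY := natAbs_cha_cons (mem_level.1 hA).1 hm hr M
      have hd' : degVal N (2 ^ b) (move A c (c - 2 ^ b)) ≠ 0 := by
        intro h6
        have := h.odd _ h1 h6
        omega
      refine ⟨?_, Or.inl ⟨c, hr, by omega, hd'⟩⟩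
      rw [hY]
      exact h.even _ h1 hd' (by rwa [← Int.natAbs_ne_zero, ← hY, Int.natAbs_ne_zero])
    · refine ⟨?_, Or.inr (by omega)⟩
      have hle : (cha N (2 ^ b ::ₘ M) A).natAbs ≤ 2 := by
        obtain ⟨ε, hε, hY⟩ := exists_cha_cons (mem_level.1 hA).1 hm
        rw [hY]
        have h6 : ∀ d ∈ removable A (2 ^ b),
            |ε d * cha N M (move A d (d - 2 ^ b))| ≤ 1 := by
          intro d hd
          obtain ⟨h7, h8, h9⟩ := key A hA d hd
          have h10 := hw2 _ h7
          have h11 := h.odd _ h7 (by omega)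
          rw [abs_mul]
          have h13 : |ε d| = 1 := by rcases hε d with h12 | h12 <;> rw [h12] <;> rfl
          rw [h13, one_mul, Int.abs_eq_natAbs, h11, Nat.cast_one]
        have h7 := (Finset.abs_sum_le_sum_abs _ _).trans (Finset.sum_le_card_nsmul _ _ _ h6)
        have h8 : (removable A (2 ^ b)).card = 2 := by omega
        rw [h8, nsmul_one, Int.abs_eq_natAbs] at h7
        exact_mod_cast h7
      omega
  have htrans : ∀ p : ℕ → Prop, ∀ [DecidablePred p], ¬ p 0 →
      {A ∈ level N (2 ^ (b + 1)) | cha N (2 ^ b ::ₘ M) A ≠ 0 ∧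
        degVal N (2 ^ (b + 1)) A ≠ 0 ∧ p (degVal N (2 ^ (b + 1)) A - 1)}.card =
      2 ^ b * {A ∈ level N (2 ^ b) | cha N M A ≠ 0 ∧ p (degVal N (2 ^ b) A)}.card := by
    intro p _ hp
    have h1 := sum_card_removable (N := N) (n := 2 ^ b) (m := 2 ^ b)
      fun A => cha N M A ≠ 0 ∧ p (degVal N (2 ^ b) A)
    have h2 : ∀ A ∈ (level N (2 ^ b)).filter fun A => cha N M A ≠ 0 ∧ p (degVal N (2 ^ b) A),
        (addable A (2 ^ b)).card = 2 ^ b := by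
      intro A hA
      rw [Finset.mem_filter] at hA
      rw [card_addable hA.1 (by omega), ← hw' A hA.1]
      rcases hw2 A hA.1 with h3 | ⟨-, h3⟩
      · omega
      · exact absurd (h3 ▸ hA.2.2) hp
    rw [Finset.sum_congr rfl h2, Finset.sum_const, smul_eq_mul, mul_comm] at h1
    rw [← h1, Finset.card_filter, ← h22]
    refine Finset.sum_congr rfl fun A hA => ?_
    split_ifs with hc
    · obtain ⟨h0, hd, hpd⟩ := hc
      rcases (heven A hA hd h0).2 with ⟨c, hr, h3, h4⟩ | h3
      · have hY := natAbs_cha_cons (mem_level.1 hA).1 hm hr M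
        rw [hr, Finset.filter_singleton, if_pos, Finset.card_singleton]
        refine ⟨?_, by rwa [h3, Nat.add_sub_cancel] at hpd⟩
        rwa [← Int.natAbs_ne_zero, ← hY, Int.natAbs_ne_zero]
      · rw [h3] at hpd
        exact absurd hpd hp
    · symm
      rw [Finset.card_eq_zero, Finset.filter_eq_empty_iff]
      rintro c hcr ⟨h3, h4⟩
      obtain ⟨h5, h6, h7⟩ := key A hA c hcr
      have hd' : degVal N (2 ^ b) (move A c (c - 2 ^ b)) ≠ 0 := fun h8 => hp (h8 ▸ h4)
      have h8 := hw2 _ h5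
      have h9 : 0 < (removable A (2 ^ b)).card := Finset.card_pos.2 ⟨c, hcr⟩
      have hr := removable_eq_singleton hcr (by omega)
      have hY := natAbs_cha_cons (mem_level.1 hA).1 hm hr M
      refine hc ⟨?_, by omega, ?_⟩
      · rwa [← Int.natAbs_ne_zero, hY, Int.natAbs_ne_zero]
      · rwa [show degVal N (2 ^ (b + 1)) A - 1 = degVal N (2 ^ b) (move A c (c - 2 ^ b)) by omega]
  have hzero : {A ∈ level N (2 ^ (b + 1)) | cha N (2 ^ b ::ₘ M) A ≠ 0 ∧
      degVal N (2 ^ (b + 1)) A = 0}.card = 2 * 2 ^ b := by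
    have h1 := sum_card_removable (N := N) (n := 0) (m := 2 ^ (b + 1)) fun _ => True
    simp only [Finset.filter_true, add_zero] at h1
    have h0 : Finset.range N ∈ level N 0 := by rw [level_zero, Finset.mem_singleton]
    rw [level_zero, Finset.sum_singleton, card_addable h0 (by omega)] at h1
    have h2 : removable (Finset.range N) (2 ^ (b + 1)) = ∅ := by
      rw [Finset.eq_empty_iff_forall_notMem]
      intro c hc
      obtain ⟨h3, h4, h5⟩ := mem_removable.1 hc
      rw [Finset.mem_range] at h3 h5
      omega
    rw [h2, Finset.card_empty, zero_add] at h1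
    rw [Finset.card_filter]
    refine Eq.trans ?_ (h1.trans (pow_succ' 2 b))
    refine Finset.sum_congr rfl fun A hA => ?_
    rw [← hw A hA]
    split_ifs with hc
    · exact (hodd A hA hc.2).2.symm
    · rcases hw3 A hA with h3 | h3
      · exact h3.symm
      · exact absurd ⟨hne A hA h3.2, h3.2⟩ hc
  refine ⟨fun A hA hd => (hodd A hA hd).1, fun A hA hd h0 => (heven A hA hd h0).1, fun k => ?_⟩
  match k with
  | 0 => exact hzero
  | 1 =>
    have h1 := card_add_four_mul_card hM' hs' hN (fun A hA hd => (hodd A hA hd).1)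
      fun A hA hd h0 => (heven A hA hd h0).1
    have h2 := card_add_four_mul_card hM hs (by omega) h.odd h.even
    have h3 := htrans (fun d => d ≠ 0) (by simp)
    rw [h.count 0, hf] at h2
    rw [hzero, zNum_cons, Multiset.count_eq_zero.2 fun hmem => (hlt _ hmem).ne rfl] at h1
    have h4 : {A ∈ level N (2 ^ (b + 1)) | cha N (2 ^ b ::ₘ M) A ≠ 0 ∧
        degVal N (2 ^ (b + 1)) A ≠ 0}.card =
      {A ∈ level N (2 ^ (b + 1)) | cha N (2 ^ b ::ₘ M) A ≠ 0 ∧ degVal N (2 ^ (b + 1)) A = 1}.card +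
      {A ∈ level N (2 ^ (b + 1)) | cha N (2 ^ b ::ₘ M) A ≠ 0 ∧
        degVal N (2 ^ (b + 1)) A ≠ 0 ∧ degVal N (2 ^ (b + 1)) A - 1 ≠ 0}.card := by
      rw [← Finset.card_union_of_disjoint]
      · congr 1
        ext A
        simp only [Finset.mem_union, Finset.mem_filter]
        have : degVal N (2 ^ (b + 1)) A ≠ 0 ↔ degVal N (2 ^ (b + 1)) A = 1 ∨
          (degVal N (2 ^ (b + 1)) A ≠ 0 ∧ degVal N (2 ^ (b + 1)) A - 1 ≠ 0) := by omega
        tauto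
      · rw [Finset.disjoint_left]
        intro A hA hA'
        rw [Finset.mem_filter] at hA hA'
        omega
    rw [h4, h3, ← h2] at h1
    show _ = ((2 ^ b) ^ 2 - 2 * 2 ^ b) / 4
    rw [show (2 ^ b) ^ 2 = 2 ^ b * 2 ^ b by ring]
    have h5 : 2 ^ b * (0 + 1) * (2 ^ b + 4 * {A ∈ level N (2 ^ b) | cha N M A ≠ 0 ∧
      degVal N (2 ^ b) A ≠ 0}.card) = 2 ^ b * 2 ^ b + 4 * (2 ^ b * {A ∈ level N (2 ^ b) |
        cha N M A ≠ 0 ∧ degVal N (2 ^ b) A ≠ 0}.card) := by ring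
    omega
  | k + 2 =>
    show _ = 2 ^ b * f (k + 1)
    rw [← h.count (k + 1), ← htrans (fun d => d = k + 1) (by simp)]
    congr 1
    refine Finset.filter_congr fun A _ => ?_
    have : degVal N (2 ^ (b + 1)) A = k + 2 ↔ degVal N (2 ^ (b + 1)) A ≠ 0 ∧
      degVal N (2 ^ (b + 1)) A - 1 = k + 1 := by omega
    tauto

end CharProfile

lemma IsProfile.charProfile {n : ℕ} {M : Multiset ℕ} {f : ℕ → ℕ} (h : IsProfile n M f)
    (hN : n ≤ N) : CharProfile N n M f := by
  induction h with
  | base => exact CharProfile.base hN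
  | @double b M f h hf ih =>
    exact (ih (by rw [pow_succ] at hN; omega)).double h.two_pow_of_mem h.sum_eq h.lt_of_mem hf hN
  | @add b n M f h hn ih => exact (ih (by omega)).add h.two_pow_of_mem h.sum_eq hn hN

end CharProfile

section Symmetric

open Equiv

variable {N : ℕ} {ι : Type} [Fintype ι] [DecidableEq ι]

lemma orbitSizes_inv (σ : Perm ι) : orbitSizes σ⁻¹ = orbitSizes σ := by
  rw [orbitSizes_def, orbitSizes_def, Perm.cycleType_inv, Perm.support_inv]

lemma sum_cha_mul_cha (hN : Fintype.card ι ≤ N) (σ τ : Perm ι) :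
    ∑ A ∈ level N (Fintype.card ι), cha N (orbitSizes σ) A * cha N (orbitSizes τ) A =
      conjCount σ τ := by
  have h := gram (N := N) (L := orbitSizes σ) (L' := orbitSizes τ)
    (fun _ => pos_of_mem_orbitSizes) (fun _ => pos_of_mem_orbitSizes)
    (by rw [sum_orbitSizes, sum_orbitSizes]) (by rwa [sum_orbitSizes])
  rw [sum_orbitSizes] at h
  rw [h]
  split_ifs with hc
  · rw [conjCount_of_isConj (isConj_iff_orbitSizes.2 hc), cent_perm]
  · rw [conjCount_eq_zero (mt isConj_iff_orbitSizes.1 hc), Nat.cast_zero]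

lemma exists_int_sum_cha_mul_inv (A : Finset ℕ) {χ : Perm ι → ℂ} (hχ : χ ∈ Irr (Perm ι)) :
    ∃ a : ℤ, ∑ g, (cha N (orbitSizes g) A : ℂ) * χ g⁻¹ = Fintype.card (Perm ι) * a := by
  have hfin : ∀ w : Perm (Fin N), FiniteDimensional ℂ
      (MonoidAlgebra ℂ (Coloring ι (enum N A - fun i => (((w i : Fin N) : ℕ) : ℤ)))) :=
    fun w => Module.Finite.of_basis (MonoidAlgebra.basis _ ℂ)
  choose a ha using fun w : Perm (Fin N) =>
    exists_int_sum_mul_inv (Representation.ofMulAction ℂ (Perm ι)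
      (Coloring ι (enum N A - fun i => (((w i : Fin N) : ℕ) : ℤ)))) hχ
  refine ⟨∑ w, (Perm.sign w : ℤ) * a w, ?_⟩
  simp_rw [cha_orbitSizes, Finset.sum_mul]
  rw [Finset.sum_comm]
  push_cast
  rw [Finset.mul_sum]
  refine Finset.sum_congr rfl fun w _ => ?_
  simp_rw [mul_assoc]
  rw [← Finset.mul_sum, ha]
  ring

lemma exists_eq_cha (hN : Fintype.card ι ≤ N) {χ : Perm ι → ℂ} (hχ : χ ∈ Irr (Perm ι)) :
    ∃ A ∈ level N (Fintype.card ι), (χ = fun g => (cha N (orbitSizes g) A : ℂ)) ∧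
      ∀ B ∈ level N (Fintype.card ι),
        ∑ g, (cha N (orbitSizes g) B : ℂ) * χ g⁻¹ ≠ 0 → B = A := by
  have hcard : (Fintype.card (Perm ι) : ℂ) ≠ 0 := by exact_mod_cast Fintype.card_ne_zero
  choose a ha using fun A : Finset ℕ => exists_int_sum_cha_mul_inv (N := N) A hχ
  have hexp : ∀ τ, ∑ A ∈ level N (Fintype.card ι), (cha N (orbitSizes τ) A : ℂ) * a A = χ τ⁻¹ := by
    intro τ
    refine mul_left_cancel₀ hcard ?_
    rw [Finset.mul_sum]
    calc ∑ A ∈ level N (Fintype.card ι), (Fintype.card (Perm ι) : ℂ) *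
          ((cha N (orbitSizes τ) A : ℂ) * a A)
        = ∑ A ∈ level N (Fintype.card ι), ∑ g, (cha N (orbitSizes τ) A : ℂ) *
          (cha N (orbitSizes g) A * χ g⁻¹) := by
          refine Finset.sum_congr rfl fun A _ => ?_
          rw [← Finset.mul_sum, ha]
          ring
      _ = ∑ g, (conjCount τ g : ℂ) * χ g⁻¹ := by
          rw [Finset.sum_comm]
          refine Finset.sum_congr rfl fun g _ => ?_
          have h := congrArg (Int.cast : ℤ → ℂ) (sum_cha_mul_cha hN τ g)
          push_cast at h
          rw [← h, Finset.sum_mul]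
          exact Finset.sum_congr rfl fun A _ => by ring
      _ = _ := sum_conjCount_mul τ (fun g => χ g⁻¹) fun g h => by
          rw [← apply_conj_of_mem_Irr hχ g⁻¹ h]; simp [mul_assoc]
  have hinv : ∀ g, χ g⁻¹ = χ g := fun g => by
    rw [← hexp g, ← inv_inv g, ← hexp g⁻¹, orbitSizes_inv]
  have hsq : ∑ A ∈ level N (Fintype.card ι), a A ^ 2 = 1 := by
    have h1 : (Fintype.card (Perm ι) : ℂ) * ∑ A ∈ level N (Fintype.card ι), (a A : ℂ) ^ 2 =
        Fintype.card (Perm ι) := by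
      rw [Finset.mul_sum]
      calc ∑ A ∈ level N (Fintype.card ι), (Fintype.card (Perm ι) : ℂ) * (a A : ℂ) ^ 2
          = ∑ A ∈ level N (Fintype.card ι), ∑ g, (cha N (orbitSizes g) A * (a A : ℂ)) * χ g⁻¹ := by
            refine Finset.sum_congr rfl fun A _ => ?_
            rw [sq, ← mul_assoc, ← ha, Finset.sum_mul]
            exact Finset.sum_congr rfl fun g _ => by ring
        _ = ∑ g, χ g * χ g⁻¹ := by
            rw [Finset.sum_comm]
            simp_rw [← Finset.sum_mul, hexp]
            exact Finset.sum_congr rfl fun g _ => by rw [hinv]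
        _ = _ := by rw [sum_mul_inv_of_mem_Irr hχ hχ, if_pos rfl]
    have h2 := mul_left_cancel₀ hcard (h1.trans (mul_one _).symm)
    exact_mod_cast h2
  obtain ⟨A, hA, hA0⟩ : ∃ A ∈ level N (Fintype.card ι), a A ≠ 0 := by
    by_contra! h
    rw [Finset.sum_eq_zero fun A hA => by rw [h A hA]; rfl] at hsq
    exact zero_ne_one hsq
  have hpos : ∀ B, a B ≠ 0 → 1 ≤ a B ^ 2 := fun B hB => Int.add_one_le_of_lt (sq_pos_of_ne_zero hB)
  have huniq : ∀ B ∈ level N (Fintype.card ι), a B ≠ 0 → B = A := by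
    intro B hB hB0
    by_contra hne
    have h1 := Finset.sum_le_sum_of_subset_of_nonneg (f := fun A => a A ^ 2)
      (s := {A, B}) (t := level N (Fintype.card ι))
      (Finset.insert_subset hA (Finset.singleton_subset_iff.2 hB)) fun _ _ _ => sq_nonneg _
    rw [hsq, Finset.sum_pair (Ne.symm hne)] at h1
    linarith [hpos A hA0, hpos B hB0]
  have hval : ∀ τ, (cha N (orbitSizes τ) A : ℂ) * a A = χ τ⁻¹ := by
    intro τ
    rw [← hexp, Finset.sum_eq_single_of_mem A hA]
    intro B hB hne
    rw [not_imp_comm.1 (huniq B hB) hne, Int.cast_zero, mul_zero]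
  have hone : a A = 1 := by
    rw [Finset.sum_eq_single_of_mem A hA fun B hB hne => by
      rw [not_imp_comm.1 (huniq B hB) hne]; rfl] at hsq
    obtain ⟨d, hd, hd1⟩ := exists_apply_one_of_mem_Irr hχ
    have h1 := hval 1
    rw [inv_one, hd1, orbitSizes_one] at h1
    have h2 : cha N (Multiset.replicate (Fintype.card ι) 1) A * a A = d := by exact_mod_cast h1
    have h3 := cha_replicate_pos hA
    rcases sq_eq_one_iff.1 hsq with h | h
    · exact h
    · rw [h] at h2
      omega
  refine ⟨A, hA, ?_, fun B hB hne => huniq B hB fun h0 => hne ?_⟩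
  · funext g
    rw [← hinv, ← hval, hone, Int.cast_one, mul_one]
  · rw [ha, h0, Int.cast_zero, mul_zero]

lemma sum_cha_mul_inv_ne_zero {A : Finset ℕ} (hA : A ∈ level N (Fintype.card ι)) :
    ∑ g : Perm ι, (cha N (orbitSizes g) A : ℂ) * cha N (orbitSizes g⁻¹) A ≠ 0 := by
  simp_rw [orbitSizes_inv]
  have h : 0 < ∑ g : Perm ι, cha N (orbitSizes g) A * cha N (orbitSizes g) A := by
    refine Finset.sum_pos' (fun g _ => mul_self_nonneg _) ⟨1, Finset.mem_univ _, ?_⟩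
    rw [orbitSizes_one]
    exact mul_pos (cha_replicate_pos hA) (cha_replicate_pos hA)
  exact_mod_cast h.ne'

/-- The class functions `cha` are irreducible characters of the symmetric group. -/
lemma cha_mem_Irr (hN : Fintype.card ι ≤ N) {A : Finset ℕ} (hA : A ∈ level N (Fintype.card ι)) :
    (fun g : Perm ι => (cha N (orbitSizes g) A : ℂ)) ∈ Irr (Perm ι) := by
  have hfin : ∀ w : Perm (Fin N), FiniteDimensional ℂ
      (MonoidAlgebra ℂ (Coloring ι (enum N A - fun i => (((w i : Fin N) : ℕ) : ℤ)))) :=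
    fun w => Module.Finite.of_basis (MonoidAlgebra.basis _ ℂ)
  by_contra hc
  refine sum_cha_mul_inv_ne_zero hA (sum_mul_inv_eq_zero _ _ _ _ (cha_orbitSizes A) ?_)
  intro χ hχ
  by_contra h0
  obtain ⟨B, hB, h1, h2⟩ := exists_eq_cha hN hχ
  rw [h2 A hA h0, ← h1] at hc
  exact hc hχ

lemma cha_injOn (hN : Fintype.card ι ≤ N) {A B : Finset ℕ} (hA : A ∈ level N (Fintype.card ι))
    (hB : B ∈ level N (Fintype.card ι))
    (h : ∀ g : Perm ι, cha N (orbitSizes g) A = cha N (orbitSizes g) B) : A = B := by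
  obtain ⟨C, -, -, h2⟩ := exists_eq_cha hN (cha_mem_Irr hN hA)
  have h3 := sum_cha_mul_inv_ne_zero (ι := ι) hA
  rw [h2 A hA h3, h2 B hB]
  simpa only [h] using h3

lemma CharProfile.prof {M : Multiset ℕ} {f : ℕ → ℕ} (h : CharProfile N (Fintype.card ι) M f)
    (hN : Fintype.card ι ≤ N) {x : Perm ι} (hx : orbitSizes x = M) : Prof (Perm ι) x f := by
  subst hx
  refine ⟨{A : Finset ℕ // A ∈ (level N (Fintype.card ι)).filter fun A =>
      cha N (orbitSizes x) A ≠ 0}, inferInstance, fun A g => cha N (orbitSizes g) A.1,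
    fun A => degVal N (Fintype.card ι) A.1, ?_, ?_, ?_, ?_, ?_, ?_, ?_, ?_⟩
  · rintro ⟨A, hA⟩ ⟨B, hB⟩ hAB
    rw [Finset.mem_filter] at hA hB
    exact Subtype.ext (cha_injOn hN hA.1 hB.1 (congrFun hAB))
  · exact fun A => cha_mem_Irr hN (Finset.mem_filter.1 A.2).1
  · exact fun A g => by simp only [orbitSizes_inv]
  · intro A
    refine ⟨_, ?_, rfl⟩
    show cha N (orbitSizes (1 : Perm ι)) A.1 = _
    rw [orbitSizes_one, Int.natCast_natAbs,
      abs_of_pos (cha_replicate_pos (Finset.mem_filter.1 A.2).1)]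
  · intro A hA
    rw [Int.abs_eq_natAbs, h.odd A.1 (Finset.mem_filter.1 A.2).1 hA]
    rfl
  · intro A hA
    rw [Int.abs_eq_natAbs, h.even A.1 (Finset.mem_filter.1 A.2).1 hA (Finset.mem_filter.1 A.2).2]
    rfl
  · rw [Finset.sum_coe_sort _ fun A => cha N (orbitSizes x) A ^ 2, ← conjCount_self,
      ← sum_cha_mul_cha hN, Finset.sum_filter]
    refine Finset.sum_congr rfl fun A _ => ?_
    split_ifs with h0
    · exact sq _
    · rw [not_not.1 h0, mul_zero]
  · intro k
    rw [← h.count k, ← Finset.filter_filter, Nat.card_eq_fintype_card, Fintype.card_subtype,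
      ← Finset.card_map (Function.Embedding.subtype _)]
    congr 1
    ext A
    simp only [Finset.mem_map, Finset.mem_filter, Finset.mem_univ, true_and,
      Function.Embedding.coe_subtype, Subtype.exists, exists_and_left, exists_prop]
    constructor
    · rintro ⟨B, h1, h2, rfl⟩
      exact ⟨h2, h1⟩
    · rintro ⟨h1, h2⟩
      exact ⟨A, h2, h1, rfl⟩

theorem prof_perm {n : ℕ} {M : Multiset ℕ} {f : ℕ → ℕ} (h : IsProfile n M f)
    (hι : Fintype.card ι = n) (x : Perm ι) (hx : orbitSizes x = M) : Prof (Perm ι) x f := by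
  subst hι
  exact (h.charProfile le_rfl).prof le_rfl hx

end Symmetric

section Correspondence

variable {G H : Type} [Group G] [Group H] {x : G} {y : H} {f : ℕ → ℕ}

lemma charDeg_eq {χ : G → ℂ} {n : ℕ} (h : χ 1 = n) : charDeg χ = n := by
  rw [charDeg, h, Complex.natCast_re, Nat.floor_natCast]

/-- The `2`-adic valuation of the degree. -/
def val (χ : IrrX G x) : ℕ := (charDeg χ.1).factorization 2

lemma Prof.val_spec [Finite G] (h : Prof G x f) :
    Finite (IrrX G x) ∧ (∀ χ : IrrX G x, val χ = 0 → χ.1 x = 1 ∨ χ.1 x = -1) ∧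
      (∀ χ : IrrX G x, val χ ≠ 0 → χ.1 x = 2 ∨ χ.1 x = -2) ∧
      ∀ k, Nat.card {χ : IrrX G x // val χ = k} = f k := by
  have := Fintype.ofFinite G
  obtain ⟨I, hI, e, d, h1, h2, h3, h4, h5, h6, h7, h8⟩ := h
  have hne : ∀ i, (e i x : ℂ) ≠ 0 := by
    intro i h0
    have h0' : e i x = 0 := by exact_mod_cast h0
    rcases eq_or_ne (d i) 0 with hd | hd
    · have := h5 i hd
      simp [h0'] at this
    · have := h6 i hd
      simp [h0'] at this
  let F : I → IrrX G x := fun i => ⟨fun g => (e i g : ℂ), h2 i, hne i⟩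
  have hF : Function.Bijective F := by
    refine ⟨fun i j hij => h1 ?_, fun χ => ?_⟩
    · ext g
      have h : (e i g : ℂ) = e j g := congrFun (congrArg Subtype.val hij) g
      exact_mod_cast h
    · obtain ⟨i, hi⟩ := exists_eq_of_apply_ne_zero h1 h2 h3 x h7 χ.2.1 χ.2.2
      exact ⟨i, Subtype.ext hi.symm⟩
  have hval : ∀ i, val (F i) = d i := by
    intro i
    obtain ⟨n, hn, hd⟩ := h4 i
    rw [val, charDeg_eq (n := n) (by simp [F, hn]), hd]
  have habs : ∀ a b : ℤ, |a| = b → (a : ℂ) = b ∨ (a : ℂ) = -b := by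
    intro a b hab
    rcases abs_choice a with h | h
    · left; rw [← hab, h]
    · right; rw [← hab, h]; simp
  refine ⟨Finite.of_surjective F hF.2, fun χ hχ => ?_, fun χ hχ => ?_, fun k => ?_⟩
  · obtain ⟨i, rfl⟩ := hF.2 χ
    change (e i x : ℂ) = 1 ∨ (e i x : ℂ) = -1
    exact_mod_cast habs _ _ (h5 i (by rw [← hval, hχ]))
  · obtain ⟨i, rfl⟩ := hF.2 χ
    change (e i x : ℂ) = 2 ∨ (e i x : ℂ) = -2
    exact_mod_cast habs _ _ (h6 i (by rwa [← hval]))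
  · rw [← h8 k]
    exact (Nat.card_congr ((Equiv.ofBijective F hF).subtypeEquiv fun i => by
      rw [Equiv.ofBijective_apply, hval])).symm

lemma Prof.exists_equiv [Finite G] [Finite H] (hG : Prof G x f) (hH : Prof H y f) :
    ∃ Γ : IrrX G x ≃ IrrX H y, ∀ χ, val (Γ χ) = val χ := by
  obtain ⟨h1, -, -, h2⟩ := hG.val_spec
  obtain ⟨h3, -, -, h4⟩ := hH.val_spec
  have h5 : ∀ k, Nonempty ({χ : IrrX G x // val χ = k} ≃ {ψ : IrrX H y // val ψ = k}) :=
    fun k => Finite.card_eq.1 ((h2 k).trans (h4 k).symm)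
  refine ⟨(Equiv.sigmaFiberEquiv val).symm.trans
    ((Equiv.sigmaCongrRight fun k => (h5 k).some).trans (Equiv.sigmaFiberEquiv val)), fun χ => ?_⟩
  exact ((h5 (val χ)).some ⟨χ, rfl⟩).2

lemma Prof.apply_of_mem_IrrP' [Finite G] (h : Prof G x f) {k : ℕ} (hx : x ^ 2 ^ k = 1)
    {χ : G → ℂ} (hχ : χ ∈ IrrP' 2 G) : χ x = 1 ∨ χ x = -1 := by
  obtain ⟨V, hV, rfl, hodd⟩ := hχ
  refine h.val_spec.2.1 ⟨V.character, ⟨V, hV, rfl⟩, character_ne_zero_of_odd hx V hodd⟩ ?_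
  rw [val, charDeg_eq (FDRep.char_one V)]
  exact Nat.factorization_eq_zero_of_not_dvd hodd

lemma Prof.apply_of_notMem_IrrP' [Finite G] (h : Prof G x f) {χ : G → ℂ} (hχ : χ ∈ IrrX G x)
    (hP : χ ∉ IrrP' 2 G) : χ x = 2 ∨ χ x = -2 := by
  refine h.val_spec.2.2.1 ⟨χ, hχ⟩ fun h0 => ?_
  obtain ⟨n, hn, h1⟩ := exists_apply_one_of_mem_Irr hχ.1
  obtain ⟨V, hV, hVχ⟩ := hχ.1
  refine hP ⟨V, hV, hVχ, fun hdvd => ?_⟩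
  rw [val, charDeg_eq h1] at h0
  have h2 : Module.finrank ℂ V = n := by
    rw [← hVχ, FDRep.char_one] at h1
    exact_mod_cast h1
  rw [h2] at hdvd
  exact (Nat.prime_two.factorization_pos_of_dvd hn.ne' hdvd).ne' h0

end Correspondence

end TypeII

/-- For `n ≡ 0 (mod 8)`, `x` a picky element of Type II of `S_n` and `P` its unique
Sylow `2`-subgroup, there is a bijection `Γ : Irr^x(S_n) → Irr^x(P)` preserving
`2`-parts of degrees and values at `x` up to sign; moreover, for `H ∈ {S_n, P}`,
characters of odd degree take value `±1` at `x` and the remaining characters of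
`Irr^x(H)` take value `±2` at `x`. -/
theorem typeII_eight_dvd_case (n : ℕ) (hn : 6 ≤ n) (heven : Even n) (h8 : n % 8 = 0)
    (x : Equiv.Perm (Fin n)) (hx : IsTypeII x)
    (P : Sylow 2 (Equiv.Perm (Fin n)))
    (hxP : x ∈ (P : Subgroup (Equiv.Perm (Fin n)))) :
    (∃ Γ : ↥(IrrX (Equiv.Perm (Fin n)) x) ≃
          ↥(IrrX ↥(P : Subgroup (Equiv.Perm (Fin n))) ⟨x, hxP⟩),
      (∀ χ, pPart 2 (charDeg (Γ χ).1) = pPart 2 (charDeg χ.1)) ∧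
      (∀ χ, (Γ χ).1 ⟨x, hxP⟩ = χ.1 x ∨ (Γ χ).1 ⟨x, hxP⟩ = - χ.1 x)) ∧
    (∀ χ ∈ IrrP' 2 (Equiv.Perm (Fin n)), χ x = 1 ∨ χ x = -1) ∧
    (∀ ψ ∈ IrrP' 2 ↥(P : Subgroup (Equiv.Perm (Fin n))),
      ψ ⟨x, hxP⟩ = 1 ∨ ψ ⟨x, hxP⟩ = -1) ∧
    (∀ χ ∈ IrrX (Equiv.Perm (Fin n)) x,
      χ ∉ IrrP' 2 (Equiv.Perm (Fin n)) → χ x = 2 ∨ χ x = -2) ∧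
    (∀ ψ ∈ IrrX ↥(P : Subgroup (Equiv.Perm (Fin n))) ⟨x, hxP⟩,
      ψ ∉ IrrP' 2 ↥(P : Subgroup (Equiv.Perm (Fin n))) →
        ψ ⟨x, hxP⟩ = 2 ∨ ψ ⟨x, hxP⟩ = -2) := by
  obtain ⟨f, hf, -⟩ := TypeII.exists_isProfile (n - 2) (heven.tsub ⟨1, rfl⟩)
  rw [show n - 2 + 2 = n by omega] at hf
  have hM : TypeII.orbitSizes x = padicCycleMultiset 2 (n - 2) + Multiset.replicate 2 1 := by
    rw [← hx, TypeII.orbitSizes_def, fullCycleType, Fintype.card_fin]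
  have hS := TypeII.prof_perm hf (Fintype.card_fin n) x hM
  have hP := TypeII.prof_sylow hf (Fintype.card_fin n) P ⟨x, hxP⟩ hM
  obtain ⟨k, hk⟩ := P.isPGroup' ⟨x, hxP⟩
  have hk' : x ^ 2 ^ k = 1 := congrArg Subtype.val hk
  refine ⟨?_, fun χ => hS.apply_of_mem_IrrP' hk', fun ψ => hP.apply_of_mem_IrrP' hk,
    fun χ => hS.apply_of_notMem_IrrP', fun ψ => hP.apply_of_notMem_IrrP'⟩
  obtain ⟨Γ, hΓ⟩ := hS.exists_equiv hP
  refine ⟨Γ, fun χ => congrArg (2 ^ ·) (hΓ χ), fun χ => ?_⟩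
  obtain ⟨-, h1, h2, -⟩ := hS.val_spec
  obtain ⟨-, h3, h4, -⟩ := hP.val_spec
  rcases eq_or_ne (TypeII.val χ) 0 with h0 | h0
  · rcases h1 χ h0 with h5 | h5 <;> rcases h3 (Γ χ) (by rw [hΓ, h0]) with h6 | h6 <;>
      simp [h5, h6]
  · rcases h2 χ h0 with h5 | h5 <;> rcases h4 (Γ χ) (by rwa [hΓ]) with h6 | h6 <;>
      simp [h5, h6]

end
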